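/- Fix an integer n ≥ 1. There exists a constant c = c(n) such that for every primitive polynomial f ∈ ℤ[x_1,…,x_{n+1}] (the gcd of its coefficients is 1) of total degree d ≥ 1 which is irreducible in ℚ[x_1,…,x_{n+1}], and every integer B ≥ 2, there exists a nonzero polynomial g ∈ ℤ[x_1,…,x_{n+1}], not divisible by f, of total degree at most c · d^{4−1/n} · B^{1/d^{1/n}} · log B, which vanishes at every point x ∈ ℤ^{n+1} with f(x) = 0 and |x_i| ≤ B for all i. -/

import Mathlib

namespace AuxPoly

open Finset

/-- The primes in the interval `(Q, Y]`. -/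
def primesIoc (Q Y : ℕ) : Finset ℕ := (Ioc Q Y).filter Nat.Prime

lemma mem_primesIoc {Q Y p : ℕ} : p ∈ primesIoc Q Y ↔ (Q < p ∧ p ≤ Y) ∧ p.Prime := by
  simp [primesIoc]

lemma sum_log_primesIoc_le (Q Y : ℕ) : ∑ p ∈ primesIoc Q Y, Real.log p ≤ Real.log 4 * Y := by
  refine le_trans ?_ (Chebyshev.theta_le_log4_mul_x (x := (Y : ℝ)) (by positivity))
  rw [Chebyshev.theta_eq_sum_Icc]
  refine sum_le_sum_of_subset_of_nonneg ?_ ?_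
  · intro p hp
    rw [mem_primesIoc] at hp
    simp [hp.2, hp.1.2]
  · intro p hp _
    exact Real.log_natCast_nonneg p

lemma log_factorial_eq (n : ℕ) :
    Real.log (n.factorial) = ∑ p ∈ primesIoc 0 n, (n.factorial.factorization p) * Real.log p := by
  conv_lhs => rw [← Nat.prod_factorization_pow_eq_self (Nat.factorial_ne_zero n)]
  rw [Finsupp.prod, Nat.cast_prod, Real.log_prod]
  · simp only [Nat.cast_pow, Real.log_pow]
    refine sum_subset ?_ ?_
    · intro p hp
      rw [Nat.support_factorization, Nat.mem_primeFactors] at hp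
      rw [mem_primesIoc]
      exact ⟨⟨hp.1.pos, (hp.1.dvd_factorial).1 hp.2.1⟩, hp.1⟩
    · intro p _ hp
      rw [Finsupp.notMem_support_iff] at hp
      simp [hp]
  · intro p hp
    rw [Nat.support_factorization, Nat.mem_primeFactors] at hp
    have := hp.1.pos
    positivity

lemma sum_log_div_le (n : ℕ) (hn : 1 ≤ n) :
    ∑ p ∈ primesIoc 0 n, Real.log p / p ≤ Real.log n + Real.log 4 := by
  have h1 := log_factorial_eq n
  have h2 : Real.log (n.factorial) ≤ n * Real.log n := by
    rw [← Real.log_pow]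
    refine Real.log_le_log (by positivity) ?_
    exact_mod_cast Nat.factorial_le_pow n
  have h3 : ∀ p ∈ primesIoc 0 n, ((n : ℝ) / p - 1) * Real.log p ≤
      (n.factorial.factorization p) * Real.log p := by
    intro p hp
    rw [mem_primesIoc] at hp
    refine mul_le_mul_of_nonneg_right ?_ (Real.log_natCast_nonneg p)
    have h4 : n / p ≤ n.factorial.factorization p := by
      rw [← hp.2.pow_dvd_iff_le_factorization (Nat.factorial_ne_zero n)]
      have : p ^ (n / p) ∣ (p * (n / p)).factorial := by
        refine dvd_trans ?_ (Nat.factorial_dvd_factorial (le_refl _))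
        rw [hp.2.pow_dvd_iff_le_factorization (Nat.factorial_ne_zero _)]
        rw [Nat.factorization_factorial_mul hp.2]
        omega
      exact this.trans (Nat.factorial_dvd_factorial (Nat.mul_div_le n p))
    have h5 : (n : ℝ) / p < (n / p : ℕ) + 1 := by
      rw [← Nat.floor_div_eq_div (K := ℝ)]
      exact Nat.lt_floor_add_one _
    have h6 : ((n / p : ℕ) : ℝ) ≤ n.factorial.factorization p := by exact_mod_cast h4
    linarith
  have h4 := sum_le_sum h3
  rw [← h1] at h4
  have h5 := sum_log_primesIoc_le 0 n
  have h6 : ∑ p ∈ primesIoc 0 n, ((n : ℝ) / p - 1) * Real.log p =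
      n * ∑ p ∈ primesIoc 0 n, Real.log p / p - ∑ p ∈ primesIoc 0 n, Real.log p := by
    rw [mul_sum, ← sum_sub_distrib]
    exact sum_congr rfl fun p _ => by ring
  have hn' : (0 : ℝ) < n := by exact_mod_cast hn
  have : (n : ℝ) * ∑ p ∈ primesIoc 0 n, Real.log p / p ≤ n * (Real.log n + Real.log 4) := by
    linarith
  exact le_of_mul_le_mul_left this hn'

lemma exists_le_sum_log_div : ∃ C : ℝ, ∀ n : ℕ, 1 ≤ n →
    Real.log n - C ≤ ∑ p ∈ primesIoc 0 n, Real.log p / p := by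
  have hs : Summable fun m : ℕ => 1 / (m : ℝ) ^ (3 / 2 : ℝ) :=
    Real.summable_one_div_nat_rpow.2 (by norm_num)
  refine ⟨1 + ∑' m : ℕ, 4 * (1 / (m : ℝ) ^ (3 / 2 : ℝ)), fun n hn => ?_⟩
  have hn' : (0 : ℝ) < n := by exact_mod_cast hn
  have h1 := log_factorial_eq n
  have h2 : n * Real.log n - n ≤ Real.log (n.factorial) := by
    have := Stirling.le_log_factorial_stirling (n := n) (by omega)
    have h3 : 0 ≤ Real.log n := Real.log_natCast_nonneg n
    have h4 : 0 ≤ Real.log (2 * Real.pi) := Real.log_nonneg (by nlinarith [Real.pi_gt_three])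
    linarith
  have h3 : ∀ p ∈ primesIoc 0 n, (n.factorial.factorization p) * Real.log p ≤
      n * (Real.log p / p + 4 * (1 / (p : ℝ) ^ (3 / 2 : ℝ))) := by
    intro p hp
    rw [mem_primesIoc] at hp
    have hp2 : (2 : ℝ) ≤ p := by exact_mod_cast hp.2.two_le
    have h4 : (n.factorial.factorization p : ℝ) ≤ n / (p - 1) := by
      have := Nat.factorization_factorial_le_div_pred hp.2 n
      have h5 : ((n.factorial.factorization p : ℕ) : ℝ) ≤ ((n / (p - 1) : ℕ) : ℝ) := by
        exact_mod_cast this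
      refine h5.trans (Nat.cast_div_le.trans ?_)
      rw [Nat.cast_sub hp.2.one_le]; simp
    have h5 : Real.log p ≤ 2 * (p : ℝ) ^ (1 / 2 : ℝ) := by
      have := Real.log_le_rpow_div (x := (p : ℝ)) (by positivity) (ε := 1 / 2) (by norm_num)
      linarith
    have h6 : 0 ≤ Real.log p := Real.log_natCast_nonneg p
    calc _ ≤ n / ((p : ℝ) - 1) * Real.log p := by gcongr
      _ = n * (Real.log p / p + Real.log p / (p * (p - 1))) := by
        have : (p : ℝ) - 1 ≠ 0 := by linarith
        field_simp
        ring
      _ ≤ _ := by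
        gcongr
        calc Real.log p / (p * ((p : ℝ) - 1)) ≤ 2 * (p : ℝ) ^ (1 / 2 : ℝ) / (p * (p / 2)) := by
              gcongr
              linarith
          _ = 4 * ((p : ℝ) ^ (1 / 2 : ℝ) / p ^ (2 : ℝ)) := by
              norm_num
              field_simp
              ring
          _ = _ := by
              rw [← Real.rpow_sub (by positivity), one_div ((p : ℝ) ^ _),
                ← Real.rpow_neg (by positivity)]
              norm_num
  have h4 := sum_le_sum h3
  rw [← h1, ← mul_sum, sum_add_distrib] at h4
  have h5 : ∑ p ∈ primesIoc 0 n, 4 * (1 / (p : ℝ) ^ (3 / 2 : ℝ)) ≤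
      ∑' m : ℕ, 4 * (1 / (m : ℝ) ^ (3 / 2 : ℝ)) :=
    (hs.mul_left 4).sum_le_tsum _ fun m _ => by positivity
  have h6 : n * (Real.log n - 1) ≤ n * (∑ p ∈ primesIoc 0 n, Real.log p / p +
      ∑ p ∈ primesIoc 0 n, 4 * (1 / (p : ℝ) ^ (3 / 2 : ℝ))) := by linarith
  have h7 := le_of_mul_le_mul_left h6 hn'
  linarith

lemma primesIoc_union {Q Y Z : ℕ} (h1 : Q ≤ Y) (h2 : Y ≤ Z) :
    primesIoc Q Z = primesIoc Q Y ∪ primesIoc Y Z := by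
  rw [primesIoc, primesIoc, primesIoc, ← filter_union, Ioc_union_Ioc_eq_Ioc h1 h2]

lemma disjoint_primesIoc (Q Y Z : ℕ) : Disjoint (primesIoc Q Y) (primesIoc Y Z) := by
  rw [Finset.disjoint_left]
  intro p hp hp'
  rw [mem_primesIoc] at hp hp'
  omega

/-- A lower bound in the style of Mertens for sums over primes in an interval. -/
lemma exists_log_div_le_sum : ∃ C : ℝ, ∀ Q Y : ℕ, 1 ≤ Q → Q ≤ Y →
    Real.log (Y / Q) - C ≤ ∑ p ∈ primesIoc Q Y, Real.log p / p := by
  obtain ⟨C, hC⟩ := exists_le_sum_log_div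
  refine ⟨C + Real.log 4, fun Q Y hQ hY => ?_⟩
  have h1 := hC Y (hQ.trans hY)
  have h2 := sum_log_div_le Q hQ
  rw [primesIoc_union (Nat.zero_le Q) hY, sum_union (disjoint_primesIoc _ _ _)] at h1
  have hQ' : (0 : ℝ) < Q := by exact_mod_cast hQ
  have hY' : (0 : ℝ) < Y := by exact_mod_cast (hQ.trans hY)
  rw [Real.log_div hY'.ne' hQ'.ne']
  linarith

lemma sum_log_div_mul_sqrt_block (Q : ℕ) (hQ : 1 ≤ Q) (j : ℕ) :
    ∑ p ∈ primesIoc (4 ^ j * Q) (4 ^ (j + 1) * Q), Real.log p / (p * √p) ≤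
      4 * Real.log 4 / √Q * (1 / 2) ^ j := by
  have hQ' : (0 : ℝ) < Q := by exact_mod_cast hQ
  have h0 : √((4 : ℝ) ^ j * Q) = 2 ^ j * √Q := by
    rw [Real.sqrt_mul (by positivity), show (4 : ℝ) ^ j = (2 ^ j) ^ 2 by
      rw [← pow_mul, mul_comm, pow_mul]; norm_num, Real.sqrt_sq (by positivity)]
  calc _ ≤ ∑ p ∈ primesIoc (4 ^ j * Q) (4 ^ (j + 1) * Q),
        Real.log p / ((4 ^ j * Q) * (2 ^ j * √Q)) := by
        refine sum_le_sum fun p hp => ?_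
        rw [mem_primesIoc] at hp
        have h1 : ((4 : ℝ) ^ j * Q) ≤ p := by exact_mod_cast hp.1.1.le
        have h2 : 2 ^ j * √Q ≤ √p := by
          rw [← h0]; exact Real.sqrt_le_sqrt h1
        have := Real.log_natCast_nonneg p
        gcongr
    _ ≤ Real.log 4 * (4 ^ (j + 1) * Q) / ((4 ^ j * Q) * (2 ^ j * √Q)) := by
        rw [← sum_div]
        gcongr
        have := sum_log_primesIoc_le (4 ^ j * Q) (4 ^ (j + 1) * Q)
        push_cast at this
        exact this
    _ = _ := by
        rw [one_div, inv_pow]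
        field_simp
        ring

lemma sum_log_div_mul_sqrt_le (Q Y : ℕ) (hQ : 1 ≤ Q) :
    ∑ p ∈ primesIoc Q Y, Real.log p / (p * √p) ≤ 8 * Real.log 4 / √Q := by
  have key : ∀ J : ℕ, ∑ p ∈ primesIoc Q (4 ^ J * Q), Real.log p / (p * √p) ≤
      4 * Real.log 4 / √Q * ∑ j ∈ range J, (1 / 2 : ℝ) ^ j := by
    intro J
    induction J with
    | zero => simp [primesIoc]
    | succ J ih =>
      rw [primesIoc_union (Nat.le_mul_of_pos_left Q (by positivity : 0 < 4 ^ J))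
        (Nat.mul_le_mul_right Q (Nat.pow_le_pow_right (by norm_num) (Nat.le_succ J))),
        sum_union (disjoint_primesIoc _ _ _), sum_range_succ, mul_add]
      exact add_le_add ih (sum_log_div_mul_sqrt_block Q hQ J)
  have h1 : ∑ p ∈ primesIoc Q Y, Real.log p / (p * √p) ≤
      ∑ p ∈ primesIoc Q (4 ^ Y * Q), Real.log p / (p * √p) := by
    refine sum_le_sum_of_subset_of_nonneg ?_ ?_
    · intro p hp
      rw [mem_primesIoc] at hp ⊢
      have h3 : Y < 4 ^ Y := Nat.lt_pow_self (by norm_num)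
      have h4 : 4 ^ Y ≤ 4 ^ Y * Q := Nat.le_mul_of_pos_right _ hQ
      exact ⟨⟨hp.1.1, by omega⟩, hp.2⟩
    · intro p _ _
      have := Real.log_natCast_nonneg p
      positivity
  refine h1.trans ((key Y).trans ?_)
  have h2 : ∑ j ∈ range Y, (1 / 2 : ℝ) ^ j ≤ 2 := by
    refine (Summable.sum_le_tsum _ (fun _ _ => by positivity) summable_geometric_two).trans ?_
    rw [tsum_geometric_two]
  have h3 : 0 ≤ 4 * Real.log 4 / √Q := by
    have := Real.log_nonneg (by norm_num : (1 : ℝ) ≤ 4)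
    positivity
  calc _ ≤ 4 * Real.log 4 / √Q * 2 := by gcongr
    _ = _ := by ring

lemma sum_log_div_of_dvd_le (N Q Y : ℕ) (hN : N ≠ 0) (hQ : 1 ≤ Q) :
    ∑ p ∈ (primesIoc Q Y).filter (· ∣ N), Real.log p / p ≤ Real.log N / Q := by
  have hQ' : (0 : ℝ) < Q := by exact_mod_cast hQ
  have h1 : ∑ p ∈ (primesIoc Q Y).filter (· ∣ N), Real.log p ≤ Real.log N := by
    rw [← Real.log_prod]
    · refine Real.log_le_log ?_ ?_
      · refine prod_pos fun p hp => ?_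
        rw [mem_filter, mem_primesIoc] at hp
        exact_mod_cast hp.1.2.pos
      · have : ∏ p ∈ (primesIoc Q Y).filter (· ∣ N), p ∣ N := by
          refine Finset.prod_primes_dvd N ?_ ?_
          · intro p hp
            rw [mem_filter, mem_primesIoc] at hp
            exact hp.1.2.prime
          · intro p hp
            exact (mem_filter.1 hp).2
        have h3 := Nat.le_of_dvd (Nat.pos_of_ne_zero hN) this
        rw [← Nat.cast_prod]
        exact_mod_cast h3
    · intro p hp
      rw [mem_filter, mem_primesIoc] at hp
      exact_mod_cast hp.1.2.pos.ne'
  calc _ ≤ ∑ p ∈ (primesIoc Q Y).filter (· ∣ N), Real.log p / Q := by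
        refine sum_le_sum fun p hp => ?_
        rw [mem_filter, mem_primesIoc] at hp
        have h2 : (Q : ℝ) ≤ p := by exact_mod_cast hp.1.1.1.le
        have := Real.log_natCast_nonneg p
        gcongr
    _ ≤ _ := by
        rw [← sum_div]
        gcongr

end AuxPoly

namespace AuxPoly

open Polynomial

section WeightedDegree

variable {R : Type*} [CommRing R]

/-- `BiDegLE m q` says that the bivariate polynomial `q` has total degree at most `m`. -/
def BiDegLE (m : ℕ) (q : R[X][X]) : Prop := ∀ i j, (q.coeff i).coeff j ≠ 0 → i + j ≤ m

lemma BiDegLE.mono {m m' : ℕ} {q : R[X][X]} (h : BiDegLE m q) (hm : m ≤ m') : BiDegLE m' q :=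
  fun i j hij => (h i j hij).trans hm

lemma BiDegLE.zero (m : ℕ) : BiDegLE m (0 : R[X][X]) := fun i j h => by simp at h

lemma BiDegLE.add {m : ℕ} {q r : R[X][X]} (hq : BiDegLE m q) (hr : BiDegLE m r) :
    BiDegLE m (q + r) := by
  intro i j h
  rw [coeff_add, coeff_add] at h
  by_cases h1 : (q.coeff i).coeff j = 0
  · exact hr i j (by simpa [h1] using h)
  · exact hq i j h1

lemma BiDegLE.neg {m : ℕ} {q : R[X][X]} (hq : BiDegLE m q) : BiDegLE m (-q) := by
  intro i j h
  exact hq i j (by simpa using h)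

lemma BiDegLE.sub {m : ℕ} {q r : R[X][X]} (hq : BiDegLE m q) (hr : BiDegLE m r) :
    BiDegLE m (q - r) := by
  rw [sub_eq_add_neg]
  exact hq.add hr.neg

lemma BiDegLE.sum {m : ℕ} {ι : Type*} (s : Finset ι) (q : ι → R[X][X])
    (hq : ∀ i ∈ s, BiDegLE m (q i)) : BiDegLE m (∑ i ∈ s, q i) := by
  classical
  induction s using Finset.induction_on with
  | empty => simpa using BiDegLE.zero m
  | insert a s ha ih =>
    rw [Finset.sum_insert ha]
    exact (hq a (by simp)).add (ih fun i hi => hq i (by simp [hi]))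

lemma BiDegLE.mul {m m' : ℕ} {q r : R[X][X]} (hq : BiDegLE m q) (hr : BiDegLE m' r) :
    BiDegLE (m + m') (q * r) := by
  intro i j h
  rw [coeff_mul, finsetSum_coeff] at h
  obtain ⟨⟨i1, i2⟩, hi, h⟩ := Finset.exists_ne_zero_of_sum_ne_zero h
  rw [coeff_mul] at h
  obtain ⟨⟨j1, j2⟩, hj, h⟩ := Finset.exists_ne_zero_of_sum_ne_zero h
  rw [Finset.HasAntidiagonal.mem_antidiagonal] at hi hj
  have h1 := hq i1 j1 (left_ne_zero_of_mul h)
  have h2 := hr i2 j2 (right_ne_zero_of_mul h)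
  simp only at hi hj
  omega

lemma BiDegLE.one (m : ℕ) : BiDegLE m (1 : R[X][X]) := by
  intro i j h
  rw [coeff_one] at h
  split_ifs at h with hi
  · rw [coeff_one] at h
    split_ifs at h with hj
    · omega
    · simp at h
  · simp at h

lemma BiDegLE.pow {m : ℕ} {q : R[X][X]} (hq : BiDegLE m q) (n : ℕ) : BiDegLE (n * m) (q ^ n) := by
  induction n with
  | zero => simpa using BiDegLE.one _
  | succ n ih => rw [pow_succ, Nat.succ_mul]; exact ih.mul hq

lemma BiDegLE.monomial {n l : ℕ} (c : R[X]) (hc : c.natDegree ≤ l) :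
    BiDegLE (n + l) (Polynomial.monomial n c) := by
  intro i j h
  rw [coeff_monomial] at h
  split_ifs at h with hi
  · have := le_natDegree_of_ne_zero h
    omega
  · simp at h

lemma BiDegLE.natDegree_le {m : ℕ} {q : R[X][X]} (hq : BiDegLE m q) : q.natDegree ≤ m := by
  rw [natDegree_le_iff_coeff_eq_zero]
  intro i hi
  ext j
  by_contra h
  have := hq i j (by simpa using h)
  omega

lemma BiDegLE.natDegree_coeff_le {m : ℕ} {q : R[X][X]} (hq : BiDegLE m q) (i : ℕ) :
    (q.coeff i).natDegree ≤ m - i := by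
  rw [natDegree_le_iff_coeff_eq_zero]
  intro j hj
  by_contra h
  have := hq i j h
  omega

lemma BiDegLE.derivative {m : ℕ} {q : R[X][X]} (hq : BiDegLE m q) :
    BiDegLE m (Polynomial.derivative q) := by
  intro i j h
  have h1 : (q.coeff (i + 1)).coeff j ≠ 0 := by
    intro h0
    apply h
    rw [coeff_derivative]
    have : ((i : R[X]) + 1) = C ((i : R) + 1) := by simp
    rw [this, coeff_mul_C, h0, zero_mul]
  have := hq _ _ h1
  omega

lemma BiDegLE.modByMonic [Nontrivial R] {d m : ℕ} {F q : R[X][X]} (hq : BiDegLE m q)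
    (hF : F.Monic) (hd : F.natDegree = d) (hFd : BiDegLE d F) : BiDegLE m (q %ₘ F) := by
  induction hN : q.natDegree using Nat.strong_induction_on generalizing q with
  | _ N ih =>
    by_cases h : q.degree < F.degree
    · rwa [(modByMonic_eq_self_iff hF).2 h]
    by_cases hN0 : N = 0
    · have hq0 : q ≠ 0 := by
        rintro rfl
        rw [degree_zero] at h
        exact h (bot_lt_iff_ne_bot.2 (by rw [ne_eq, degree_eq_bot]; exact hF.ne_zero))
      have h1 : F.natDegree = 0 := by
        have := natDegree_le_natDegree (not_lt.1 h)
        omega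
      have h2 : F = 1 := by
        exact hF.natDegree_eq_zero.1 h1
      rw [h2, modByMonic_one]
      exact BiDegLE.zero m
    have hq0 : q ≠ 0 := by rintro rfl; simp at hN; omega
    have hle : d ≤ N := by
      have := natDegree_le_natDegree (not_lt.1 h)
      omega
    have hNm : N ≤ m := hN ▸ hq.natDegree_le
    set r := Polynomial.monomial (N - d) q.leadingCoeff with hr
    have hrm : BiDegLE (m - d) r := by
      have := BiDegLE.monomial (n := N - d) (l := m - N) q.leadingCoeff
        (by rw [leadingCoeff, hN]; exact hq.natDegree_coeff_le N)
      exact this.mono (by omega)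
    have hq' : BiDegLE m (q - F * r) := hq.sub ((hFd.mul hrm).mono (by omega))
    have hlt : (q - F * r).natDegree < N := by
      rw [← hN]
      by_cases h0 : q - F * r = 0
      · rw [h0, natDegree_zero]
        omega
      · refine natDegree_lt_natDegree h0 ?_
        rw [hr, ← C_mul_X_pow_eq_monomial, ← hN, ← hd]
        exact div_wf_lemma ⟨not_lt.1 h, hq0⟩ hF
    have := ih _ hlt hq' rfl
    have h3 : (q - F * r) %ₘ F = q %ₘ F := by
      rw [sub_modByMonic, (modByMonic_eq_zero_iff_dvd hF).2 (dvd_mul_right F r), sub_zero]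
    rwa [h3] at this

end WeightedDegree

section Bezout

variable {k : Type*} [Field k]

lemma natDegree_det_le {d e : ℕ} (M : Matrix (Fin d) (Fin d) k[X])
    (hM : ∀ i j l, (M i j).coeff l ≠ 0 → (i : ℕ) + l ≤ e + j) : M.det.natDegree ≤ d * e := by
  rw [Matrix.det_apply]
  refine natDegree_sum_le_of_forall_le _ _ fun σ _ => ?_
  refine (natDegree_smul_le _ _).trans ?_
  by_cases h0 : ∏ i, M (σ i) i = 0
  · simp [h0]
  rw [natDegree_prod _ _ (fun i hi => (Finset.prod_ne_zero_iff.1 h0) i hi)]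
  have h1 : ∀ i, (M (σ i) i).natDegree + (σ i : ℕ) ≤ e + i := by
    intro i
    have := hM (σ i) i (M (σ i) i).natDegree (by
      rw [coeff_natDegree, leadingCoeff_ne_zero]
      exact (Finset.prod_ne_zero_iff.1 h0) i (Finset.mem_univ i))
    omega
  have h2 := Finset.sum_le_sum fun i (_ : i ∈ Finset.univ) => h1 i
  rw [Finset.sum_add_distrib, Finset.sum_add_distrib,
    Equiv.sum_comp σ (fun i : Fin d => (i : ℕ))] at h2
  simp at h2
  exact h2

/-- A form of Bézout's theorem: a surjective linear map that kills the ideal `(F, G)` has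
target of dimension at most `deg F * deg G`. -/
lemma finrank_le_of_surjective {d e : ℕ} {F G : k[X][X]} (hF : F.Monic) (hd : F.natDegree = d)
    (hFd : BiDegLE d F) (hirr : Irreducible F) (hG : BiDegLE e G) (hFG : ¬ F ∣ G)
    {W : Type*} [AddCommGroup W] [Module k W]
    (Φ : k[X][X] →ₗ[k] W) (hΦ : Function.Surjective Φ) (h1 : ∀ u, Φ (F * u) = 0)
    (h2 : ∀ u, Φ (G * u) = 0) : Module.finrank k W ≤ d * e := by
  subst hd
  have hprime : Prime F := hirr.prime
  have : IsDomain (AdjoinRoot F) := AdjoinRoot.isDomain_of_prime hprime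
  set g : AdjoinRoot F := AdjoinRoot.mk F G with hg
  have hg0 : g ≠ 0 := by rwa [hg, ne_eq, AdjoinRoot.mk_eq_zero]
  let b := AdjoinRoot.powerBasisAux' hF
  have hfr := finrank_quotient_span_eq_natDegree_norm (F := k) b hg0
  have hI : Ideal.span {g} ≠ ⊥ := by simpa using hg0
  have : Module.Finite k (AdjoinRoot F ⧸ Ideal.span {g}) :=
    Module.Finite.equiv (Ideal.quotientEquivDirectSum k b hI).symm
  have hnorm : (Algebra.norm k[X] g).natDegree ≤ F.natDegree * e := by
    rw [Algebra.norm_eq_matrix_det b]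
    refine natDegree_det_le (d := F.natDegree) _ fun i j l h => ?_
    rw [Algebra.leftMulMatrix_eq_repr_mul] at h
    have h3 : b.repr (g * b j) i = ((G * X ^ (j : ℕ)) %ₘ F).coeff i := by
      have hb : b j = AdjoinRoot.mk F (X ^ (j : ℕ)) := by
        have := (AdjoinRoot.powerBasis' hF).basis_eq_pow j
        rw [map_pow, AdjoinRoot.mk_X]
        exact this
      rw [hb, hg, ← map_mul, AdjoinRoot.powerBasisAux'_repr_apply_to_fun,
        AdjoinRoot.modByMonicHom_mk]
    rw [h3] at h
    have h4 : BiDegLE (e + j) (G * X ^ (j : ℕ)) := by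
      refine hG.mul ?_
      rw [← monomial_one_right_eq_X_pow]
      exact BiDegLE.monomial (l := 0) 1 (by simp)
    exact (h4.modByMonic hF rfl hFd) _ _ h
  let q1 : k[X][X] →ₗ[k] AdjoinRoot F ⧸ Ideal.span {g} :=
    ((Ideal.Quotient.mkₐ k (Ideal.span {g})).comp
        (AdjoinRoot.mkₐ F |>.restrictScalars k)).toLinearMap
  have hq1 : Function.Surjective q1 :=
    (Ideal.Quotient.mk_surjective).comp AdjoinRoot.mk_surjective
  have hker : LinearMap.ker q1 ≤ LinearMap.ker Φ := by
    intro u hu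
    rw [LinearMap.mem_ker] at hu ⊢
    have hu' : AdjoinRoot.mk F u ∈ Ideal.span {g} := Ideal.Quotient.eq_zero_iff_mem.1 hu
    obtain ⟨v, hv⟩ := Ideal.mem_span_singleton'.1 hu'
    obtain ⟨v, rfl⟩ := AdjoinRoot.mk_surjective v
    rw [hg, ← map_mul, ← sub_eq_zero, ← map_sub, AdjoinRoot.mk_eq_zero] at hv
    obtain ⟨w, hw⟩ := hv
    have : u = G * v - F * w := by rw [← hw]; ring
    rw [this, map_sub, h1, h2, sub_zero]
  let Ψ : (AdjoinRoot F ⧸ Ideal.span {g}) →ₗ[k] W :=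
    ((LinearMap.ker q1).liftQ Φ hker).comp (q1.quotKerEquivOfSurjective hq1).symm.toLinearMap
  have hΨ : Function.Surjective Ψ := by
    intro w
    obtain ⟨u, rfl⟩ := hΦ w
    refine ⟨q1 u, ?_⟩
    have h3 : (q1.quotKerEquivOfSurjective hq1).symm (q1 u) = Submodule.Quotient.mk u := by
      rw [LinearEquiv.symm_apply_eq]
      rfl
    change (LinearMap.ker q1).liftQ Φ hker ((q1.quotKerEquivOfSurjective hq1).symm (q1 u)) = _
    rw [h3]
    rfl
  refine (LinearMap.finrank_le_finrank_of_surjective hΨ).trans ?_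
  rw [hfr]
  exact hnorm

end Bezout

section Derivation

variable {k R : Type*} [CommRing k] [CommRing R] [Algebra k R]

/-- The iterate `D^r` of a derivation as a linear map. -/
noncomputable def iter (D : Derivation k R R) (r : ℕ) : R →ₗ[k] R := (D : Module.End k R) ^ r

@[simp] lemma iter_zero (D : Derivation k R R) (q : R) : iter D 0 q = q := rfl

lemma iter_succ (D : Derivation k R R) (r : ℕ) (q : R) : iter D (r + 1) q = iter D r (D q) := by
  rw [iter, pow_succ]
  rfl

/-- `q` vanishes to order `l` along the derivation `D` at the point given by `ev`. -/
def VanishTo (D : Derivation k R R) (ev : R →+* k) (l : ℕ) (q : R) : Prop :=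
  ∀ r < l, ev (iter D r q) = 0

variable {D : Derivation k R R} {ev : R →+* k}

lemma VanishTo.mono {l l' : ℕ} {q : R} (h : VanishTo D ev l q) (hl : l' ≤ l) :
    VanishTo D ev l' q := fun r hr => h r (hr.trans_le hl)

lemma vanishTo_zero (q : R) : VanishTo D ev 0 q := fun r hr => absurd hr (Nat.not_lt_zero r)

lemma vanishTo_succ {l : ℕ} {q : R} :
    VanishTo D ev (l + 1) q ↔ ev q = 0 ∧ VanishTo D ev l (D q) := by
  constructor
  · intro h
    exact ⟨h 0 (Nat.succ_pos l), fun r hr => by rw [← iter_succ]; exact h (r + 1) (by omega)⟩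
  · rintro ⟨h1, h2⟩ r hr
    cases r with
    | zero => exact h1
    | succ r => rw [iter_succ]; exact h2 r (by omega)

lemma VanishTo.add {l : ℕ} {q q' : R} (h : VanishTo D ev l q) (h' : VanishTo D ev l q') :
    VanishTo D ev l (q + q') := fun r hr => by rw [map_add, map_add, h r hr, h' r hr, add_zero]

lemma VanishTo.eval_eq_zero {l : ℕ} {q : R} (h : VanishTo D ev l q) (hl : 0 < l) : ev q = 0 :=
  h 0 hl

lemma VanishTo.deriv {l : ℕ} {q : R} (h : VanishTo D ev l q) : VanishTo D ev (l - 1) (D q) := by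
  cases l with
  | zero => exact vanishTo_zero _
  | succ l => exact (vanishTo_succ.1 h).2

lemma VanishTo.mul {i j : ℕ} {a b : R} (ha : VanishTo D ev i a) (hb : VanishTo D ev j b) :
    VanishTo D ev (i + j) (a * b) := by
  induction hn : i + j generalizing i j a b with
  | zero => exact vanishTo_zero _
  | succ m ih =>
    rw [vanishTo_succ]
    refine ⟨?_, ?_⟩
    · rw [map_mul]
      rcases Nat.eq_zero_or_pos i with hi | hi
      · rw [hb.eval_eq_zero (by omega), mul_zero]
      · rw [ha.eval_eq_zero hi, zero_mul]
    · rw [D.leibniz, smul_eq_mul, smul_eq_mul]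
      refine VanishTo.add ?_ ?_
      · rcases Nat.eq_zero_or_pos j with hj | hj
        · exact ih (ha.mono (Nat.sub_le i 1)) (vanishTo_zero (D b)) (by omega)
        · exact ih ha hb.deriv (by omega)
      · rcases Nat.eq_zero_or_pos i with hi | hi
        · exact ih (hb.mono (Nat.sub_le j 1)) (vanishTo_zero (D a)) (by omega)
        · exact ih hb ha.deriv (by omega)

lemma VanishTo.mul_left {j : ℕ} {b : R} (a : R) (hb : VanishTo D ev j b) :
    VanishTo D ev j (a * b) := by
  simpa using (vanishTo_zero (D := D) (ev := ev) a).mul hb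

lemma VanishTo.mul_right {j : ℕ} {b : R} (hb : VanishTo D ev j b) (a : R) :
    VanishTo D ev j (b * a) := by
  rw [mul_comm]; exact hb.mul_left a

lemma VanishTo.iter_mul {i : ℕ} {q : R} (hq : VanishTo D ev i q) (u : R) :
    ev (iter D i (u * q)) = ev u * ev (iter D i q) := by
  induction i generalizing q u with
  | zero => simp
  | succ i ih =>
    rw [iter_succ, iter_succ, D.leibniz, smul_eq_mul, smul_eq_mul, map_add, map_add,
      ih hq.deriv, (hq.mul_right (D u)) i (Nat.lt_succ_self i), add_zero]

lemma vanishTo_pow {T : R} (hT : ev T = 0) (i : ℕ) : VanishTo D ev i (T ^ i) := by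
  induction i with
  | zero => exact vanishTo_zero _
  | succ i ih =>
    rw [pow_succ]
    refine ih.mul ?_
    intro r hr
    obtain rfl : r = 0 := by omega
    exact hT

lemma iter_pow {T : R} (hT : ev T = 0) (i : ℕ) :
    ev (iter D i (T ^ i)) = i.factorial * ev (D T) ^ i := by
  induction i with
  | zero => simp
  | succ i ih =>
    rw [iter_succ, D.leibniz_pow, Nat.add_sub_cancel, smul_eq_mul, mul_comm (T ^ i), map_nsmul,
      map_nsmul, (vanishTo_pow hT i).iter_mul, ih, Nat.factorial_succ, pow_succ, nsmul_eq_mul]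
    push_cast
    ring

lemma iter_mul_of_const {c : R} (hc : D c = 0) (r : ℕ) (q : R) :
    iter D r (c * q) = c * iter D r q := by
  induction r generalizing q with
  | zero => simp
  | succ r ih => rw [iter_succ, iter_succ, D.leibniz, hc, smul_zero, add_zero, smul_eq_mul, ih]

end Derivation

section Bivariate

variable {k : Type*} [CommRing k]

/-- Differentiation with respect to the outer variable. -/
noncomputable def dX : Derivation k k[X][X] k[X][X] :=
  (Polynomial.derivative' : Derivation k[X] k[X][X] k[X][X]).restrictScalars k

/-- Differentiation with respect to the inner variable. -/
noncomputable def dT : Derivation k k[X][X] k[X][X] :=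
  Derivation.mk' ((Bivariate.swap (R := k)).toLinearMap ∘ₗ
    (derivative (R := k[X])).restrictScalars k ∘ₗ (Bivariate.swap (R := k)).toLinearMap)
    fun a b => by
      simp [derivative_mul, Bivariate.swap_swap_apply]
      ring

lemma coeff_dT (q : k[X][X]) (i : ℕ) : (dT q).coeff i = derivative (q.coeff i) := by
  induction q using Polynomial.induction_on' with
  | add p q hp hq => simp [hp, hq]
  | monomial n a =>
    induction a using Polynomial.induction_on' with
    | add p q hp hq => simp only [map_add, coeff_add, hp, hq]
    | monomial m c =>
      change (Bivariate.swap (derivative (Bivariate.swap (monomial n (monomial m c))))).coeff i = _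
      rw [Bivariate.swap_monomial_monomial, derivative_monomial, mul_comm, ← nsmul_eq_mul,
        map_nsmul (monomial (R := k[X]) (m - 1)), map_nsmul (Bivariate.swap (R := k)),
        Bivariate.swap_monomial_monomial, coeff_smul, coeff_monomial, coeff_monomial]
      split_ifs
      · rw [derivative_monomial, ← nsmul_eq_mul', map_nsmul]
      · simp

lemma BiDegLE.dT {m : ℕ} {q : k[X][X]} (hq : BiDegLE m q) : BiDegLE m (dT q) := by
  intro i j h
  rw [coeff_dT, coeff_derivative] at h
  have := hq i (j + 1) (left_ne_zero_of_mul h)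
  omega

/-- The derivation `F_x ∂_t - F_t ∂_x`, which kills `F`. -/
noncomputable def hamilton (F : k[X][X]) : Derivation k k[X][X] k[X][X] :=
  derivative F • dT - dT F • dX

lemma hamilton_apply (F q : k[X][X]) :
    hamilton F q = derivative F * dT q - dT F * derivative q := rfl

lemma hamilton_self (F : k[X][X]) : hamilton F F = 0 := by
  rw [hamilton_apply]; ring

lemma BiDegLE.hamilton {d m : ℕ} {F q : k[X][X]} (hF : BiDegLE d F) (hq : BiDegLE m q) :
    BiDegLE (m + d) (hamilton F q) := by
  rw [hamilton_apply]
  exact ((hF.derivative.mul hq.dT).sub (hF.dT.mul hq.derivative)).mono (by omega)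

lemma BiDegLE.iter {d m : ℕ} {F q : k[X][X]} (hF : BiDegLE d F) (hq : BiDegLE m q) (r : ℕ) :
    BiDegLE (m + r * d) (iter (AuxPoly.hamilton F) r q) := by
  induction r generalizing q m with
  | zero => simpa using hq
  | succ r ih =>
    rw [iter_succ]
    exact (ih (hF.hamilton hq)).mono (by rw [Nat.succ_mul]; omega)

end Bivariate

section Jets

variable {k : Type*} [Field k]

/-- Evaluation of a bivariate polynomial at the point `P` (outer variable first). -/
noncomputable def evPt (P : k × k) : k[X][X] →+* k := evalEvalRingHom P.2 P.1

lemma evPt_apply (P : k × k) (q : k[X][X]) :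
    evPt P q = (q.eval (C P.1)).eval P.2 := rfl

lemma exists_linear_separating {P Q : k × k} (h : P ≠ Q) :
    ∃ l : k[X][X], evPt Q l = 0 ∧ evPt P l ≠ 0 := by
  by_cases h1 : P.1 = Q.1
  · have h2 : P.2 ≠ Q.2 := fun h2 => h (Prod.ext h1 h2)
    exact ⟨C (X - C Q.2), by simp [evPt_apply], by simpa [evPt_apply, sub_eq_zero] using h2⟩
  · refine ⟨X - C (C Q.1), by simp [evPt_apply], ?_⟩
    simpa [evPt_apply, sub_eq_zero] using h1

/-- The values of the first `l` iterates of the derivation at the points of `Z`. -/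
noncomputable def jets (F : k[X][X]) (Z : Finset (k × k)) (l : ℕ) :
    k[X][X] →ₗ[k] (Z × Fin l → k) where
  toFun q := fun i => evPt i.1.1 (iter (hamilton F) i.2 q)
  map_add' q r := by ext i; simp
  map_smul' c q := by
    ext i
    simp [evPt_apply, eval_smul]

lemma jets_surjective {F : k[X][X]} {Z : Finset (k × k)}
    {l : ℕ}
    (hZ : ∀ P ∈ Z, l ≤ 1 ∨ evPt P (derivative F) ≠ 0) (hl : ∀ r < l, (r.factorial : k) ≠ 0) :
    Function.Surjective (jets F Z l) := by
  classical
  have key : ∀ m : ℕ, ∀ P : Z, ∀ r : Fin l, l - (r : ℕ) ≤ m →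
      (Pi.single (P, r) 1 : Z × Fin l → k) ∈ LinearMap.range (jets F Z l) := by
    intro m
    induction m with
    | zero =>
      intro P r h
      have := r.2
      omega
    | succ m ih =>
      intro P r h
      choose! L hL0 hL using fun (Q : k × k) (hQ : P.1 ≠ Q) => exists_linear_separating hQ
      set A : k[X][X] := ∏ Q ∈ Z.erase P.1, L Q ^ l with hA
      set T : k[X][X] := C (X - C P.1.2) with hT
      have hT0 : evPt P.1 T = 0 := by simp [hT, evPt_apply]
      have hDT : hamilton F T = derivative F := by
        have h1 : dT T = 1 := by
          ext i : 1
          rw [coeff_dT, hT, coeff_C, coeff_one]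
          split_ifs <;> simp_all
        rw [hamilton_apply, h1, hT, derivative_C]
        ring
      have hA0 : evPt P.1 A ≠ 0 := by
        rw [hA, map_prod, Finset.prod_ne_zero_iff]
        intro Q hQ
        rw [map_pow]
        exact pow_ne_zero _ (hL Q (Finset.ne_of_mem_erase hQ).symm)
      have hc : evPt P.1 (iter (hamilton F) r (A * T ^ (r : ℕ))) ≠ 0 := by
        rw [(vanishTo_pow hT0 r).iter_mul, iter_pow hT0, hDT]
        refine mul_ne_zero hA0 (mul_ne_zero ?_ ?_)
        swap
        · rcases hZ _ P.2 with h1 | h1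
          · have h2 : (r : ℕ) = 0 := by have := r.2; omega
            simp [h2]
          · exact pow_ne_zero _ h1
        exact hl r r.2
      set v := jets F Z l (A * T ^ (r : ℕ)) with hv
      have hv0 : ∀ Q : Z, ∀ s : Fin l, Q ≠ P → v (Q, s) = 0 := by
        intro Q s hQ
        have hne : P.1 ≠ Q.1 := fun h => hQ (Subtype.ext h.symm)
        have h1 : VanishTo (hamilton F) (evPt Q.1) l (A * T ^ (r : ℕ)) := by
          refine VanishTo.mul_right ?_ _
          rw [hA, ← Finset.mul_prod_erase (Z.erase P.1) _ (a := Q.1)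
            (Finset.mem_erase.2 ⟨hne.symm, Q.2⟩)]
          exact (vanishTo_pow (hL0 _ hne) l).mul_right _
        exact h1 s s.2
      have hv1 : ∀ s : Fin l, s < r → v (P, s) = 0 := by
        intro s hs
        exact ((vanishTo_pow hT0 r).mul_left A) s hs
      have hsum : v = v (P, r) • Pi.single (P, r) 1 +
          ∑ s ∈ Finset.univ.filter (fun s : Fin l => r < s), v (P, s) • Pi.single (P, s) 1 := by
        ext ⟨Q, s⟩
        simp only [Pi.add_apply, Finset.sum_apply, Pi.smul_apply, Pi.single_apply, Prod.mk.injEq,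
          smul_eq_mul, mul_ite, mul_one, mul_zero]
        by_cases hQ : Q = P
        · subst hQ
          simp only [true_and, Finset.sum_ite_eq, Finset.mem_filter, Finset.mem_univ]
          rcases lt_trichotomy s r with hs | hs | hs
          · rw [hv1 s hs, if_neg hs.ne, if_neg hs.not_gt, add_zero]
          · subst hs; simp
          · rw [if_neg hs.ne', if_pos hs, zero_add]
        · simp [hQ, hv0 Q s hQ]
      have hmem : v (P, r) • (Pi.single (P, r) 1 : Z × Fin l → k) ∈
          LinearMap.range (jets F Z l) := by
        rw [eq_sub_iff_add_eq.2 hsum.symm]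
        refine Submodule.sub_mem _ ⟨_, rfl⟩ (Submodule.sum_mem _ fun s hs => ?_)
        refine Submodule.smul_mem _ _ (ih P s ?_)
        have h1 := (Finset.mem_filter.1 hs).2
        have h2 : (r : ℕ) < s := h1
        omega
      exact (Submodule.smul_mem_iff _ hc).1 hmem
  rw [← LinearMap.range_eq_top, eq_top_iff]
  intro v _
  have : v = ∑ i, v i • (Pi.single i 1 : Z × Fin l → k) := by
    ext i
    simp [Pi.single_apply]
  rw [this]
  exact Submodule.sum_mem _ fun i _ => Submodule.smul_mem _ _ (key _ i.1 i.2 le_rfl)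

/-- Bézout's theorem with multiplicities. -/
lemma card_mul_le {d e : ℕ} {F G : k[X][X]} (hF : F.Monic) (hd : F.natDegree = d)
    (hFd : BiDegLE d F) (hirr : Irreducible F) (hG : BiDegLE e G) (hFG : ¬ F ∣ G)
    {Z : Finset (k × k)} {l : ℕ} (hl : ∀ r < l, (r.factorial : k) ≠ 0) (hZ0 : ∀ P ∈ Z, evPt P F = 0)
    (hZ : ∀ P ∈ Z, l ≤ 1 ∨ evPt P (derivative F) ≠ 0)
    (hGZ : ∀ P ∈ Z, VanishTo (hamilton F) (evPt P) l G) : Z.card * l ≤ d * e := by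
  have := finrank_le_of_surjective hF hd hFd hirr hG hFG (jets F Z l) (jets_surjective hZ hl)
    (fun u => by
      ext i
      change evPt i.1.1 (iter (hamilton F) i.2 (F * u)) = 0
      rw [iter_mul_of_const (hamilton_self F), map_mul, hZ0 _ i.1.2, zero_mul])
    (fun u => by
      ext i
      exact ((hGZ _ i.1.2).mul_right u) i.2 i.2.2)
  simpa using this

end Jets

section Box

variable {R : Type*} [CommRing R]

/-- The bivariate polynomial with prescribed coefficients in a box of monomials. -/
noncomputable def box (d a : ℕ) : (Fin d × Fin a → R) →ₗ[R] R[X][X] where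
  toFun c := ∑ i, monomial (i.1 : ℕ) (monomial (i.2 : ℕ) (c i))
  map_add' c c' := by simp [Finset.sum_add_distrib]
  map_smul' r c := by simp [Finset.smul_sum, smul_monomial]

lemma box_apply {d a : ℕ} (c : Fin d × Fin a → R) :
    box d a c = ∑ i, monomial (i.1 : ℕ) (monomial (i.2 : ℕ) (c i)) := rfl

lemma coeff_box {d a : ℕ} (c : Fin d × Fin a → R) (i : Fin d × Fin a) :
    ((box d a c).coeff i.1).coeff i.2 = c i := by
  classical
  rw [box_apply, finsetSum_coeff, finsetSum_coeff, Finset.sum_eq_single i]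
  · simp
  · intro j _ hj
    rw [coeff_monomial]
    split_ifs with h
    · rw [coeff_monomial, if_neg]
      intro h2
      exact hj (Prod.ext (Fin.ext h) (Fin.ext h2))
    · simp
  · simp

lemma box_injective (d a : ℕ) : Function.Injective (box (R := R) d a) := by
  intro c c' h
  ext i
  rw [← coeff_box c i, h, coeff_box]

lemma degree_box_lt {d a : ℕ} (c : Fin d × Fin a → R) : (box d a c).degree < d := by
  rw [degree_lt_iff_coeff_zero]
  intro m hm
  rw [box_apply, finsetSum_coeff]
  refine Finset.sum_eq_zero fun i _ => ?_
  rw [coeff_monomial, if_neg]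
  have := i.1.2
  omega

lemma biDegLE_box {d a : ℕ} (c : Fin d × Fin a → R) : BiDegLE (d + a) (box d a c) := by
  rw [box_apply]
  refine BiDegLE.sum _ _ fun i _ => BiDegLE.mono
    (BiDegLE.monomial (l := i.2) _ (natDegree_monomial_le _)) ?_
  omega

lemma eq_zero_of_dvd_box [Nontrivial R] {d a : ℕ} {F : R[X][X]} (hF : F.Monic)
    (hd : F.natDegree = d) {c : Fin d × Fin a → R} (h : F ∣ box d a c) : box d a c = 0 := by
  by_contra hne
  refine hF.not_dvd_of_degree_lt hne ?_ h
  rw [degree_eq_natDegree hF.ne_zero, hd]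
  exact degree_box_lt c

end Box

section Stepanov

variable {p : ℕ} [Fact p.Prime]

lemma iter_mul_pow_char (F q e : (ZMod p)[X][X]) (r : ℕ) :
    iter (hamilton F) r (q * e ^ p) = iter (hamilton F) r q * e ^ p := by
  rw [mul_comm, iter_mul_of_const, mul_comm]
  rw [Derivation.leibniz_pow]
  simp

/-- Linear algebra step: the coefficients of the auxiliary polynomial. -/
lemma exists_stepanov {d a b l : ℕ} {F : (ZMod p)[X][X]} (hF : F.Monic) (hd : F.natDegree = d)
    (hFd : BiDegLE d F) (h : l * (a + b + 2 * d + l * d + 1) < d * a * b) :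
    ∃ H : Fin d × Fin a → Fin d × Fin b → ZMod p, H ≠ 0 ∧ ∀ r < l,
      F ∣ ∑ J, iter (hamilton F) r (box d a (Pi.single J 1)) * box d b (H J) := by
  classical
  set m := a + b + 2 * d + l * d with hm
  let T : (Fin d × Fin a → Fin d × Fin b → ZMod p) →ₗ[ZMod p]
      (Fin l × Fin d × Fin (m + 1) → ZMod p) :=
    LinearMap.pi fun i => (lcoeff (ZMod p) (i.2.2 : ℕ)) ∘ₗ
      ((lcoeff (ZMod p)[X] (i.2.1 : ℕ)).restrictScalars (ZMod p)) ∘ₗ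
      ((modByMonicHom F).restrictScalars (ZMod p)) ∘ₗ
      (∑ J, (LinearMap.mulLeft (ZMod p) (iter (hamilton F) i.1 (box d a (Pi.single J 1)))) ∘ₗ
        (box d b) ∘ₗ LinearMap.proj J)
  have hker : LinearMap.ker T ≠ ⊥ := by
    apply LinearMap.ker_ne_bot_of_finrank_lt
    simp only [Module.finrank_fintype_fun_eq_card, Module.finrank_pi_fintype, Fintype.card_prod,
      Fintype.card_fin, Finset.sum_const, Finset.card_univ, smul_eq_mul]
    have hd0 : 0 < d := by
      rcases Nat.eq_zero_or_pos d with h0 | h0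
      · simp [h0] at h
      · exact h0
    calc l * (d * (m + 1)) = d * (l * (m + 1)) := by ring
      _ < d * (d * a * b) := by gcongr
      _ = d * a * (d * b) := by ring
  obtain ⟨H, hH, hH0⟩ := Submodule.exists_mem_ne_zero_of_ne_bot hker
  refine ⟨H, hH0, fun r hr => ?_⟩
  set q := ∑ J, iter (hamilton F) r (box d a (Pi.single J 1)) * box d b (H J) with hq
  have hqm : BiDegLE m q := by
    refine BiDegLE.sum _ _ fun J _ => ?_
    refine ((BiDegLE.iter hFd (biDegLE_box _) r).mul (biDegLE_box _)).mono ?_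
    have : r * d ≤ l * d := by gcongr
    omega
  rw [← modByMonic_eq_zero_iff_dvd hF]
  ext i j
  rw [coeff_zero, coeff_zero]
  by_contra hne
  have h1 := hqm.modByMonic hF hd hFd i j hne
  have h2 : i < d := by
    by_contra hi
    apply hne
    rw [coeff_eq_zero_of_degree_lt (p := q %ₘ F), coeff_zero]
    refine (degree_modByMonic_lt q hF).trans_le ?_
    rw [degree_eq_natDegree hF.ne_zero, hd]
    exact_mod_cast not_lt.1 hi
  have h3 := congrFun (LinearMap.mem_ker.1 hH) (⟨r, hr⟩, ⟨i, h2⟩, ⟨j, by omega⟩)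
  apply hne
  refine Eq.trans ?_ h3
  change _ = (((_ : (ZMod p)[X][X]) %ₘ F).coeff i).coeff j
  congr 4
  rw [LinearMap.sum_apply]
  rfl

lemma evPt_box_sum {d a b : ℕ} {F : (ZMod p)[X][X]} (P : ZMod p × ZMod p)
    (H : Fin d × Fin a → Fin d × Fin b → ZMod p) (r : ℕ) :
    evPt P (iter (hamilton F) r (∑ J, box d a (Pi.single J 1) * box d b (H J) ^ p)) =
      ∑ J, evPt P (box d b (H J)) * evPt P (iter (hamilton F) r (box d a (Pi.single J 1))) := by
  rw [map_sum, map_sum]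
  refine Finset.sum_congr rfl fun J _ => ?_
  rw [iter_mul_pow_char, map_mul, map_pow, ZMod.pow_card, mul_comm]

lemma evPt_smul (P : ZMod p × ZMod p) (c : ZMod p) (q : (ZMod p)[X][X]) :
    evPt P (c • q) = c * evPt P q := by
  simp [evPt_apply, eval_smul]

lemma factorial_ne_zero_of_le {l : ℕ} (hl : l ≤ p) (r : ℕ) (hr : r < l) :
    (r.factorial : ZMod p) ≠ 0 := by
  rw [ne_eq, ZMod.natCast_eq_zero_iff, (Fact.out : p.Prime).dvd_factorial]
  omega

/-- Stepanov's method for smooth points. -/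
lemma stepanov {d a b l : ℕ} {F : (ZMod p)[X][X]} (hF : F.Monic) (hd : F.natDegree = d)
    (hFd : BiDegLE d F) (hirr : Irreducible F)
    (h : l * (a + b + 2 * d + l * d + 1) < d * a * b) (hlp : l ≤ p) (hp : d * (a + d) < p)
    {Z : Finset (ZMod p × ZMod p)} (hZ0 : ∀ P ∈ Z, evPt P F = 0)
    (hZ : ∀ P ∈ Z, evPt P (derivative F) ≠ 0) :
    Z.card * l ≤ d * (a + d) + p * (d * (b + d)) := by
  classical
  obtain ⟨H, hH0, hH⟩ := exists_stepanov hF hd hFd h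
  set G := ∑ J, box d a (Pi.single J 1) * box d b (H J) ^ p with hG
  by_cases hFG : F ∣ G
  · obtain ⟨J0, hJ0⟩ := Function.ne_iff.1 hH0
    have hq : ∀ P ∈ Z, ∀ J, evPt P (box d b (H J)) = 0 := by
      intro P hP
      set c : Fin d × Fin a → ZMod p := fun J => evPt P (box d b (H J)) with hc
      have hc' : c = ∑ J, c J • (Pi.single J 1 : Fin d × Fin a → ZMod p) := by
        ext i
        simp [Pi.single_apply]
      suffices hbox : box d a c = 0 by
        have h1 : c = 0 := box_injective d a (by rw [hbox, map_zero])
        exact fun J => congrFun h1 J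
      by_contra hne
      have h1 : ¬ F ∣ box d a c := fun hdvd => hne (eq_zero_of_dvd_box hF hd hdvd)
      have h2 := card_mul_le (Z := {P}) (l := p) hF hd hFd hirr (biDegLE_box c) h1
        (factorial_ne_zero_of_le le_rfl)
        (by simpa using hZ0 P hP) (by simpa using Or.inr (hZ P hP)) ?_
      · rw [Finset.card_singleton, one_mul, add_comm d a] at h2
        omega
      · intro P' hP' r hr
        rw [Finset.mem_singleton.1 hP']
        obtain ⟨u, hu⟩ := hFG
        have h3 := evPt_box_sum (F := F) P H r
        rw [← hG, hu, iter_mul_of_const (hamilton_self F), map_mul, hZ0 P hP, zero_mul] at h3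
        rw [hc', map_sum, map_sum, map_sum, h3]
        refine Finset.sum_congr rfl fun J _ => ?_
        rw [map_smul, map_smul, evPt_smul]
    have h1 : ¬ F ∣ box d b (H J0) := fun hdvd => hJ0
      (box_injective d b (by rw [eq_zero_of_dvd_box hF hd hdvd, Pi.zero_apply, map_zero]))
    have h2 := card_mul_le (Z := Z) (l := 1) hF hd hFd hirr (biDegLE_box (H J0)) h1
      (factorial_ne_zero_of_le (Nat.Prime.one_le Fact.out)) hZ0 (fun P hP => Or.inl le_rfl)
          fun P hP => by
        rw [vanishTo_succ]
        exact ⟨hq P hP J0, vanishTo_zero _⟩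
    rw [mul_one, add_comm d b] at h2
    calc Z.card * l ≤ (d * (b + d)) * p := by gcongr
      _ ≤ _ := by rw [mul_comm]; exact Nat.le_add_left _ _
  · have hGdeg : BiDegLE (a + d + p * (b + d)) G := by
      refine BiDegLE.sum _ _ fun J _ => ?_
      exact ((biDegLE_box _).mul ((biDegLE_box _).pow p)).mono (by rw [add_comm d a, add_comm d b])
    have h2 := card_mul_le (Z := Z) (l := l) hF hd hFd hirr hGdeg hFG
      (factorial_ne_zero_of_le hlp) hZ0
      (fun P hP => Or.inr (hZ P hP)) fun P hP r hr => by
        rw [evPt_box_sum]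
        obtain ⟨u, hu⟩ := hH r hr
        have h3 := congrArg (evPt P) hu
        rw [map_mul, hZ0 P hP, zero_mul, map_sum] at h3
        rw [← h3]
        refine Finset.sum_congr rfl fun J _ => ?_
        rw [map_mul, mul_comm]
    refine h2.trans_eq ?_
    ring

lemma card_smooth_le {d : ℕ} {F : (ZMod p)[X][X]} (hF : F.Monic) (hd : F.natDegree = d)
    (hFd : BiDegLE d F) (hirr : Irreducible F) (hd0 : 0 < d) (hp : 64 * d ^ 2 ≤ Nat.sqrt p)
    {Z : Finset (ZMod p × ZMod p)} (hZ0 : ∀ P ∈ Z, evPt P F = 0)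
    (hZ : ∀ P ∈ Z, evPt P (derivative F) ≠ 0) :
    Z.card ≤ p + 201 * d ^ 2 * Nat.sqrt p := by
  set s := Nat.sqrt p with hs
  have hs1 : s * s ≤ p := Nat.sqrt_le p
  have hs2 : p ≤ s * s + s + s := Nat.sqrt_le_add p
  have hs0 : 0 < s := lt_of_lt_of_le (by positivity) hp
  set a := p / (4 * d) with ha
  set e := s / d with he
  have ha1 : 4 * d * a ≤ p := Nat.mul_div_le p (4 * d)
  have ha2 : p < 4 * d * a + 4 * d := Nat.lt_mul_div_succ p (by positivity)
  have he1 : d * e ≤ s := Nat.mul_div_le s d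
  have he2 : s < d * e + d := Nat.lt_mul_div_succ s hd0
  have hdd : d ≤ d ^ 2 := Nat.le_self_pow (by norm_num) d
  have hsp : 64 * s ≤ p := by nlinarith
  have hdp : 64 * d ^ 2 ≤ p := by nlinarith
  have key := stepanov (a := a) (b := e + 1 + 64 * d) (l := s) hF hd hFd hirr ?_ ?_ ?_ hZ0 hZ
  · have h1 : Z.card * s ≤ p * s + 67 * d ^ 2 * p := by
      refine key.trans ?_
      have : d * (e + 1 + 64 * d + d) ≤ s + 66 * d ^ 2 := by
        have : d * (e + 1 + 64 * d + d) = d * e + d + 65 * d ^ 2 := by ring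
        omega
      have h3 : p * (d * (e + 1 + 64 * d + d)) ≤ p * (s + 66 * d ^ 2) := by gcongr
      have h4 : d * (a + d) = d * a + d ^ 2 := by ring
      have h5 : 4 * d * a = 4 * (d * a) := by ring
      have h6 : d ^ 2 * 1 ≤ d ^ 2 * p := by gcongr; omega
      have h7 : 1 * p ≤ d ^ 2 * p := by gcongr; omega
      have h8 : p * (s + 66 * d ^ 2) = p * s + 66 * (d ^ 2 * p) := by ring
      have h9 : 67 * d ^ 2 * p = 67 * (d ^ 2 * p) := by ring
      omega
    have h2 : p ≤ 3 * s * s := by nlinarith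
    have h3 : Z.card * s ≤ (p + 201 * d ^ 2 * s) * s := by
      have : 67 * d ^ 2 * p ≤ 67 * d ^ 2 * (3 * s * s) := by gcongr
      nlinarith
    exact Nat.le_of_mul_le_mul_right h3 hs0
  · have h1 : d * (e + 1 + 64 * d) ≥ s + 64 * d ^ 2 := by
      have : d * (e + 1 + 64 * d) = d * e + d + 64 * d ^ 2 := by ring
      omega
    have h2 : d * a * (e + 1 + 64 * d) = a * (d * (e + 1 + 64 * d)) := by ring
    have h3 : a * (s + 64 * d ^ 2) ≤ a * (d * (e + 1 + 64 * d)) := by gcongr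
    have h4 : 16 * d * p ≤ 64 * d ^ 2 * a + 64 * d ^ 2 := by
      calc 16 * d * p ≤ 16 * d * (4 * d * a + 4 * d) := by gcongr
        _ = _ := by ring
    have he3 : e ≤ s := Nat.div_le_self s d
    have h5 : 64 * d ≤ s := by omega
    have h6 : s * (e + 1 + 64 * d) ≤ 3 * p := by
      calc s * (e + 1 + 64 * d) ≤ s * (3 * s) := by gcongr; omega
        _ = 3 * (s * s) := by ring
        _ ≤ 3 * p := by gcongr
    have h7 : s * (2 * d) ≤ p := by
      calc s * (2 * d) ≤ s * s := by gcongr; omega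
        _ ≤ p := hs1
    have h8 : s * (s * d) ≤ p * d := by
      rw [← mul_assoc]
      gcongr
    have h9 : p ≤ p * d := Nat.le_mul_of_pos_right p hd0
    rw [h2]
    refine lt_of_lt_of_le ?_ h3
    have h10 : s * (a + (e + 1 + 64 * d) + 2 * d + s * d + 1) =
      s * a + s * (e + 1 + 64 * d) + s * (2 * d) + s * (s * d) + s := by ring
    rw [h10]
    have h11 : 0 < p := by omega
    have h12 : a * (s + 64 * d ^ 2) = s * a + 64 * d ^ 2 * a := by ring
    rw [h12]
    have h13 : 16 * d * p = 16 * (p * d) := by ring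
    omega
  · nlinarith
  · have : d * (a + d) = d * a + d ^ 2 := by ring
    have : 4 * d * a = 4 * (d * a) := by ring
    omega

end Stepanov

section FiberWeight

variable {p : ℕ} [Fact p.Prime]

open Classical in
/-- The number of roots of `u`, replaced by `d` if `u` has a multiple root. -/
noncomputable def fiberWeight (d : ℕ) (u : (ZMod p)[X]) : ℕ :=
  if ∃ x, u.eval x = 0 ∧ (derivative u).eval x = 0 then d
  else (Finset.univ.filter fun x => u.eval x = 0).card

lemma fiberWeight_le {d : ℕ} {u : (ZMod p)[X]} (hu : u ≠ 0) (hd : u.natDegree ≤ d) :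
    fiberWeight d u ≤ d := by
  classical
  rw [fiberWeight]
  split_ifs
  · exact le_rfl
  · refine le_trans (Finset.card_le_card (t := u.roots.toFinset) fun x hx => ?_)
      ((Multiset.toFinset_card_le _).trans ((card_roots' u).trans hd))
    simpa [hu] using hx

lemma evPt_eq_eval_map {k : Type*} [Field k] (P : k × k) (q : k[X][X]) :
    evPt P q = (q.map (evalRingHom P.2)).eval P.1 := by
  have h := hom_eval₂ q (RingHom.id _) (evalRingHom P.2) (C P.1)
  simpa [eval_map, evPt_apply, eval₂_id] using h

lemma sum_fiberWeight_le {d : ℕ} {F : (ZMod p)[X][X]} (hF : F.Monic) (hd : F.natDegree = d)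
    (hFd : BiDegLE d F) (hirr : Irreducible F) (hd0 : 0 < d) (hp : 64 * d ^ 2 ≤ Nat.sqrt p) :
    ∑ t, fiberWeight d (F.map (evalRingHom t)) ≤ p + 202 * d ^ 2 * Nat.sqrt p := by
  classical
  have hsp : Nat.sqrt p ≤ p := Nat.sqrt_le_self p
  have hdd : d ≤ d ^ 2 := Nat.le_self_pow (by norm_num) d
  set Z := Finset.univ.filter fun P : ZMod p × ZMod p =>
    evPt P F = 0 ∧ evPt P (derivative F) ≠ 0 with hZ
  set S := Finset.univ.filter fun P : ZMod p × ZMod p =>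
    evPt P F = 0 ∧ evPt P (derivative F) = 0 with hS
  have h1 : Z.card ≤ p + 201 * d ^ 2 * Nat.sqrt p :=
    card_smooth_le hF hd hFd hirr hd0 hp (fun P hP => (Finset.mem_filter.1 hP).2.1)
      fun P hP => (Finset.mem_filter.1 hP).2.2
  have h2 : S.card ≤ d * d := by
    have hdvd : ¬ F ∣ derivative F := by
      have hne : derivative F ≠ 0 := by
        intro h0
        have h1 := congrArg (fun q => coeff q (d - 1)) h0
        simp only [coeff_derivative, coeff_zero] at h1
        rw [Nat.sub_add_cancel hd0, ← hd, hF.coeff_natDegree, one_mul, hd] at h1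
        have h3 : ((d : (ZMod p)[X])) = 0 := by
          rw [← h1, Nat.cast_sub hd0]
          ring
        rw [← map_natCast C, C_eq_zero, ZMod.natCast_eq_zero_iff] at h3
        have := Nat.le_of_dvd hd0 h3
        nlinarith
      refine hF.not_dvd_of_natDegree_lt hne ?_
      exact natDegree_derivative_lt (by omega)
    have := card_mul_le (Z := S) (l := 1) hF hd hFd hirr hFd.derivative hdvd
      (factorial_ne_zero_of_le (Nat.Prime.one_le Fact.out))
          (fun P hP => (Finset.mem_filter.1 hP).2.1)
      (fun P hP => Or.inl le_rfl) fun P hP => by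
        rw [vanishTo_succ]
        exact ⟨(Finset.mem_filter.1 hP).2.2, vanishTo_zero _⟩
    rwa [mul_one] at this
  have h3 : ∀ t, fiberWeight d (F.map (evalRingHom t)) ≤
      (Z.filter fun P => P.2 = t).card + d * (S.filter fun P => P.2 = t).card := by
    intro t
    rw [fiberWeight]
    split_ifs with h
    · obtain ⟨x, hx, hx'⟩ := h
      have : 0 < (S.filter fun P => P.2 = t).card := by
        refine Finset.card_pos.2 ⟨(x, t), ?_⟩
        simp only [hS, Finset.mem_filter, Finset.mem_univ, true_and, and_true]
        rw [evPt_eq_eval_map, evPt_eq_eval_map]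
        rw [derivative_map] at hx'
        exact ⟨hx, hx'⟩
      exact le_add_left (Nat.le_mul_of_pos_right d this)
    · refine le_add_right ?_
      refine Finset.card_le_card_of_injOn (fun x => (x, t)) ?_ ?_
      · intro x hx
        simp only [Finset.coe_filter, Finset.mem_univ, true_and, Set.mem_ofPred_eq] at hx
        simp only [hZ, Finset.coe_filter, Finset.mem_filter, Finset.mem_univ, true_and,
          Set.mem_ofPred_eq, and_true]
        rw [evPt_eq_eval_map, evPt_eq_eval_map]
        refine ⟨hx, fun hx' => h ⟨x, hx, ?_⟩⟩
        rw [derivative_map]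
        exact hx'
      · intro x _ y _ h
        exact congrArg Prod.fst h
  calc ∑ t, fiberWeight d (F.map (evalRingHom t))
      ≤ ∑ t, ((Z.filter fun P => P.2 = t).card + d * (S.filter fun P => P.2 = t).card) :=
        Finset.sum_le_sum fun t _ => h3 t
    _ = Z.card + d * S.card := by
        rw [Finset.sum_add_distrib, ← Finset.mul_sum]
        rw [← Finset.card_eq_sum_card_fiberwise (f := Prod.snd) (s := Z) (t := Finset.univ)
            (fun _ _ => Finset.mem_coe.2 (Finset.mem_univ _)),
          ← Finset.card_eq_sum_card_fiberwise (f := Prod.snd) (s := S) (t := Finset.univ)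
            (fun _ _ => Finset.mem_coe.2 (Finset.mem_univ _))]
    _ ≤ (p + 201 * d ^ 2 * Nat.sqrt p) + d * (d * d) := by gcongr
    _ ≤ p + 202 * d ^ 2 * Nat.sqrt p := by
        have : d ≤ Nat.sqrt p := by omega
        have : d * (d * d) ≤ d ^ 2 * Nat.sqrt p := by
          calc d * (d * d) = d ^ 2 * d := by ring
            _ ≤ _ := by gcongr
        nlinarith

end FiberWeight

section RuppertForm

variable {R : Type*} [CommRing R]

/-- The coefficient of the differential of `(g dx + h dt) / F`, multiplied by `F ^ 2`. -/
noncomputable def rup (F g h : R[X][X]) : R[X][X] :=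
  F * dT g - g * dT F - F * derivative h + h * derivative F

lemma VanishTo.of_mul {k A : Type*} [Field k] [CommRing A] [Algebra k A] {D : Derivation k A A}
    {ev : A →+* k} {l : ℕ} {a b : A} (h : VanishTo D ev l (a * b)) (ha : ev a ≠ 0) :
    VanishTo D ev l b := by
  induction l with
  | zero => exact vanishTo_zero _
  | succ l ih =>
    have h1 := ih (h.mono (Nat.le_succ l))
    intro r hr
    rcases Nat.lt_succ_iff_lt_or_eq.1 hr with hr | rfl
    · exact h1 r hr
    · have h2 := h r hr
      rw [h1.iter_mul, mul_eq_zero] at h2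
      exact h2.resolve_left ha

lemma exists_biDegLE (q : R[X][X]) : ∃ e, BiDegLE e q := by
  induction q using Polynomial.induction_on' with
  | add p q hp hq =>
    obtain ⟨e, he⟩ := hp
    obtain ⟨e', he'⟩ := hq
    exact ⟨max e e', (he.mono (le_max_left _ _)).add (he'.mono (le_max_right _ _))⟩
  | monomial n a => exact ⟨_, BiDegLE.monomial a le_rfl⟩

lemma dT_derivative (q : R[X][X]) : dT (derivative q) = derivative (dT q) := by
  ext i : 1
  rw [coeff_dT, coeff_derivative, coeff_derivative, coeff_dT]
  have : ((i : R[X]) + 1) = C ((i : R) + 1) := by simp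
  rw [this, derivative_mul, derivative_C, mul_zero, add_zero]

lemma vanishTo_self {k : Type*} [Field k] {l : ℕ} {F : k[X][X]} {P : k × k} (hP : evPt P F = 0)
    (u : k[X][X]) :
    VanishTo (hamilton F) (evPt P) l (F * u) := fun r _ => by
  rw [iter_mul_of_const (hamilton_self F), map_mul, hP, zero_mul]

end RuppertForm

section Absolute

variable {k : Type*} [Field k] [CharZero k]

lemma vanishTo_of_forall {d : ℕ} {F G : k[X][X]} (hF : F.Monic) (hd : F.natDegree = d)
    (hFd : BiDegLE d F) (hirr : Irreducible F) {P : k × k} (hP : evPt P F = 0)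
    (hP' : evPt P (derivative F) ≠ 0) (h : ∀ l, VanishTo (hamilton F) (evPt P) l G) : F ∣ G := by
  by_contra hFG
  obtain ⟨e, he⟩ := exists_biDegLE G
  have := card_mul_le (Z := {P}) (l := d * e + 1) hF hd hFd hirr he hFG
    (fun r _ => by exact_mod_cast r.factorial_ne_zero) (by simpa using hP)
    (by simpa using Or.inr hP') (by simpa using h _)
  simp at this

/-- Ruppert's criterion: an absolutely irreducible curve with a smooth rational point has no
nonzero closed form of the given shape. -/
lemma eq_zero_of_rup_eq_zero {d : ℕ} {F : k[X][X]} (hF : F.Monic) (hd : F.natDegree = d)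
    (hFd : BiDegLE d F) (hirr : Irreducible F) (hd0 : 0 < d) {P : k × k} (hP : evPt P F = 0)
    (hP' : evPt P (derivative F) ≠ 0) {g h : k[X][X]} (hg : ∀ i, d ≤ i + 1 → g.coeff i = 0)
    (hh : ∀ i, d ≤ i → h.coeff i = 0) (hrup : rup F g h = 0) : g = 0 ∧ h = 0 := by
  have hF' : ∀ q : k[X][X], (∀ i, d ≤ i → q.coeff i = 0) → F ∣ q → q = 0 := by
    intro q hq hdvd
    by_contra hne
    refine hF.not_dvd_of_degree_lt hne ?_ hdvd
    rw [degree_eq_natDegree hF.ne_zero, hd, degree_lt_iff_coeff_zero]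
    exact hq
  have hFx : ∀ i, d ≤ i → (derivative F).coeff i = 0 := by
    intro i hi
    rw [coeff_derivative, coeff_eq_zero_of_natDegree_lt (by omega), zero_mul]
  set c : k := evPt P g / evPt P (derivative F) with hc
  set g' := g - c • derivative F with hg'
  have hdg : F ∣ derivative F * hamilton F g' - g' * hamilton F (derivative F) := by
    have hcs : ∀ q : k[X][X], c • q = C (C c) * q := fun q => Algebra.smul_def c q
    have e1 : F * dT g - g * dT F - F * derivative h + h * derivative F = 0 := hrup
    have e2 := congrArg derivative e1
    simp only [derivative_add, derivative_sub, derivative_mul, derivative_zero] at e2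
    rw [← dT_derivative, ← dT_derivative] at e2
    refine ⟨-(derivative F * (derivative (dT g) - derivative (derivative h)))
      + derivative (derivative F) * (dT g - derivative h), ?_⟩
    rw [hamilton_apply, hamilton_apply, hg', map_sub, Derivation.map_smul, derivative_sub,
      derivative_smul, hcs, hcs, hcs, ← dT_derivative]
    linear_combination (derivative F) * e2 - (derivative (derivative F)) * e1
  have hv : ∀ l, VanishTo (hamilton F) (evPt P) l g' := by
    intro l
    induction l with
    | zero => exact vanishTo_zero _
    | succ l ih =>
      rw [vanishTo_succ]
      constructor
      · rw [hg', map_sub, sub_eq_zero]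
        have : evPt P (c • derivative F) = c * evPt P (derivative F) := by
          simp [evPt_apply, eval_smul]
        rw [this, hc, div_mul_cancel₀ _ hP']
      · obtain ⟨u, hu⟩ := hdg
        refine VanishTo.of_mul (a := derivative F) ?_ hP'
        rw [sub_eq_iff_eq_add.1 hu]
        exact (vanishTo_self hP u).add (ih.mul_right _)
  have hg'0 : g' = 0 := by
    refine hF' g' (fun i hi => ?_) (vanishTo_of_forall hF hd hFd hirr hP hP' hv)
    rw [hg', coeff_sub, coeff_smul, hFx i hi, hg i (by omega), smul_zero, sub_zero]
  have hc0 : c = 0 := by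
    have h1 := congrArg (fun q => (coeff q (d - 1)).coeff 0) hg'0
    simp only [hg', coeff_sub, hg (d - 1) (by omega), coeff_smul, coeff_zero, coeff_derivative]
        at h1
    rw [Nat.sub_add_cancel hd0, ← hd, hF.coeff_natDegree, one_mul, hd] at h1
    have h3 : (((d - 1 : ℕ) : k[X]) + 1) = C (d : k) := by
      rw [Nat.cast_sub hd0]
      simp
    rw [h3, coeff_C_zero, zero_sub, neg_eq_zero, smul_eq_mul, mul_eq_zero] at h1
    exact h1.resolve_right (by exact_mod_cast hd0.ne')
  have hg0 : g = 0 := by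
    rw [hc0, zero_smul, sub_zero] at hg'
    rw [← hg', hg'0]
  refine ⟨hg0, hF' h hh ?_⟩
  have h1 : F ∣ h * derivative F := by
    refine ⟨derivative h, ?_⟩
    rw [rup, hg0, map_zero] at hrup
    linear_combination hrup
  refine (hirr.prime.dvd_or_dvd h1).resolve_right fun h2 => hP' ?_
  obtain ⟨u, hu⟩ := h2
  rw [hu, map_mul, hP, zero_mul]

end Absolute

section TDeg

variable {R : Type*} [CommRing R]

/-- The degree in the inner variable is at most `m`. -/
def TDegLE (m : ℕ) (q : R[X][X]) : Prop := ∀ i, (q.coeff i).natDegree ≤ m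

lemma coeff_swap (q : R[X][X]) (i j : ℕ) :
    ((Bivariate.swap q).coeff j).coeff i = (q.coeff i).coeff j := by
  induction q using Polynomial.induction_on' with
  | add p q hp hq => simp [hp, hq]
  | monomial n a =>
    induction a using Polynomial.induction_on' with
    | add p q hp hq => simp only [map_add, coeff_add, hp, hq]
    | monomial m c =>
      rw [Bivariate.swap_monomial_monomial, coeff_monomial, coeff_monomial]
      split_ifs <;> simp_all [coeff_monomial]

lemma tDegLE_iff {m : ℕ} {q : R[X][X]} : TDegLE m q ↔ (Bivariate.swap q).natDegree ≤ m := by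
  rw [natDegree_le_iff_coeff_eq_zero]
  constructor
  · intro h j hj
    ext i
    rw [coeff_swap, coeff_zero]
    exact coeff_eq_zero_of_natDegree_lt ((h i).trans_lt hj)
  · intro h i
    rw [natDegree_le_iff_coeff_eq_zero]
    intro j hj
    rw [← coeff_swap, h j hj, coeff_zero]

lemma TDegLE.mul {m m' : ℕ} {q r : R[X][X]} (hq : TDegLE m q) (hr : TDegLE m' r) :
    TDegLE (m + m') (q * r) := by
  rw [tDegLE_iff] at *
  rw [map_mul]
  exact natDegree_mul_le.trans (by omega)

lemma TDegLE.mono {m m' : ℕ} {q : R[X][X]} (hq : TDegLE m q) (h : m ≤ m') : TDegLE m' q :=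
  fun i => (hq i).trans h

lemma TDegLE.sub {m : ℕ} {q r : R[X][X]} (hq : TDegLE m q) (hr : TDegLE m r) :
    TDegLE m (q - r) := fun i => by
  rw [coeff_sub]
  exact (natDegree_sub_le_of_le (hq i) (hr i)).trans_eq (max_self m)

lemma TDegLE.natCast_mul {m : ℕ} {q : R[X][X]} (hq : TDegLE m q) (c : ℕ) :
    TDegLE m ((c : R[X][X]) * q) := fun i => by
  rw [← nsmul_eq_mul, coeff_smul]
  exact (natDegree_smul_le _ _).trans (hq i)

lemma TDegLE.derivative {m : ℕ} {q : R[X][X]} (hq : TDegLE m q) :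
    TDegLE m (Polynomial.derivative q) := fun i => by
  rw [coeff_derivative]
  have : ((i : R[X]) + 1) = C ((i : R) + 1) := by simp
  rw [this]
  exact (natDegree_mul_C_le _ _).trans (hq _)

lemma TDegLE.dT {m : ℕ} {q : R[X][X]} (hq : TDegLE m q) : TDegLE m (dT q) := fun i => by
  rw [coeff_dT]
  exact (natDegree_derivative_le _).trans ((Nat.sub_le _ _).trans (hq i))

lemma BiDegLE.tDegLE {m : ℕ} {q : R[X][X]} (hq : BiDegLE m q) : TDegLE m q := fun i =>
  (hq.natDegree_coeff_le i).trans (Nat.sub_le _ _)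

lemma exists_tDegLE_of_mul [IsDomain R] {d : ℕ} {q r : R[X][X]} (h : TDegLE d (q * r))
    (h0 : q * r ≠ 0) : ∃ m m', m + m' ≤ d ∧ TDegLE m q ∧ TDegLE m' r := by
  refine ⟨(Bivariate.swap q).natDegree, (Bivariate.swap r).natDegree, ?_, tDegLE_iff.2 le_rfl,
    tDegLE_iff.2 le_rfl⟩
  rw [tDegLE_iff, map_mul, natDegree_mul] at h
  · exact h
  · simpa using left_ne_zero_of_mul h0
  · simpa using right_ne_zero_of_mul h0

lemma exists_box_eq {m n : ℕ} {q : R[X][X]} (h1 : ∀ i, m ≤ i → q.coeff i = 0) (h2 : TDegLE n q) :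
    ∃ c, box m (n + 1) c = q := by
  refine ⟨fun i => (q.coeff i.1).coeff i.2, ?_⟩
  ext i j
  by_cases hi : i < m
  · by_cases hj : j < n + 1
    · exact coeff_box (fun i => (q.coeff i.1).coeff i.2) ((⟨i, hi⟩, ⟨j, hj⟩) : Fin m × Fin (n + 1))
    · rw [coeff_eq_zero_of_natDegree_lt (p := q.coeff i) ((h2 i).trans_lt (by omega)), box_apply,
        finsetSum_coeff, finsetSum_coeff]
      refine Finset.sum_eq_zero fun l _ => ?_
      rw [coeff_monomial]
      split_ifs
      · rw [coeff_monomial, if_neg]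
        have := l.2.2
        omega
      · simp
  · rw [h1 i (not_lt.1 hi), coeff_eq_zero_of_degree_lt ((degree_box_lt _).trans_le _)]
    exact_mod_cast not_lt.1 hi

end TDeg

section Reducible

variable {k : Type*} [Field k]

lemma coeff_derivative_of_monic {q : k[X][X]} (hq : q.Monic) (h : 0 < q.natDegree) :
    (derivative q).coeff (q.natDegree - 1) = (q.natDegree : k[X]) := by
  rw [coeff_derivative, Nat.sub_add_cancel h, hq.coeff_natDegree, one_mul, Nat.cast_sub h]
  ring

lemma exists_monic_irreducible_mul {q : k[X][X]} (hq : q.Monic) (h : 0 < q.natDegree) :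
    ∃ q1 q2 : k[X][X], q1.Monic ∧ q2.Monic ∧ Irreducible q1 ∧ q1 * q2 = q := by
  induction hN : q.natDegree using Nat.strong_induction_on generalizing q with
  | _ N ih =>
    by_cases hirr : Irreducible q
    · exact ⟨q, 1, hq, monic_one, hirr, mul_one q⟩
    rw [hq.irreducible_iff_natDegree', not_and_or] at hirr
    rcases hirr with h1 | h1
    · rw [not_not] at h1
      simp [h1] at h
    push Not at h1
    obtain ⟨f, g, hf, hg, hfg, hlt⟩ := h1
    have hg0 : g.natDegree ≠ 0 := by
      have := (Finset.mem_Ioc.1 hlt).1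
      omega
    have h2 : f.natDegree + g.natDegree = N := by rw [← hN, ← hfg, hf.natDegree_mul hg]
    have h3 : g.natDegree ≤ N / 2 := by
      have := (Finset.mem_Ioc.1 hlt).2
      omega
    obtain ⟨q1, q2, hq1, hq2, hirr, h4⟩ := ih f.natDegree (by omega) hf (by omega) rfl
    exact ⟨q1, q2 * g, hq1, hq2.mul hg, hirr, by rw [← mul_assoc, h4, hfg]⟩

lemma natCast_ne_zero' {c : ℕ} (hc : (c : k) ≠ 0) : (c : k[X][X]) ≠ 0 := by
  rw [← map_natCast C, ← map_natCast C, ne_eq, C_eq_zero, C_eq_zero]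
  exact hc

/-- A reducible monic curve has a nonzero closed form. -/
lemma exists_rup_eq_zero {d : ℕ} {F : k[X][X]} (hF : F.Monic) (hd : F.natDegree = d)
    (hFd : TDegLE d F) (hd0 : 0 < d) (hirr : ¬ Irreducible F)
    (hchar : ∀ r, 0 < r → r ≤ d → (r : k) ≠ 0) :
    ∃ g h : k[X][X], rup F g h = 0 ∧ (g ≠ 0 ∨ h ≠ 0) ∧ (∀ i, d ≤ i + 1 → g.coeff i = 0) ∧
      (∀ i, d ≤ i → h.coeff i = 0) ∧ TDegLE d g ∧ TDegLE d h := by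
  obtain ⟨F1, F2, hF1m, hF2m, hF1irr, hFF, hn1, hn2⟩ : ∃ F1 F2 : k[X][X], F1.Monic ∧ F2.Monic ∧
      Irreducible F1 ∧ F1 * F2 = F ∧ 0 < F1.natDegree ∧ 0 < F2.natDegree := by
    obtain ⟨F1, F2, hF1m, hF2m, hF1irr, hFF⟩ := exists_monic_irreducible_mul hF (by omega)
    refine ⟨F1, F2, hF1m, hF2m, hF1irr, hFF, ?_, ?_⟩
    · refine Nat.pos_of_ne_zero fun h0 => hF1irr.not_isUnit ?_
      rw [hF1m.natDegree_eq_zero.1 h0]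
      exact isUnit_one
    · refine Nat.pos_of_ne_zero fun h0 => hirr ?_
      rwa [← hFF, hF2m.natDegree_eq_zero.1 h0, mul_one]
  set d1 := F1.natDegree with hd1
  set d2 := F2.natDegree with hd2
  have hdd : d1 + d2 = d := by rw [← hd, ← hFF, hF1m.natDegree_mul hF2m]
  have hFx1 : derivative F1 ≠ 0 := by
    intro h0
    have := coeff_derivative_of_monic hF1m hn1
    rw [h0, coeff_zero, ← hd1] at this
    rw [← map_natCast C, eq_comm, C_eq_zero] at this
    exact hchar d1 hn1 (by omega) this
  have hndvd : ¬ F1 ∣ derivative F1 :=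
    hF1m.not_dvd_of_natDegree_lt hFx1 (natDegree_derivative_lt hn1.ne')
  obtain ⟨m1, m2, hm, ht1, ht2⟩ := exists_tDegLE_of_mul (by rwa [hFF])
      (by rw [hFF]; exact hF.ne_zero)
  by_cases hdvd : F1 ∣ F2
  · obtain ⟨F3, hF3⟩ := hdvd
    have hF3m : F3.Monic := hF1m.of_mul_monic_left (by rwa [← hF3])
    have hd3 : d2 = d1 + F3.natDegree := by rw [hd2, hF3, hF1m.natDegree_mul hF3m]
    obtain ⟨m3, m4, hm', ht3, ht4⟩ := exists_tDegLE_of_mul (by rwa [← hF3])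
      (by rw [← hF3]; exact hF2m.ne_zero)
    refine ⟨F3 * derivative F1, F3 * dT F1, ?_, Or.inl (mul_ne_zero hF3m.ne_zero hFx1), ?_,
        ?_, ?_, ?_⟩
    · rw [rup, ← hFF, hF3]
      simp only [derivative_mul, Derivation.leibniz, smul_eq_mul, ← dT_derivative]
      ring
    · intro i hi
      refine coeff_eq_zero_of_natDegree_lt ?_
      have h1 := natDegree_mul_le (p := F3) (q := derivative F1)
      have h2 := natDegree_derivative_le F1
      omega
    · intro i hi
      refine coeff_eq_zero_of_natDegree_lt ?_
      have h1 := natDegree_mul_le (p := F3) (q := dT F1)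
      have h2 : (dT F1).natDegree ≤ d1 := by
        rw [natDegree_le_iff_coeff_eq_zero]
        intro j hj
        rw [coeff_dT, coeff_eq_zero_of_natDegree_lt hj, derivative_zero]
      omega
    · exact (ht4.mul ht1.derivative).mono (by omega)
    · exact (ht4.mul ht1.dT).mono (by omega)
  · refine ⟨d2 * (F2 * derivative F1) - d1 * (F1 * derivative F2),
      d2 * (F2 * dT F1) - d1 * (F1 * dT F2), ?_, Or.inl ?_, ?_, ?_, ?_, ?_⟩
    · rw [rup, ← hFF]
      simp only [derivative_mul, map_sub, Derivation.leibniz, smul_eq_mul,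
        ← dT_derivative, derivative_natCast, Derivation.map_natCast]
      ring
    · intro h0
      have h1 : F1 ∣ d2 * (F2 * derivative F1) := ⟨d1 * derivative F2, by
        linear_combination h0⟩
      rcases hF1irr.prime.dvd_or_dvd h1 with h2 | h2
      · refine hF1m.not_dvd_of_natDegree_lt (natCast_ne_zero' (hchar d2 hn2 (by omega))) ?_ h2
        rwa [natDegree_natCast]
      · exact (hF1irr.prime.dvd_or_dvd h2).elim hdvd hndvd
    · intro i hi
      rw [← nsmul_eq_mul, ← nsmul_eq_mul, coeff_sub, coeff_smul, coeff_smul]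
      have h1 : (F2 * derivative F1).natDegree ≤ d2 + (d1 - 1) :=
        natDegree_mul_le.trans (by gcongr; exact natDegree_derivative_le F1)
      have h2 : (F1 * derivative F2).natDegree ≤ d1 + (d2 - 1) :=
        natDegree_mul_le.trans (by gcongr; exact natDegree_derivative_le F2)
      rcases eq_or_lt_of_le hi with hi | hi
      · have e1 : i = d2 + (d1 - 1) := by omega
        have e2 : i = d1 + (d2 - 1) := by omega
        have h3 : (F2 * derivative F1).coeff i = d1 := by
          rw [e1, coeff_mul_add_eq_of_natDegree_le le_rfl (natDegree_derivative_le F1),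
            coeff_derivative_of_monic hF1m hn1, hF2m.coeff_natDegree, one_mul]
        have h4 : (F1 * derivative F2).coeff i = d2 := by
          rw [e2, coeff_mul_add_eq_of_natDegree_le le_rfl (natDegree_derivative_le F2),
            coeff_derivative_of_monic hF2m hn2, hF1m.coeff_natDegree, one_mul]
        rw [h3, h4, nsmul_eq_mul, nsmul_eq_mul]
        ring
      · rw [coeff_eq_zero_of_natDegree_lt (h1.trans_lt (by omega)),
          coeff_eq_zero_of_natDegree_lt (h2.trans_lt (by omega)), smul_zero, smul_zero, sub_zero]
    · intro i hi
      have hn : ∀ q : k[X][X], 0 < q.natDegree → q.Monic → (dT q).natDegree ≤ q.natDegree - 1 := by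
        intro q hq hqm
        rw [natDegree_le_iff_coeff_eq_zero]
        intro j hj
        rw [coeff_dT]
        rcases eq_or_lt_of_le (show q.natDegree ≤ j by omega) with h | h
        · rw [← h, hqm.coeff_natDegree, derivative_one]
        · rw [coeff_eq_zero_of_natDegree_lt h, derivative_zero]
      have h1 : (F2 * dT F1).natDegree ≤ d2 + (d1 - 1) :=
        natDegree_mul_le.trans (by gcongr; exact hn F1 hn1 hF1m)
      have h2 : (F1 * dT F2).natDegree ≤ d1 + (d2 - 1) :=
        natDegree_mul_le.trans (by gcongr; exact hn F2 hn2 hF2m)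
      rw [← nsmul_eq_mul, ← nsmul_eq_mul, coeff_sub, coeff_smul, coeff_smul,
        coeff_eq_zero_of_natDegree_lt (h1.trans_lt (by omega)),
        coeff_eq_zero_of_natDegree_lt (h2.trans_lt (by omega)), smul_zero, smul_zero, sub_zero]
    · exact (((ht2.mul ht1.derivative).natCast_mul _).mono (by omega)).sub
        (((ht1.mul ht2.derivative).natCast_mul _).mono (by omega))
    · exact (((ht2.mul ht1.dT).natCast_mul _).mono (by omega)).sub
        (((ht1.mul ht2.dT).natCast_mul _).mono (by omega))

end Reducible

section Slice

variable {n : ℕ} {R : Type*} [CommRing R]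

/-- The fibre of `f` over the point `b`, as a polynomial in the first variable. -/
noncomputable def fib (b : Fin n → R) : MvPolynomial (Fin (n + 1)) ℤ →+* R[X] :=
  (MvPolynomial.aeval (Fin.cons X fun i => C (b i))).toRingHom

/-- The restriction of `f` to the plane spanned by the first coordinate direction and the line
`t ↦ b + t a`. -/
noncomputable def slice (b a : Fin n → R) : MvPolynomial (Fin (n + 1)) ℤ →+* R[X][X] :=
  (MvPolynomial.aeval (Fin.cons X fun i => C (C (b i) + X * C (a i)))).toRingHom

lemma fib_apply (b : Fin n → R) (f : MvPolynomial (Fin (n + 1)) ℤ) :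
    fib b f = MvPolynomial.aeval (Fin.cons X fun i => C (b i)) f := rfl

lemma slice_apply (b a : Fin n → R) (f : MvPolynomial (Fin (n + 1)) ℤ) :
    slice b a f = MvPolynomial.aeval (Fin.cons X fun i => C (C (b i) + X * C (a i))) f := rfl

lemma fib_eq_map (b : Fin n → R) (f : MvPolynomial (Fin (n + 1)) ℤ) :
    fib b f = (MvPolynomial.finSuccEquiv ℤ n f).map
      (MvPolynomial.aeval (R := ℤ) b : MvPolynomial (Fin n) ℤ →+* R) := by
  have : fib b = (mapRingHom (MvPolynomial.aeval (R := ℤ) b : MvPolynomial (Fin n) ℤ →+* R)).comp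
      ((MvPolynomial.finSuccEquiv ℤ n : MvPolynomial (Fin (n + 1)) ℤ →+* _)) := by
    refine MvPolynomial.ringHom_ext (by simp) fun i => ?_
    refine Fin.cases ?_ (fun i => ?_) i <;>
      simp [fib_apply, MvPolynomial.finSuccEquiv_X_zero, MvPolynomial.finSuccEquiv_X_succ]
  rw [this]
  rfl

lemma slice_map_eval (b a : Fin n → R) (t : R) (f : MvPolynomial (Fin (n + 1)) ℤ) :
    (slice b a f).map (evalRingHom t) = fib (b + t • a) f := by
  have : (mapRingHom (evalRingHom t)).comp (slice b a) = fib (b + t • a) := by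
    refine MvPolynomial.ringHom_ext (by simp) fun i => ?_
    refine Fin.cases ?_ (fun i => ?_) i
    · simp [fib_apply, slice_apply]
    · simpa [fib_apply, slice_apply] using mul_comm _ _
  rw [← this]
  rfl

lemma slice_map {S : Type*} [CommRing S] (φ : R →+* S) (b a : Fin n → R)
    (f : MvPolynomial (Fin (n + 1)) ℤ) :
    (slice b a f).map (mapRingHom φ) = slice (φ ∘ b) (φ ∘ a) f := by
  have : (mapRingHom (mapRingHom φ)).comp (slice b a) = slice (φ ∘ b) (φ ∘ a) := by
    refine MvPolynomial.ringHom_ext (by simp) fun i => ?_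
    refine Fin.cases ?_ (fun i => ?_) i <;> simp [slice_apply]
  rw [← this]
  rfl

lemma fib_map {S : Type*} [CommRing S] (φ : R →+* S) (b : Fin n → R)
    (f : MvPolynomial (Fin (n + 1)) ℤ) : (fib b f).map φ = fib (φ ∘ b) f := by
  have : (mapRingHom φ).comp (fib b) = fib (φ ∘ b) := by
    refine MvPolynomial.ringHom_ext (by simp) fun i => ?_
    refine Fin.cases ?_ (fun i => ?_) i <;> simp [fib_apply]
  rw [← this]
  rfl

lemma fib_eval (b : Fin n → R) (x : R) (f : MvPolynomial (Fin (n + 1)) ℤ) :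
    (fib b f).eval x = MvPolynomial.aeval (Fin.cons x b) f := by
  have : (evalRingHom x).comp (fib b) =
      (MvPolynomial.aeval (R := ℤ) (Fin.cons x b) : MvPolynomial (Fin (n + 1)) ℤ →+* R) := by
    refine MvPolynomial.ringHom_ext (by simp) fun i => ?_
    refine Fin.cases ?_ (fun i => ?_) i <;> simp [fib_apply]
  exact congrArg (fun ψ => ψ f) this

lemma BiDegLE.prod {ι : Type*} (s : Finset ι) (q : ι → R[X][X]) (m : ι → ℕ)
    (h : ∀ i ∈ s, BiDegLE (m i) (q i)) : BiDegLE (∑ i ∈ s, m i) (∏ i ∈ s, q i) := by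
  classical
  induction s using Finset.induction_on with
  | empty => simpa using BiDegLE.one 0
  | insert a s ha ih =>
    rw [Finset.sum_insert ha, Finset.prod_insert ha]
    exact (h a (by simp)).mul (ih fun i hi => h i (by simp [hi]))

lemma sum_le_totalDegree {σ S : Type*} [Fintype σ] [CommSemiring S] {f : MvPolynomial σ S}
    {m : σ →₀ ℕ} (hm : m ∈ f.support) : ∑ i, m i ≤ f.totalDegree := by
  have := MvPolynomial.le_totalDegree hm
  rwa [Finsupp.sum_fintype _ _ (by simp)] at this

lemma biDegLE_slice {d : ℕ} (b a : Fin n → R) {f : MvPolynomial (Fin (n + 1)) ℤ}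
    (hf : f.totalDegree ≤ d) : BiDegLE d (slice b a f) := by
  rw [slice_apply, MvPolynomial.aeval_def, MvPolynomial.eval₂_eq']
  refine BiDegLE.sum _ _ fun m hm => ?_
  have h1 : BiDegLE 0 (algebraMap ℤ R[X][X] (f.coeff m)) := by
    have : algebraMap ℤ R[X][X] (f.coeff m) = monomial 0 (C ((f.coeff m : ℤ) : R)) := by
      simp
    rw [this]
    exact BiDegLE.monomial (l := 0) _ (by simp)
  have h2 : ∀ i ∈ Finset.univ, BiDegLE (m i) ((Fin.cons X fun i => C (C (b i) + X * C (a i)) :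
      Fin (n + 1) → R[X][X]) i ^ m i) := by
    intro i _
    have : BiDegLE 1 ((Fin.cons X fun i => C (C (b i) + X * C (a i)) :
        Fin (n + 1) → R[X][X]) i) := by
      refine Fin.cases ?_ (fun i => ?_) i
      · rw [Fin.cons_zero, ← monomial_one_one_eq_X]
        exact BiDegLE.monomial (n := 1) (l := 0) _ (by simp)
      · rw [Fin.cons_succ, ← monomial_zero_left]
        refine (BiDegLE.monomial (n := 0) (l := 1) _ ?_).mono le_rfl
        refine (natDegree_add_le _ _).trans (max_le (by simp) ?_)
        exact (natDegree_mul_C_le _ _).trans natDegree_X_le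
    simpa using this.pow (m i)
  refine (h1.mul (BiDegLE.prod _ _ _ h2)).mono ?_
  rw [zero_add]
  exact (sum_le_totalDegree hm).trans hf

lemma finSuccEquiv_coeff_eq {S : Type*} [CommRing S] {d : ℕ} {f : MvPolynomial (Fin (n + 1)) S}
    (hf : f.totalDegree ≤ d) : (MvPolynomial.finSuccEquiv S n f).coeff d =
      MvPolynomial.C (f.coeff (Finsupp.single 0 d)) := by
  classical
  ext m
  rw [MvPolynomial.finSuccEquiv_coeff_coeff, MvPolynomial.coeff_C]
  split_ifs with h
  · rw [← h]
    congr 1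
    ext i
    refine Fin.cases ?_ (fun i => ?_) i <;> simp
  · by_contra hne
    have h1 := (sum_le_totalDegree (MvPolynomial.mem_support_iff.2 hne)).trans hf
    rw [Fin.sum_univ_succ] at h1
    simp only [Finsupp.cons_zero, Finsupp.cons_succ] at h1
    apply h
    ext i
    have := Finset.single_le_sum (f := fun i => m i) (fun i _ => Nat.zero_le _) (Finset.mem_univ i)
    simp only [Finsupp.coe_zero, Pi.zero_apply]
    omega

lemma finSuccEquiv_natDegree_le {S : Type*} [CommRing S] {d : ℕ}
    {f : MvPolynomial (Fin (n + 1)) S} (hf : f.totalDegree ≤ d) :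
    (MvPolynomial.finSuccEquiv S n f).natDegree ≤ d := by
  rw [MvPolynomial.natDegree_finSuccEquiv]
  exact (MvPolynomial.degreeOf_le_totalDegree f 0).trans hf

/-- The coefficient of the `d`-th power of the first variable. -/
noncomputable def lead (d : ℕ) (f : MvPolynomial (Fin (n + 1)) ℤ) : ℤ :=
  f.coeff (Finsupp.single 0 d)

lemma fib_coeff {d : ℕ} (b : Fin n → R) {f : MvPolynomial (Fin (n + 1)) ℤ}
    (hf : f.totalDegree ≤ d) : (fib b f).coeff d = (lead d f : R) := by
  rw [fib_eq_map, coeff_map, finSuccEquiv_coeff_eq hf]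
  simp [lead]

lemma fib_natDegree_le {d : ℕ} (b : Fin n → R) {f : MvPolynomial (Fin (n + 1)) ℤ}
    (hf : f.totalDegree ≤ d) : (fib b f).natDegree ≤ d := by
  rw [fib_eq_map]
  exact natDegree_map_le.trans (finSuccEquiv_natDegree_le hf)

lemma slice_coeff {d : ℕ} (b a : Fin n → R) {f : MvPolynomial (Fin (n + 1)) ℤ}
    (hf : f.totalDegree ≤ d) :
    (slice b a f).coeff d = C (lead d f : R) := by
  have h1 := (biDegLE_slice b a hf).natDegree_coeff_le d
  rw [Nat.sub_self, Nat.le_zero] at h1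
  rw [eq_C_of_natDegree_eq_zero h1]
  have h2 := congrArg (fun q => q.coeff d) (slice_map_eval b a 0 f)
  simp only [coeff_map, fib_coeff _ hf] at h2
  rw [← h2, coe_evalRingHom, ← coeff_zero_eq_eval_zero]

end Slice

section MonicSlice

variable {n : ℕ} {k : Type*} [Field k]

/-- The slice of `f`, normalised to be monic. -/
noncomputable def monicSlice (d : ℕ) (b a : Fin n → k) (f : MvPolynomial (Fin (n + 1)) ℤ) :
    k[X][X] := C (C ((lead d f : k)⁻¹)) * slice b a f

variable {d : ℕ} {f : MvPolynomial (Fin (n + 1)) ℤ} (b a : Fin n → k)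

lemma biDegLE_monicSlice (hf : f.totalDegree ≤ d) : BiDegLE d (monicSlice d b a f) := by
  rw [monicSlice]
  have : BiDegLE 0 (C (C ((lead d f : k)⁻¹))) := by
    rw [← monomial_zero_left]
    exact BiDegLE.monomial (n := 0) (l := 0) _ (by simp)
  simpa using this.mul (biDegLE_slice b a hf)

lemma monicSlice_monic (hf : f.totalDegree ≤ d) (hl : (lead d f : k) ≠ 0) :
    (monicSlice d b a f).Monic := by
  refine monic_of_natDegree_le_of_coeff_eq_one d (biDegLE_monicSlice b a hf).natDegree_le ?_
  rw [monicSlice, coeff_C_mul, slice_coeff b a hf, ← C_mul, inv_mul_cancel₀ hl, C_1]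

lemma monicSlice_natDegree (hf : f.totalDegree ≤ d)
    (hl : (lead d f : k) ≠ 0) : (monicSlice d b a f).natDegree = d := by
  refine natDegree_eq_of_le_of_coeff_ne_zero (biDegLE_monicSlice b a hf).natDegree_le ?_
  rw [monicSlice, coeff_C_mul, slice_coeff b a hf, ← C_mul, inv_mul_cancel₀ hl, C_1]
  exact one_ne_zero

lemma monicSlice_map_eval (t : k) : (monicSlice d b a f).map (evalRingHom t) =
    C (lead d f : k)⁻¹ * fib (b + t • a) f := by
  rw [monicSlice, Polynomial.map_mul, slice_map_eval]
  simp

lemma rup_C_mul (c : k) (F g h : k[X][X]) : rup (C (C c) * F) g h = C (C c) * rup F g h := by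
  have h1 : dT (C (C c) : k[X][X]) = 0 := (dT (k := k)).map_algebraMap c
  rw [rup, rup, derivative_mul, Derivation.leibniz, h1, derivative_C, smul_zero, smul_eq_mul]
  ring

end MonicSlice

lemma exists_det_submatrix_ne_zero {K ι κ : Type} [Field K] [Fintype κ] [DecidableEq κ]
    (M : Matrix ι κ K) (hM : ∀ v, M.mulVec v = 0 → v = 0) :
    ∃ r : κ → ι, Function.Injective r ∧ (M.submatrix r id).det ≠ 0 := by
  have hspan : Submodule.span K (Set.range M.row) = ⊤ := by
    by_contra hne
    obtain ⟨φ, hφ, hle⟩ := Submodule.exists_le_ker_of_lt_top _ (lt_top_iff_ne_top.2 hne)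
    apply hφ
    have h1 : (fun j => φ (Pi.single j 1)) = 0 := by
      apply hM
      ext i
      have h2 : φ (M.row i) = 0 := hle (Submodule.subset_span ⟨i, rfl⟩)
      rw [LinearMap.pi_apply_eq_sum_univ] at h2
      have hs : ∀ j : κ, (fun j' => if j = j' then (1 : K) else 0) = Pi.single j 1 := by
        intro j
        ext j'
        simp [Pi.single_apply, eq_comm]
      simpa [Matrix.mulVec, dotProduct, hs] using h2
    refine LinearMap.pi_ext' fun j => LinearMap.ext_ring ?_
    simpa using congrFun h1 j
  obtain ⟨κ', r, hr, hsp, hli⟩ := exists_linearIndependent' K M.row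
  rw [hspan] at hsp
  let bas := Module.Basis.mk hli hsp.ge
  let e : κ ≃ κ' := (Pi.basisFun K κ).indexEquiv bas
  refine ⟨r ∘ e, hr.comp e.injective, ?_⟩
  rw [← isUnit_iff_ne_zero, ← Matrix.isUnit_iff_isUnit_det,
      ← Matrix.linearIndependent_rows_iff_isUnit]
  exact hli.comp e e.injective

section RupMap

variable {R : Type*} [CommRing R]

/-- The index set for the unknown coefficients of a pair `(g, h)`. -/
abbrev Cols (d : ℕ) := (Fin (d - 1) × Fin (d + 1)) ⊕ (Fin d × Fin (d + 1))

lemma card_cols_le (d : ℕ) (hd : 0 < d) : Fintype.card (Cols d) ≤ 3 * d ^ 2 := by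
  simp only [Cols, Fintype.card_sum, Fintype.card_prod, Fintype.card_fin]
  obtain ⟨e, rfl⟩ : ∃ e, d = e + 1 := ⟨d - 1, by omega⟩
  simp only [Nat.add_sub_cancel]
  nlinarith

/-- The bivariate polynomial attached to an unknown. -/
noncomputable def colFst {d : ℕ} : Cols d → R[X][X] :=
  Sum.elim (fun i => monomial i.1 (monomial i.2 1)) 0

/-- The bivariate polynomial attached to an unknown. -/
noncomputable def colSnd {d : ℕ} : Cols d → R[X][X] :=
  Sum.elim 0 (fun i => monomial i.1 (monomial i.2 1))

/-- The matrix of the linear map `(g, h) ↦ rup F g h`. -/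
noncomputable def rupMat (d : ℕ) (F : R[X][X]) : Matrix (ℕ × ℕ) (Cols d) R :=
  Matrix.of fun r c => ((rup F (colFst c) (colSnd c)).coeff r.1).coeff r.2

lemma dT_map {S : Type*} [CommRing S] (φ : R →+* S) (q : R[X][X]) :
    dT (q.map (mapRingHom φ)) = (dT q).map (mapRingHom φ) := by
  ext1 i
  rw [coeff_dT, coeff_map, coeff_map, coeff_dT, coe_mapRingHom, derivative_map]

lemma rup_map {S : Type*} [CommRing S] (φ : R →+* S) (F g h : R[X][X]) :
    rup (F.map (mapRingHom φ)) (g.map (mapRingHom φ)) (h.map (mapRingHom φ)) =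
      (rup F g h).map (mapRingHom φ) := by
  simp only [rup, dT_map, derivative_map, Polynomial.map_add, Polynomial.map_sub,
    Polynomial.map_mul]

lemma rupMat_map {S : Type*} [CommRing S] (φ : R →+* S) (d : ℕ) (F : R[X][X]) :
    rupMat d (F.map (mapRingHom φ)) = (rupMat d F).map φ := by
  ext r c
  have h1 : (colFst c : S[X][X]) = (colFst c).map (mapRingHom φ) := by
    rcases c with c | c <;> simp [colFst, map_monomial]
  have h2 : (colSnd c : S[X][X]) = (colSnd c).map (mapRingHom φ) := by
    rcases c with c | c <;> simp [colSnd, map_monomial]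
  simp only [rupMat, Matrix.of_apply, Matrix.map_apply]
  rw [h1, h2, rup_map, coeff_map, coe_mapRingHom, coeff_map]

lemma rup_sum_smul {ι : Type*} (s : Finset ι) (F : R[X][X]) (v : ι → R) (g h : ι → R[X][X]) :
    rup F (∑ i ∈ s, v i • g i) (∑ i ∈ s, v i • h i) = ∑ i ∈ s, v i • rup F (g i) (h i) := by
  simp only [rup, map_sum, Derivation.map_smul, derivative_smul, Finset.mul_sum, Finset.sum_mul,
    smul_add, smul_sub, Finset.sum_add_distrib, Finset.sum_sub_distrib, mul_smul_comm,
    smul_mul_assoc]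

lemma sum_colFst {d : ℕ} (v : Cols d → R) :
    ∑ c, v c • colFst c = box (d - 1) (d + 1) (v ∘ Sum.inl) := by
  simp [Fintype.sum_sum_type, colFst, box_apply, smul_monomial]

lemma sum_colSnd {d : ℕ} (v : Cols d → R) :
    ∑ c, v c • colSnd c = box d (d + 1) (v ∘ Sum.inr) := by
  simp [Fintype.sum_sum_type, colSnd, box_apply, smul_monomial]

lemma rupMat_mulVec {d : ℕ} (F : R[X][X]) (v : Cols d → R) (r : ℕ × ℕ) :
    (rupMat d F).mulVec v r = ((rup F (box (d - 1) (d + 1) (v ∘ Sum.inl))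
      (box d (d + 1) (v ∘ Sum.inr))).coeff r.1).coeff r.2 := by
  rw [← sum_colFst, ← sum_colSnd, rup_sum_smul]
  simp only [Matrix.mulVec, dotProduct, finsetSum_coeff, coeff_smul, smul_eq_mul, rupMat,
    Matrix.of_apply, mul_comm]

end RupMap

section Field

variable {k : Type} [Field k]

/-- If the Ruppert map has no kernel, some maximal minor does not vanish. -/
lemma exists_minor_ne_zero {d : ℕ} {F : k[X][X]}
    (hF : ∀ g h, (∀ i, d ≤ i + 1 → g.coeff i = 0) → (∀ i, d ≤ i → h.coeff i = 0) →
      rup F g h = 0 → g = 0 ∧ h = 0) :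
    ∃ r : Cols d → ℕ × ℕ, Function.Injective r ∧ ((rupMat d F).submatrix r id).det ≠ 0 := by
  refine exists_det_submatrix_ne_zero _ fun v hv => ?_
  have hbox : ∀ (m a : ℕ) (c : Fin m × Fin a → k) (i : ℕ), m ≤ i → (box m a c).coeff i = 0 :=
    fun m a c => degree_lt_iff_coeff_zero _ _ |>.1 (degree_box_lt c)
  obtain ⟨h1, h2⟩ := hF (box (d - 1) (d + 1) (v ∘ Sum.inl)) (box d (d + 1) (v ∘ Sum.inr))
    (fun i hi => hbox _ _ _ i (by omega)) (hbox _ _ _) (by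
      ext i j
      rw [← rupMat_mulVec F v (i, j), hv]
      simp)
  have hl := box_injective _ _ (h1.trans (map_zero _).symm)
  have hr := box_injective _ _ (h2.trans (map_zero _).symm)
  ext (c | c)
  · exact congrFun hl c
  · exact congrFun hr c

/-- Every maximal minor of the Ruppert matrix of a reducible polynomial vanishes. -/
lemma minor_eq_zero {d : ℕ} {F : k[X][X]} (hF : F.Monic) (hd : F.natDegree = d)
    (hFd : BiDegLE d F) (hd0 : 0 < d) (hirr : ¬ Irreducible F)
    (hchar : ∀ r, 0 < r → r ≤ d → (r : k) ≠ 0) (r : Cols d → ℕ × ℕ) :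
    ((rupMat d F).submatrix r id).det = 0 := by
  obtain ⟨g, h, h0, hne, hg, hh, htg, hth⟩ := exists_rup_eq_zero hF hd hFd.tDegLE hd0 hirr hchar
  obtain ⟨cg, hcg⟩ := exists_box_eq (m := d - 1) (fun i hi => hg i (by omega)) htg
  obtain ⟨ch, hch⟩ := exists_box_eq hh hth
  rw [← Matrix.exists_mulVec_eq_zero_iff]
  refine ⟨Sum.elim cg ch, ?_, ?_⟩
  · rintro h1
    have h2 : cg = 0 := funext fun i => congrFun h1 (Sum.inl i)
    have h3 : ch = 0 := funext fun i => congrFun h1 (Sum.inr i)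
    rw [h2, map_zero] at hcg
    rw [h3, map_zero] at hch
    exact hne.elim (fun h => h hcg.symm) (fun h => h hch.symm)
  · ext i
    have := rupMat_mulVec F (Sum.elim cg ch) (r i)
    rw [Sum.elim_comp_inl, Sum.elim_comp_inr, hcg, hch, h0] at this
    simpa [Matrix.mulVec] using this

end Field

section SimpleRoot

variable {n : ℕ}

lemma finSuccEquiv_map (f : MvPolynomial (Fin (n + 1)) ℤ) :
    MvPolynomial.finSuccEquiv ℂ n (MvPolynomial.map (Int.castRingHom ℂ) f) =
      fib (MvPolynomial.X : Fin n → MvPolynomial (Fin n) ℂ) f := by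
  have : ((MvPolynomial.finSuccEquiv ℂ n : MvPolynomial (Fin (n + 1)) ℂ →+* _)).comp
      (MvPolynomial.map (Int.castRingHom ℂ)) =
      fib (MvPolynomial.X : Fin n → MvPolynomial (Fin n) ℂ) := by
    refine MvPolynomial.ringHom_ext (by simp) fun i => ?_
    refine Fin.cases ?_ (fun i => ?_) i <;>
      simp [fib_apply, MvPolynomial.finSuccEquiv_X_zero, MvPolynomial.finSuccEquiv_X_succ]
  rw [← this]
  rfl

/-- An irreducible polynomial has a fibre with a simple root. -/
lemma exists_simple_root {d : ℕ} (hd0 : 0 < d) (q : (MvPolynomial (Fin n) ℂ)[X]) (hq : q.Monic)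
    (hqd : q.natDegree = d) (hirr : Irreducible q) : ∃ (y : Fin n → ℂ) (x : ℂ),
      (q.map (MvPolynomial.eval y)).IsRoot x ∧
      ¬ (derivative (q.map (MvPolynomial.eval y))).IsRoot x := by
  set E := FractionRing (MvPolynomial (Fin n) ℂ)
  set qE := q.map (algebraMap _ E) with hqE
  have hE : Irreducible qE := (Monic.irreducible_iff_irreducible_map_fraction_map hq).1 hirr
  have hres : resultant q (derivative q) ≠ 0 := by
    intro h0
    have h1 : (derivative qE).natDegree = (derivative q).natDegree := by
      rw [hqE, derivative_map, natDegree_map_eq_of_injective (IsFractionRing.injective _ _)]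
    have h2 := resultant_ne_zero _ _ hE.separable
    rw [h1, hqE, hq.natDegree_map, derivative_map, resultant_map_map, h0, map_zero] at h2
    exact h2 rfl
  obtain ⟨u, v, -, -, huv⟩ := exists_mul_add_mul_eq_C_resultant q (derivative q) le_rfl le_rfl
    (Or.inl (by omega))
  obtain ⟨y, hy⟩ : ∃ y, MvPolynomial.eval y (resultant q (derivative q)) ≠ 0 := by
    by_contra! h
    exact hres (MvPolynomial.funext fun y => by rw [h, map_zero])
  have hdeg : (q.map (MvPolynomial.eval y)).degree ≠ 0 := by
    rw [hq.degree_map, degree_eq_natDegree hq.ne_zero, hqd]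
    exact_mod_cast hd0.ne'
  obtain ⟨x, hx⟩ := IsAlgClosed.exists_root _ hdeg
  refine ⟨y, x, hx, fun hx' => hy ?_⟩
  have h1 := congrArg (fun r => (r.map (MvPolynomial.eval y)).eval x) huv
  simp only [Polynomial.map_add, Polynomial.map_mul, eval_add, eval_mul, map_C, eval_C,
    ← derivative_map] at h1
  rw [hx.eq_zero, hx'.eq_zero] at h1
  simpa using h1.symm

/-- The Ruppert map of a suitable slice of an absolutely irreducible polynomial is injective. -/
lemma exists_slice_rup_injective {d : ℕ} (hd0 : 0 < d) {f : MvPolynomial (Fin (n + 1)) ℤ}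
    (hf : f.totalDegree ≤ d) (hl : lead d f ≠ 0)
    (hirr : Irreducible (MvPolynomial.map (Int.castRingHom ℂ) f)) :
    ∃ b a : Fin n → FractionRing (MvPolynomial (Fin n) ℂ), ∀ g h,
      (∀ i, d ≤ i + 1 → g.coeff i = 0) → (∀ i, d ≤ i → h.coeff i = 0) →
      rup (slice b a f) g h = 0 → g = 0 ∧ h = 0 := by
  set A := MvPolynomial (Fin n) ℂ
  set E := FractionRing A
  have hlC : (lead d f : ℂ) ≠ 0 := by exact_mod_cast hl
  have hlE : (lead d f : E) ≠ 0 := by exact_mod_cast hl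
  set c : A := MvPolynomial.C (lead d f : ℂ)⁻¹ with hc
  have hcl : c * (lead d f : A) = 1 := by
    have : (lead d f : A) = MvPolynomial.C (lead d f : ℂ) := by simp
    rw [hc, this, ← MvPolynomial.C_mul, inv_mul_cancel₀ hlC, MvPolynomial.C_1]
  have hcE : algebraMap A E c = (lead d f : E)⁻¹ := by
    refine eq_inv_of_mul_eq_one_left ?_
    rw [← map_intCast (algebraMap A E), ← map_mul, hcl, map_one]
  set q : A[X] := C c * fib MvPolynomial.X f with hq
  have hqm : q.Monic := by
    refine monic_of_natDegree_le_of_coeff_eq_one d ?_ ?_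
    · exact (natDegree_C_mul_le _ _).trans (fib_natDegree_le _ hf)
    · rw [hq, coeff_C_mul, fib_coeff _ hf, hcl]
  have hqd : q.natDegree = d := by
    refine natDegree_eq_of_le_of_coeff_ne_zero
      ((natDegree_C_mul_le _ _).trans (fib_natDegree_le _ hf)) ?_
    rw [hq, coeff_C_mul, fib_coeff _ hf, hcl]
    exact one_ne_zero
  have hqirr : Irreducible q := by
    have h1 : Irreducible (fib (MvPolynomial.X : Fin n → A) f) := by
      rw [← finSuccEquiv_map]
      exact (MulEquiv.irreducible_iff (MvPolynomial.finSuccEquiv ℂ n)).2 hirr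
    have h2 : IsUnit (C c : A[X]) := isUnit_C.2 (IsUnit.of_mul_eq_one _ hcl)
    exact (irreducible_isUnit_mul h2).2 h1
  obtain ⟨y, x, hx, hx'⟩ := exists_simple_root hd0 q hqm hqd hqirr
  set ι : ℂ →+* E := (algebraMap A E).comp MvPolynomial.C with hι
  set b : Fin n → E := fun i => ι (y i) with hb
  set a : Fin n → E := fun i => algebraMap A E (MvPolynomial.X i) - b i with ha
  have hb0 : b + (0 : E) • a = b := by simp
  have hb1 : b + (1 : E) • a = algebraMap A E ∘ MvPolynomial.X := by
    ext i
    simp [ha]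
  have hm1 : (monicSlice d b a f).map (evalRingHom 1) = q.map (algebraMap A E) := by
    rw [monicSlice_map_eval, hb1, ← fib_map, hq, Polynomial.map_mul, map_C, hcE]
  have hm0 : (monicSlice d b a f).map (evalRingHom 0) = (q.map (MvPolynomial.eval y)).map ι := by
    have h3 : ⇑(MvPolynomial.eval y : A →+* ℂ) ∘ (MvPolynomial.X : Fin n → A) = y := by
      ext i
      simp
    have h4 : MvPolynomial.eval y c = (lead d f : ℂ)⁻¹ := by simp [hc]
    have h5 : ι (lead d f : ℂ)⁻¹ = (lead d f : E)⁻¹ := by rw [map_inv₀, map_intCast]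
    rw [monicSlice_map_eval, hb0, hq, Polynomial.map_mul, Polynomial.map_mul, map_C, map_C, h4, h5,
      fib_map, fib_map, h3]
    rfl
  have hmon := monicSlice_monic b a hf hlE
  have hmirr : Irreducible (monicSlice d b a f) := by
    refine hmon.irreducible_of_irreducible_map (evalRingHom 1) _ ?_
    rw [hm1]
    exact (Monic.irreducible_iff_irreducible_map_fraction_map hqm).1 hqirr
  refine ⟨b, a, fun g h hg hh hrup => ?_⟩
  refine eq_zero_of_rup_eq_zero (P := (ι x, 0)) hmon (monicSlice_natDegree b a hf hlE)
    (biDegLE_monicSlice b a hf) hmirr hd0 ?_ ?_ hg hh ?_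
  · rw [evPt_eq_eval_map, hm0, eval_map_apply, hx.eq_zero, map_zero]
  · rw [evPt_eq_eval_map, ← derivative_map, hm0, derivative_map, eval_map_apply]
    exact (_root_.map_ne_zero _).2 hx'
  · rw [monicSlice, rup_C_mul, hrup, mul_zero]

end SimpleRoot

section LOne

variable {σ : Type*}

/-- The sum of the absolute values of the coefficients. -/
noncomputable def l1 (f : MvPolynomial σ ℤ) : ℕ := ∑ m ∈ f.support, (f.coeff m).natAbs

lemma l1_eq_sum {f : MvPolynomial σ ℤ} {s : Finset (σ →₀ ℕ)} (hs : f.support ⊆ s) :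
    l1 f = ∑ m ∈ s, (f.coeff m).natAbs :=
  Finset.sum_subset hs fun m _ hm => by simpa using hm

lemma natAbs_coeff_le_l1 (f : MvPolynomial σ ℤ) (m : σ →₀ ℕ) : (f.coeff m).natAbs ≤ l1 f := by
  classical
  rw [l1_eq_sum (s := insert m f.support) (Finset.subset_insert _ _)]
  exact Finset.single_le_sum (f := fun m => (f.coeff m).natAbs) (fun _ _ => Nat.zero_le _)
    (Finset.mem_insert_self _ _)

lemma l1_zero : l1 (0 : MvPolynomial σ ℤ) = 0 := by simp [l1]

lemma l1_monomial (m : σ →₀ ℕ) (c : ℤ) : l1 (MvPolynomial.monomial m c) = c.natAbs := by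
  classical
  rw [l1_eq_sum MvPolynomial.support_monomial_subset]
  simp

lemma l1_C (c : ℤ) : l1 (MvPolynomial.C c : MvPolynomial σ ℤ) = c.natAbs := l1_monomial 0 c

lemma l1_one : l1 (1 : MvPolynomial σ ℤ) = 1 := l1_C 1

lemma l1_X (i : σ) : l1 (MvPolynomial.X i : MvPolynomial σ ℤ) = 1 := l1_monomial _ 1

lemma l1_add (f g : MvPolynomial σ ℤ) : l1 (f + g) ≤ l1 f + l1 g := by
  classical
  rw [l1_eq_sum (MvPolynomial.support_add (p := f) (q := g)),
    l1_eq_sum (f := f) (Finset.subset_union_left (s₂ := g.support)),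
    l1_eq_sum (f := g) (Finset.subset_union_right (s₁ := f.support)), ← Finset.sum_add_distrib]
  exact Finset.sum_le_sum fun m _ => by
    rw [MvPolynomial.coeff_add]
    exact Int.natAbs_add_le _ _

lemma l1_neg (f : MvPolynomial σ ℤ) : l1 (-f) = l1 f := by simp [l1]

lemma l1_sub (f g : MvPolynomial σ ℤ) : l1 (f - g) ≤ l1 f + l1 g := by
  rw [sub_eq_add_neg, ← l1_neg g]
  exact l1_add _ _

lemma l1_sum {ι : Type*} (s : Finset ι) (f : ι → MvPolynomial σ ℤ) :
    l1 (∑ i ∈ s, f i) ≤ ∑ i ∈ s, l1 (f i) := by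
  classical
  induction s using Finset.induction_on with
  | empty => simp [l1_zero]
  | insert a s ha ih =>
    rw [Finset.sum_insert ha, Finset.sum_insert ha]
    exact (l1_add _ _).trans (Nat.add_le_add_left ih _)

lemma l1_mul (f g : MvPolynomial σ ℤ) : l1 (f * g) ≤ l1 f * l1 g := by
  conv_lhs => rw [MvPolynomial.as_sum f, MvPolynomial.as_sum g, Finset.sum_mul_sum]
  refine (l1_sum _ _).trans ?_
  rw [l1, l1, Finset.sum_mul_sum]
  refine Finset.sum_le_sum fun m _ => (l1_sum _ _).trans (Finset.sum_le_sum fun m' _ => ?_)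
  rw [MvPolynomial.monomial_mul, l1_monomial, Int.natAbs_mul]

lemma l1_prod {ι : Type*} (s : Finset ι) (f : ι → MvPolynomial σ ℤ) :
    l1 (∏ i ∈ s, f i) ≤ ∏ i ∈ s, l1 (f i) := by
  classical
  induction s using Finset.induction_on with
  | empty => simp [l1_one]
  | insert a s ha ih =>
    rw [Finset.prod_insert ha, Finset.prod_insert ha]
    exact (l1_mul _ _).trans (Nat.mul_le_mul_left _ ih)

lemma l1_pow (f : MvPolynomial σ ℤ) (k : ℕ) : l1 (f ^ k) ≤ l1 f ^ k := by
  simpa using l1_prod (Finset.range k) fun _ => f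

lemma l1_bind₁_le {τ : Type*} [Fintype σ] {K d : ℕ} (hK : 1 ≤ K) {g : σ → MvPolynomial τ ℤ}
    (hg : ∀ i, l1 (g i) ≤ K) {f : MvPolynomial σ ℤ} (hf : f.totalDegree ≤ d) :
    l1 (MvPolynomial.bind₁ g f) ≤ l1 f * K ^ d := by
  rw [MvPolynomial.bind₁, MvPolynomial.aeval_def, MvPolynomial.eval₂_eq', l1.eq_def f,
    Finset.sum_mul]
  refine (l1_sum _ _).trans (Finset.sum_le_sum fun m hm => (l1_mul _ _).trans ?_)
  refine Nat.mul_le_mul (l1_C _).le ((l1_prod _ _).trans ?_)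
  calc ∏ i, l1 (g i ^ m i) ≤ ∏ i, K ^ m i :=
        Finset.prod_le_prod' fun i _ => (l1_pow _ _).trans (Nat.pow_le_pow_left (hg i) _)
    _ = K ^ ∑ i, m i := Finset.prod_pow_eq_pow_sum _ _ _
    _ ≤ K ^ d := Nat.pow_le_pow_right hK ((sum_le_totalDegree hm).trans hf)

lemma l1_det_le {N L D : ℕ} {κ : Type*} [Fintype κ] [DecidableEq κ]
    (M : Matrix κ κ (MvPolynomial σ ℤ)) (hM : ∀ i j, l1 (M i j) ≤ L)
    (hD : ∀ i j, (M i j).totalDegree ≤ D) (hN : Fintype.card κ = N) :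
    l1 M.det ≤ N.factorial * L ^ N ∧ M.det.totalDegree ≤ N * D := by
  rw [Matrix.det_apply]
  constructor
  · refine (l1_sum _ _).trans ?_
    calc _ ≤ ∑ _σ : Equiv.Perm κ, L ^ N := Finset.sum_le_sum fun e _ => ?_
      _ = _ := by rw [Finset.sum_const, Finset.card_univ, Fintype.card_perm, hN, smul_eq_mul]
    have h1 : l1 (∏ i, M (e i) i) ≤ L ^ N := by
      refine (l1_prod _ _).trans ((Finset.prod_le_prod' fun i _ => hM (e i) i).trans ?_)
      rw [Finset.prod_const, Finset.card_univ, hN]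
    rcases Int.units_eq_one_or (Equiv.Perm.sign e) with h | h
    · rwa [h, one_smul]
    · rwa [h, Units.neg_smul, one_smul, l1_neg]
  · refine MvPolynomial.totalDegree_finsetSum_le fun e _ => ?_
    have h1 : (∏ i, M (e i) i).totalDegree ≤ N * D := by
      refine (MvPolynomial.totalDegree_finsetProd _ _).trans
        ((Finset.sum_le_sum fun i _ => hD (e i) i).trans ?_)
      rw [Finset.sum_const, Finset.card_univ, hN, smul_eq_mul]
    rcases Int.units_eq_one_or (Equiv.Perm.sign e) with h | h
    · rwa [h, one_smul]
    · rwa [h, Units.neg_smul, one_smul, MvPolynomial.totalDegree_neg]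

end LOne

section CoeffBdd

variable {σ : Type*}

/-- All coefficients have total degree at most `D` and `l1` norm at most `L`. -/
def CoeffBdd (D L : ℕ) (q : (MvPolynomial σ ℤ)[X][X]) : Prop :=
  ∀ i j, ((q.coeff i).coeff j).totalDegree ≤ D ∧ l1 ((q.coeff i).coeff j) ≤ L

variable {D L L' : ℕ} {q r : (MvPolynomial σ ℤ)[X][X]}

lemma CoeffBdd.mono {D' : ℕ} (h : CoeffBdd D L q) (hD : D ≤ D') (hL : L ≤ L') :
    CoeffBdd D' L' q := fun i j => ⟨(h i j).1.trans hD, (h i j).2.trans hL⟩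

lemma CoeffBdd.zero : CoeffBdd D L (0 : (MvPolynomial σ ℤ)[X][X]) := fun i j => by
  simp [l1_zero]

lemma CoeffBdd.one : CoeffBdd D 1 (1 : (MvPolynomial σ ℤ)[X][X]) := fun i j => by
  rw [coeff_one]
  split_ifs
  · rw [coeff_one]
    split_ifs <;> simp [l1_zero, l1_one]
  · simp [l1_zero]

lemma CoeffBdd.add (h : CoeffBdd D L q) (h' : CoeffBdd D L' r) :
    CoeffBdd D (L + L') (q + r) := fun i j => by
  rw [coeff_add, coeff_add]
  exact ⟨(MvPolynomial.totalDegree_add _ _).trans (max_le (h i j).1 (h' i j).1),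
    (l1_add _ _).trans (Nat.add_le_add (h i j).2 (h' i j).2)⟩

lemma CoeffBdd.sub (h : CoeffBdd D L q) (h' : CoeffBdd D L' r) :
    CoeffBdd D (L + L') (q - r) := fun i j => by
  rw [coeff_sub, coeff_sub]
  exact ⟨(MvPolynomial.totalDegree_sub _ _).trans (max_le (h i j).1 (h' i j).1),
    (l1_sub _ _).trans (Nat.add_le_add (h i j).2 (h' i j).2)⟩

lemma CoeffBdd.sum {ι : Type*} (s : Finset ι) {L : ι → ℕ} {q : ι → (MvPolynomial σ ℤ)[X][X]}
    (h : ∀ i ∈ s, CoeffBdd D (L i) (q i)) : CoeffBdd D (∑ i ∈ s, L i) (∑ i ∈ s, q i) := by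
  classical
  induction s using Finset.induction_on with
  | empty => exact CoeffBdd.zero
  | insert a s ha ih =>
    rw [Finset.sum_insert ha, Finset.sum_insert ha]
    exact (h a (by simp)).add (ih fun i hi => h i (by simp [hi]))

lemma coeff_mul_monomial_eq_ite {R : Type*} [Semiring R] (p : R[X]) (n d : ℕ) (r : R) :
    (p * monomial n r).coeff d = if n ≤ d then p.coeff (d - n) * r else 0 := by
  rw [← C_mul_X_pow_eq_monomial, ← mul_assoc, coeff_mul_X_pow', coeff_mul_C]

lemma CoeffBdd.mul_monomial {D' : ℕ} (h : CoeffBdd D L q) (i j : ℕ) (c : MvPolynomial σ ℤ)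
    (hc : c.totalDegree ≤ D') : CoeffBdd (D + D') (L * l1 c) (q * monomial i (monomial j c)) := by
  intro i' j'
  rw [coeff_mul_monomial_eq_ite]
  split_ifs
  · rw [coeff_mul_monomial_eq_ite]
    split_ifs
    · exact ⟨(MvPolynomial.totalDegree_mul _ _).trans (Nat.add_le_add (h _ _).1 hc),
        (l1_mul _ _).trans (Nat.mul_le_mul_right _ (h _ _).2)⟩
    · simp [l1_zero]
  · simp [l1_zero]

lemma CoeffBdd.mul_natCast (h : CoeffBdd D L q) (i j d c : ℕ) (hc : c ≤ d) :
    CoeffBdd D (d * L) (q * monomial i (monomial j (c : MvPolynomial σ ℤ))) := by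
  have h1 : (c : MvPolynomial σ ℤ) = MvPolynomial.C (c : ℤ) := by simp
  refine (h.mul_monomial (D' := 0) i j c (by rw [h1, MvPolynomial.totalDegree_C])).mono le_rfl ?_
  rw [h1, l1_C, Int.natAbs_natCast, mul_comm]
  exact Nat.mul_le_mul_right _ hc

lemma CoeffBdd.natCast_bound (h : CoeffBdd D L q) (i j d c : ℕ)
    (hc : (q.coeff i).coeff j ≠ 0 → c ≤ d) :
    ((q.coeff i).coeff j * (c : MvPolynomial σ ℤ)).totalDegree ≤ D ∧
      l1 ((q.coeff i).coeff j * (c : MvPolynomial σ ℤ)) ≤ d * L := by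
  by_cases h0 : (q.coeff i).coeff j = 0
  · simp [h0, l1_zero]
  have h1 : (c : MvPolynomial σ ℤ) = MvPolynomial.C (c : ℤ) := by simp
  refine ⟨(MvPolynomial.totalDegree_mul _ _).trans ?_, (l1_mul _ _).trans ?_⟩
  · rw [h1, MvPolynomial.totalDegree_C]
    exact (h i j).1
  · rw [h1, l1_C, Int.natAbs_natCast, mul_comm]
    exact Nat.mul_le_mul (hc h0) (h i j).2

lemma CoeffBdd.dT {d : ℕ} (h : CoeffBdd D L q) (hq : BiDegLE d q) :
    CoeffBdd D (d * L) (dT q) := fun i j => by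
  rw [coeff_dT, coeff_derivative, ← Nat.cast_succ]
  refine h.natCast_bound i (j + 1) d (j + 1) fun h0 => ?_
  have := hq _ _ h0
  omega

lemma CoeffBdd.derivative {d : ℕ} (h : CoeffBdd D L q) (hq : BiDegLE d q) :
    CoeffBdd D (d * L) (derivative q) := fun i j => by
  have h1 : (q.coeff (i + 1) * ((i : (MvPolynomial σ ℤ)[X]) + 1)).coeff j =
      (q.coeff (i + 1)).coeff j * ((i + 1 : ℕ) : MvPolynomial σ ℤ) := by
    rw [← Nat.cast_succ, Polynomial.coeff_mul_natCast]
  rw [coeff_derivative, h1]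
  refine h.natCast_bound (i + 1) j d (i + 1) fun h0 => ?_
  have := hq _ _ h0
  omega

lemma rupMat_bound {d : ℕ} (h : CoeffBdd D L q) (hq : BiDegLE d q) (r : ℕ × ℕ) (c : Cols d) :
    (rupMat d q r c).totalDegree ≤ D ∧ l1 (rupMat d q r c) ≤ 2 * d * L := by
  suffices CoeffBdd D (2 * d * L) (rup q (colFst c) (colSnd c)) from this _ _
  have hdT : ∀ i j : ℕ, AuxPoly.dT (monomial i (monomial j (1 : MvPolynomial σ ℤ))) =
      monomial i (monomial (j - 1) ((j : ℕ) : MvPolynomial σ ℤ)) := by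
    intro i j
    ext1 k
    rw [coeff_dT, coeff_monomial, coeff_monomial]
    split_ifs <;> simp [derivative_monomial]
  have h2 : 2 * d * L = d * L + d * L := by ring
  rw [h2]
  rcases c with ⟨i, j⟩ | ⟨i, j⟩
  · have : rup q (colFst (Sum.inl (i, j))) (colSnd (Sum.inl (i, j))) =
        q * monomial i.1 (monomial (j.1 - 1) ((j.1 : ℕ) : MvPolynomial σ ℤ)) -
          AuxPoly.dT q * monomial i.1 (monomial j.1 1) := by
      simp only [colFst, colSnd, Sum.elim_inl, rup, hdT, Pi.zero_apply, derivative_zero]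
      ring
    rw [this]
    refine (h.mul_natCast _ _ d _ (by omega)).sub ?_
    simpa [l1_one] using (h.dT hq).mul_monomial (D' := 0) i.1 j.1 1 (by simp)
  · have : rup q (colFst (Sum.inr (i, j))) (colSnd (Sum.inr (i, j))) =
        Polynomial.derivative q * monomial i.1 (monomial j.1 1) -
          q * monomial (i.1 - 1) (monomial j.1 ((i.1 : ℕ) : MvPolynomial σ ℤ)) := by
      have hm : (monomial j.1 1 : (MvPolynomial σ ℤ)[X]) * ((i.1 : ℕ) : (MvPolynomial σ ℤ)[X]) =
          monomial j.1 ((i.1 : ℕ) : MvPolynomial σ ℤ) := by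
        rw [← C_eq_natCast, monomial_mul_C, one_mul]
      simp only [colFst, colSnd, Sum.elim_inr, rup, Pi.zero_apply, derivative_monomial, hm,
        map_zero]
      ring
    rw [this]
    refine CoeffBdd.sub ?_ (h.mul_natCast _ _ d _ (by omega))
    simpa [l1_one] using (h.derivative hq).mul_monomial (D' := 0) i.1 j.1 1 (by simp)

end CoeffBdd

section GenericSlice

variable {n d : ℕ}

/-- The slice of `f` along the line with indeterminate coefficients. -/
noncomputable def genSlice (f : MvPolynomial (Fin (n + 1)) ℤ) :
    (MvPolynomial (Fin n ⊕ Fin n) ℤ)[X][X] :=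
  slice (fun i => MvPolynomial.X (Sum.inl i)) (fun i => MvPolynomial.X (Sum.inr i)) f

lemma genSlice_map {R : Type*} [CommRing R] (b a : Fin n → R) (f : MvPolynomial (Fin (n + 1)) ℤ) :
    (genSlice f).map (mapRingHom (MvPolynomial.aeval (R := ℤ) (Sum.elim b a) :
      MvPolynomial (Fin n ⊕ Fin n) ℤ →+* R)) = slice b a f := by
  have hb : ⇑(MvPolynomial.aeval (R := ℤ) (Sum.elim b a) :
      MvPolynomial (Fin n ⊕ Fin n) ℤ →+* R) ∘ (fun i => MvPolynomial.X (Sum.inl i)) = b := by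
    ext i
    simp
  have ha : ⇑(MvPolynomial.aeval (R := ℤ) (Sum.elim b a) :
      MvPolynomial (Fin n ⊕ Fin n) ℤ →+* R) ∘ (fun i => MvPolynomial.X (Sum.inr i)) = a := by
    ext i
    simp
  exact (slice_map _ _ _ f).trans (by rw [hb, ha])

lemma coeffBdd_genSlice {f : MvPolynomial (Fin (n + 1)) ℤ} (hf : f.totalDegree ≤ d) :
    CoeffBdd d (l1 f * 2 ^ d) (genSlice f) := by
  have hlin : ∀ {D L : ℕ} {q : (MvPolynomial (Fin n ⊕ Fin n) ℤ)[X][X]} (i : Fin n) (k : ℕ),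
      CoeffBdd D L q → CoeffBdd (D + k) (L * 2 ^ k)
        (q * (C (C (MvPolynomial.X (Sum.inl i)) + X * C (MvPolynomial.X (Sum.inr i)))) ^ k) := by
    intro D L q i k h
    induction k with
    | zero => simpa using h
    | succ k ih =>
      set l := C (C (MvPolynomial.X (Sum.inl i) : MvPolynomial (Fin n ⊕ Fin n) ℤ) +
        X * C (MvPolynomial.X (Sum.inr i))) with hl
      have h0 : q * l ^ (k + 1) = q * l ^ k * C (C (MvPolynomial.X (Sum.inl i))) +
          q * l ^ k * C (X * C (MvPolynomial.X (Sum.inr i))) := by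
        rw [← mul_add, ← C_add, pow_succ, mul_assoc]
      rw [h0]
      have h1 := ih.mul_monomial (D' := 1) 0 0 (MvPolynomial.X (Sum.inl i)) (by simp)
      have h2 := ih.mul_monomial (D' := 1) 0 1 (MvPolynomial.X (Sum.inr i)) (by simp)
      rw [l1_X, mul_one, monomial_zero_left, ← C_mul_X_pow_eq_monomial, pow_zero, mul_one] at h1
      rw [l1_X, mul_one, monomial_zero_left, ← C_mul_X_pow_eq_monomial, pow_one,
        mul_comm (C _) X] at h2
      exact (h1.add h2).mono (by omega) (by rw [pow_succ]; linarith)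
  have hX : ∀ {D L : ℕ} {q : (MvPolynomial (Fin n ⊕ Fin n) ℤ)[X][X]} (k : ℕ),
      CoeffBdd D L q → CoeffBdd (D + k) (L * 2 ^ k) (q * X ^ k) := by
    intro D L q k h
    have h1 := h.mul_monomial (D' := 0) k 0 1 (by simp)
    rw [monomial_zero_left, C_1, monomial_one_right_eq_X_pow, l1_one] at h1
    exact h1.mono (by omega) (Nat.mul_le_mul_left _ Nat.one_le_two_pow)
  have hprod : ∀ (s : Finset (Fin (n + 1))) (m : Fin (n + 1) → ℕ) {D L : ℕ}
      {q : (MvPolynomial (Fin n ⊕ Fin n) ℤ)[X][X]}, CoeffBdd D L q →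
      CoeffBdd (D + ∑ i ∈ s, m i) (L * 2 ^ (∑ i ∈ s, m i)) (q * ∏ i ∈ s,
        (Fin.cons X (fun i => C (C (MvPolynomial.X (Sum.inl i)) +
          X * C (MvPolynomial.X (Sum.inr i)))) :
          Fin (n + 1) → (MvPolynomial (Fin n ⊕ Fin n) ℤ)[X][X]) i ^ m i) := by
    classical
    intro s m D L q h
    induction s using Finset.induction_on generalizing D L q with
    | empty => simpa using h
    | insert a s ha ih =>
      rw [Finset.sum_insert ha, Finset.prod_insert ha, ← mul_assoc, pow_add, ← mul_assoc,
        ← add_assoc]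
      apply ih
      refine Fin.cases ?_ (fun i => ?_) a
      · exact hX _ h
      · exact hlin i _ h
  rw [genSlice, slice_apply, MvPolynomial.aeval_def, MvPolynomial.eval₂_eq', l1, Finset.sum_mul]
  refine CoeffBdd.sum _ fun m hm => ?_
  have h0 : CoeffBdd 0 (f.coeff m).natAbs
      (algebraMap ℤ (MvPolynomial (Fin n ⊕ Fin n) ℤ)[X][X] (f.coeff m)) := by
    have h1 := (CoeffBdd.one (D := 0)).mul_monomial (D' := 0) 0 0
      (MvPolynomial.C (f.coeff m) : MvPolynomial (Fin n ⊕ Fin n) ℤ)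
          (MvPolynomial.totalDegree_C _).le
    rw [one_mul, l1_C, one_mul, monomial_zero_left, monomial_zero_left] at h1
    exact h1
  have h1 := (sum_le_totalDegree hm).trans hf
  exact (hprod Finset.univ m h0).mono (by omega)
    (Nat.mul_le_mul_left _ (Nat.pow_le_pow_right two_pos h1))

end GenericSlice

/-- The Ruppert certificate: outside the zero set of a polynomial `D` of controlled size, the
plane slices of an absolutely irreducible polynomial remain irreducible modulo large primes. -/
theorem exists_certificate {n d : ℕ} (hd0 : 0 < d) {f : MvPolynomial (Fin (n + 1)) ℤ}
    (hf : f.totalDegree ≤ d) (hl : lead d f ≠ 0)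
    (hirr : Irreducible (MvPolynomial.map (Int.castRingHom ℂ) f)) :
    ∃ D : MvPolynomial (Fin n ⊕ Fin n) ℤ, D ≠ 0 ∧ D.totalDegree ≤ 3 * d ^ 3 ∧
      (∃ N ≤ 3 * d ^ 2, l1 D ≤ N.factorial * (2 * d * (l1 f * 2 ^ d)) ^ N) ∧
      ∀ (p : ℕ) [Fact p.Prime], d < p → ((lead d f : ℤ) : ZMod p) ≠ 0 → ∀ b a : Fin n → ZMod p,
        MvPolynomial.aeval (R := ℤ) (Sum.elim b a) D ≠ 0 → Irreducible (monicSlice d b a f) := by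
  obtain ⟨b, a, hinj⟩ := exists_slice_rup_injective hd0 hf hl hirr
  obtain ⟨r, -, hr⟩ := exists_minor_ne_zero hinj
  have hmap : ∀ {R : Type} [CommRing R] (b a : Fin n → R),
      MvPolynomial.aeval (R := ℤ) (Sum.elim b a) ((rupMat d (genSlice f)).submatrix r id).det =
        ((rupMat d (slice b a f)).submatrix r id).det := by
    intro R _ b a
    rw [← genSlice_map b a f, rupMat_map]
    exact RingHom.map_det _ _
  have hbd := fun i j => rupMat_bound (coeffBdd_genSlice hf)
    (biDegLE_slice (fun i => MvPolynomial.X (Sum.inl i)) (fun i => MvPolynomial.X (Sum.inr i)) hf)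
    (r i) j
  obtain ⟨h1, h2⟩ := l1_det_le ((rupMat d (genSlice f)).submatrix r id) (fun i j => (hbd i j).2)
    (fun i j => (hbd i j).1) rfl
  refine ⟨((rupMat d (genSlice f)).submatrix r id).det, ?_, ?_, ⟨_, card_cols_le d hd0, h1⟩, ?_⟩
  · intro h0
    apply hr
    rw [← hmap, h0, map_zero]
  · calc _ ≤ _ := h2
      _ ≤ 3 * d ^ 2 * d := Nat.mul_le_mul_right _ (card_cols_le d hd0)
      _ = 3 * d ^ 3 := by ring
  · intro p _ hp hlp b a hD
    by_contra hirr
    apply hD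
    rw [hmap]
    have h3 := minor_eq_zero (monicSlice_monic b a hf hlp) (monicSlice_natDegree b a hf hlp)
      (biDegLE_monicSlice b a hf) hd0 hirr (fun r h0 hr h => by
        rw [ZMod.natCast_eq_zero_iff] at h
        exact absurd (Nat.le_of_dvd h0 h) (by omega)) r
    have h4 : (rupMat d (monicSlice d b a f)).submatrix r id =
        ((lead d f : ZMod p)⁻¹) • (rupMat d (slice b a f)).submatrix r id := by
      ext i j
      simp [rupMat, monicSlice, rup_C_mul]
    rw [h4, Matrix.det_smul, mul_eq_zero] at h3
    exact h3.resolve_left (pow_ne_zero _ (inv_ne_zero hlp))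

section Weight

variable {p : ℕ} [Fact p.Prime]

/-- Counting zeros of a polynomial over a prime field. -/
lemma card_zeros_mul_le {σ : Type*} [Fintype σ] [DecidableEq σ] (P : MvPolynomial σ (ZMod p))
    (hP : P ≠ 0) : p * (Finset.univ.filter fun x : σ → ZMod p => MvPolynomial.eval x P = 0).card ≤
      P.totalDegree * p ^ Fintype.card σ := by
  classical
  set e := Fintype.equivFin σ
  set Q := MvPolynomial.rename e P with hQ
  have hQ0 : Q ≠ 0 := fun h => hP
      (MvPolynomial.rename_injective e e.injective (h.trans (map_zero _).symm))
  have hQd : Q.totalDegree = P.totalDegree := MvPolynomial.totalDegree_renameEquiv e P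
  have h1 := MvPolynomial.schwartz_zippel_totalDegree hQ0 (Finset.univ : Finset (ZMod p))
  have hp0 : (0 : ℚ≥0) < p := by exact_mod_cast (Fact.out : p.Prime).pos
  rw [Finset.card_univ, ZMod.card, hQd, div_le_div_iff₀ (by positivity) hp0] at h1
  have h2 : (Finset.univ.filter fun x : σ → ZMod p => MvPolynomial.eval x P = 0).card =
      ((Fintype.piFinset fun _ => (Finset.univ : Finset (ZMod p))).filter
        fun x => MvPolynomial.eval x Q = 0).card := by
    refine Finset.card_bij (fun x _ => x ∘ e.symm) ?_ ?_ ?_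
    · intro x hx
      simp only [Finset.mem_filter, Fintype.mem_piFinset, Finset.mem_univ, implies_true, true_and]
        at hx ⊢
      rw [hQ, MvPolynomial.eval_rename, Function.comp_assoc, e.symm_comp_self, Function.comp_id, hx]
    · intro x _ y _ h
      exact e.symm.surjective.injective_comp_right h
    · intro x hx
      refine ⟨x ∘ e, ?_, by rw [Function.comp_assoc, e.self_comp_symm, Function.comp_id]⟩
      simp only [Finset.mem_filter, Fintype.mem_piFinset, Finset.mem_univ, implies_true, true_and]
        at hx ⊢
      rwa [hQ, MvPolynomial.eval_rename] at hx
  rw [h2]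
  rw [mul_comm]
  exact_mod_cast h1

lemma totalDegree_map_le {σ R S : Type*} [CommSemiring R] [CommSemiring S] (φ : R →+* S)
    (P : MvPolynomial σ R) : (MvPolynomial.map φ P).totalDegree ≤ P.totalDegree :=
  Finset.sup_mono (MvPolynomial.support_map_subset φ P)

variable {n d : ℕ}

/-- The weight of the fibre of `f` over the point `a`. -/
noncomputable def weight (d : ℕ) (f : MvPolynomial (Fin (n + 1)) ℤ) (a : Fin n → ZMod p) : ℕ :=
  fiberWeight d (C ((lead d f : ZMod p)⁻¹) * fib a f)

lemma weight_le {f : MvPolynomial (Fin (n + 1)) ℤ} (hf : f.totalDegree ≤ d)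
    (hl : (lead d f : ZMod p) ≠ 0) (a : Fin n → ZMod p) : weight d f a ≤ d := by
  refine fiberWeight_le (fun h => ?_) ((natDegree_C_mul_le _ _).trans (fib_natDegree_le _ hf))
  have := congrArg (fun q => q.coeff d) h
  simp only [coeff_C_mul, fib_coeff _ hf, inv_mul_cancel₀ hl, coeff_zero] at this
  exact one_ne_zero this

lemma sum_weight_le (hd0 : 0 < d) {f : MvPolynomial (Fin (n + 1)) ℤ} (hf : f.totalDegree ≤ d)
    (hl : (lead d f : ZMod p) ≠ 0) {D : MvPolynomial (Fin n ⊕ Fin n) ℤ}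
    (hDd : D.totalDegree ≤ 3 * d ^ 3)
    (hD : MvPolynomial.map (Int.castRingHom (ZMod p)) D ≠ 0)
    (hcert : ∀ b a : Fin n → ZMod p,
      MvPolynomial.aeval (R := ℤ) (Sum.elim b a) D ≠ 0 → Irreducible (monicSlice d b a f))
    (hp : 64 * d ^ 2 ≤ Nat.sqrt p) :
    p * ∑ a : Fin n → ZMod p, weight d f a ≤ p ^ n * (p + 203 * d ^ 2 * Nat.sqrt p) := by
  classical
  have hp0 : 0 < p := (Fact.out : p.Prime).pos
  set s := Nat.sqrt p
  have hlow : ∑ b : Fin n → ZMod p, ∑ a : Fin n → ZMod p, ∑ t : ZMod p, weight d f (b + t • a) =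
      p ^ (n + 1) * ∑ a : Fin n → ZMod p, weight d f a := by
    rw [Finset.sum_comm]
    have h1 : ∀ a : Fin n → ZMod p, ∑ b : Fin n → ZMod p, ∑ t : ZMod p, weight d f (b + t • a) =
        p * ∑ a : Fin n → ZMod p, weight d f a := by
      intro a
      rw [Finset.sum_comm]
      have h2 : ∀ t : ZMod p, ∑ b : Fin n → ZMod p, weight d f (b + t • a) =
          ∑ a : Fin n → ZMod p, weight d f a := fun t =>
        Fintype.sum_equiv (Equiv.addRight (t • a)) _ _ fun b => rfl
      rw [Finset.sum_congr rfl fun t _ => h2 t, Finset.sum_const, Finset.card_univ, ZMod.card,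
        smul_eq_mul]
    rw [Finset.sum_congr rfl fun a _ => h1 a, Finset.sum_const, Finset.card_univ]
    simp only [Fintype.card_fun, ZMod.card, Fintype.card_fin, smul_eq_mul]
    ring
  set P := MvPolynomial.map (Int.castRingHom (ZMod p)) D with hP
  have haev : ∀ x : Fin n ⊕ Fin n → ZMod p, MvPolynomial.aeval (R := ℤ) x D =
      MvPolynomial.eval x P := by
    intro x
    rw [hP, MvPolynomial.eval_map]
    rfl
  have hfib : ∀ b a : Fin n → ZMod p, ∀ t : ZMod p,
      weight d f (b + t • a) = fiberWeight d ((monicSlice d b a f).map (evalRingHom t)) := by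
    intro b a t
    rw [monicSlice_map_eval, weight]
  have hslice : ∀ b a : Fin n → ZMod p, ∑ t : ZMod p, weight d f (b + t • a) ≤
      (p + 202 * d ^ 2 * s) + if MvPolynomial.eval (Sum.elim b a) P = 0 then d * p else 0 := by
    intro b a
    split_ifs with h
    · refine (Finset.sum_le_card_nsmul _ _ d fun t _ => weight_le hf hl _).trans ?_
      rw [Finset.card_univ, ZMod.card, smul_eq_mul, mul_comm]
      exact Nat.le_add_left _ _
    · rw [add_zero, Finset.sum_congr rfl fun t _ => hfib b a t]
      refine sum_fiberWeight_le (monicSlice_monic b a hf hl) (monicSlice_natDegree b a hf hl)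
        (biDegLE_monicSlice b a hf) (hcert b a ?_) hd0 hp
      rwa [haev]
  have hbad : ∑ b : Fin n → ZMod p, ∑ a : Fin n → ZMod p,
      (if MvPolynomial.eval (Sum.elim b a) P = 0 then 1 else 0) =
      (Finset.univ.filter fun x : Fin n ⊕ Fin n → ZMod p => MvPolynomial.eval x P = 0).card := by
    rw [Finset.card_filter, ← Fintype.sum_prod_type']
    exact Fintype.sum_equiv (Equiv.sumArrowEquivProdArrow _ _ _).symm _ _ fun x => rfl
  have hup : p ^ (n + 1) * ∑ a : Fin n → ZMod p, weight d f a ≤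
      p ^ (n + n) * (p + 202 * d ^ 2 * s) + d * (3 * d ^ 3 * p ^ (n + n)) := by
    rw [← hlow]
    calc _ ≤ ∑ b : Fin n → ZMod p, ∑ a : Fin n → ZMod p, ((p + 202 * d ^ 2 * s) +
          if MvPolynomial.eval (Sum.elim b a) P = 0 then d * p else 0) :=
          Finset.sum_le_sum fun b _ => Finset.sum_le_sum fun a _ => hslice b a
      _ = p ^ (n + n) * (p + 202 * d ^ 2 * s) + d * (p * ∑ b : Fin n → ZMod p,
          ∑ a : Fin n → ZMod p, (if MvPolynomial.eval (Sum.elim b a) P = 0 then 1 else 0)) := by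
        simp only [Finset.sum_add_distrib, Finset.sum_const, Finset.card_univ, Fintype.card_fun,
          ZMod.card, Fintype.card_fin, smul_eq_mul, Finset.mul_sum, mul_ite, mul_one, mul_zero]
        ring
      _ ≤ _ := by
        refine Nat.add_le_add_left (Nat.mul_le_mul_left _ ?_) _
        rw [hbad]
        refine (card_zeros_mul_le P hD).trans ?_
        rw [Fintype.card_sum, Fintype.card_fin]
        exact Nat.mul_le_mul_right _ ((totalDegree_map_le _ _).trans hDd)
  have h3 : d * (3 * d ^ 3 * p ^ (n + n)) ≤ p ^ (n + n) * (d ^ 2 * s) := by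
    calc d * (3 * d ^ 3 * p ^ (n + n)) = p ^ (n + n) * (d ^ 2 * (3 * d ^ 2)) := by ring
      _ ≤ _ := by gcongr; omega
  have h4 : p ^ n * (p * ∑ a : Fin n → ZMod p, weight d f a) ≤
      p ^ n * (p ^ n * (p + 203 * d ^ 2 * s)) := by
    calc _ = p ^ (n + 1) * ∑ a : Fin n → ZMod p, weight d f a := by ring
      _ ≤ _ := hup.trans (Nat.add_le_add_left h3 _)
      _ = _ := by ring
  exact Nat.le_of_mul_le_mul_left h4 (by positivity)

end Weight

section Newton

variable {n k d p : ℕ} [Fact p.Prime] {R : Type*} [CommRing R] {ϖ : R} {π : R →+* ZMod p}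

lemma isUnit_of_map_ne_zero (hϖ : ϖ ^ k = 0) (hker : ∀ r, π r = 0 → ϖ ∣ r)
    (hsurj : Function.Surjective π) {r : R} (hr : π r ≠ 0) : IsUnit r := by
  obtain ⟨s, hs⟩ := hsurj (π r)⁻¹
  obtain ⟨t, ht⟩ := hker (r * s - 1)
      (by rw [map_sub, map_mul, hs, mul_inv_cancel₀ hr, map_one, sub_self])
  have h1 : IsNilpotent (ϖ * t) := ⟨k, by rw [mul_pow, hϖ, zero_mul]⟩
  have h2 : r * s = ϖ * t + 1 := by linear_combination ht
  exact isUnit_of_mul_isUnit_left (h2 ▸ h1.isUnit_add_one)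

lemma eval_fib_eval (f : MvPolynomial (Fin (n + 1)) ℤ) (φ : MvPolynomial (Fin n) R)
    (Y : Fin n → R) : MvPolynomial.eval Y ((fib MvPolynomial.X f).eval φ) =
      (fib Y f).eval (MvPolynomial.eval Y φ) := by
  have h : (fib (MvPolynomial.X : Fin n → MvPolynomial (Fin n) R) f).map (MvPolynomial.eval Y) =
      fib Y f := by
    rw [fib_map]
    congr 1
    exact congrArg fib (funext fun i => by simp)
  rw [← h, eval_map_apply]

/-- Near a simple root, the first coordinate is a polynomial in the other ones. -/
lemma exists_newton {f : MvPolynomial (Fin (n + 1)) ℤ} (hker : ∀ r, π r = 0 → ϖ ∣ r) (c : R)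
    (a : Fin n → R) {u : R} (hu : π (u * (derivative (fib a f)).eval c) = 1) (m : ℕ) :
    ∃ φ : MvPolynomial (Fin n) R, ∀ (X : R) (Y : Fin n → R), π X = π c → π ∘ Y = π ∘ a →
      (fib Y f).eval X = 0 → ϖ ^ (m + 1) ∣ X - MvPolynomial.eval Y φ := by
  induction m with
  | zero =>
    refine ⟨MvPolynomial.C c, fun X Y hX _ _ => ?_⟩
    rw [MvPolynomial.eval_C, zero_add, pow_one]
    exact hker _ (by rw [map_sub, hX, sub_self])
  | succ m ih =>
    obtain ⟨φ, hφ⟩ := ih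
    refine ⟨φ - MvPolynomial.C u * (fib MvPolynomial.X f).eval φ, fun X Y hX hY h0 => ?_⟩
    obtain ⟨e, he⟩ := hφ X Y hX hY h0
    rw [map_sub, map_mul, MvPolynomial.eval_C, eval_fib_eval]
    set z := MvPolynomial.eval Y φ with hz
    obtain ⟨w, hw⟩ := binomExpansion (fib Y f) X (z - X)
    rw [h0, zero_add, add_sub_cancel] at hw
    have h1 : π (1 - u * (derivative (fib Y f)).eval X) = 0 := by
      have h2 : π ((derivative (fib Y f)).eval X) = π ((derivative (fib a f)).eval c) := by
        rw [← eval_map_apply, ← eval_map_apply, ← derivative_map, ← derivative_map, fib_map,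
          fib_map, hX, hY]
      rw [map_sub, map_mul, h2, ← map_mul, hu, map_one, sub_self]
    obtain ⟨v, hv⟩ := hker _ h1
    refine ⟨e * v + u * w * e ^ 2 * ϖ ^ m, ?_⟩
    rw [hw]
    have h3 : ϖ ^ (m + 1 + 1) = ϖ ^ (m + 1) * ϖ := pow_succ _ _
    have h4 : ϖ ^ (m + 1) = ϖ ^ m * ϖ := pow_succ _ _
    have h5 : z - X = -(ϖ ^ (m + 1) * e) := by rw [← he]; ring
    have h6 : X - (z - u * ((derivative (fib Y f)).eval X * (z - X) + w * (z - X) ^ 2)) =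
        (X - z) * (1 - u * (derivative (fib Y f)).eval X) + u * w * (z - X) ^ 2 := by ring
    rw [h6, hv, he, h5, h3, h4]
    ring

/-- On the points of `f = 0` above a residue class, every polynomial function is a combination
of `weight` many functions with coefficients polynomial in the base coordinates. -/
lemma exists_local_basis (hϖ : ϖ ^ k = 0) (hker : ∀ r, π r = 0 → ϖ ∣ r)
    (hsurj : Function.Surjective π) {f : MvPolynomial (Fin (n + 1)) ℤ} (hf : f.totalDegree ≤ d)
    (hl : (lead d f : ZMod p) ≠ 0) (a : Fin n → ZMod p) :
    ∃ u : R → (Fin n → R) → Fin (weight d f a) → R, ∀ g : MvPolynomial (Fin (n + 1)) ℤ,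
      ∃ q : Fin (weight d f a) → MvPolynomial (Fin n) R, ∀ (X : R) (Y : Fin n → R), π ∘ Y = a →
        (fib Y f).eval X = 0 → (fib Y g).eval X = ∑ c, u X Y c * MvPolynomial.eval Y (q c) := by
  classical
  have : Nontrivial R := π.domain_nontrivial
  have hk : k ≤ (k - 1) + 1 := by omega
  have hroot : ∀ x, (C ((lead d f : ZMod p)⁻¹) * fib a f).eval x = 0 ↔ (fib a f).eval x = 0 := by
    intro x
    rw [eval_mul, eval_C, mul_eq_zero, or_iff_right (inv_ne_zero hl)]
  have hroot' : ∀ x, (derivative (C ((lead d f : ZMod p)⁻¹) * fib a f)).eval x = 0 ↔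
      (derivative (fib a f)).eval x = 0 := by
    intro x
    rw [derivative_C_mul, eval_mul, eval_C, mul_eq_zero, or_iff_right (inv_ne_zero hl)]
  by_cases hbad : ∃ x, (fib a f).eval x = 0 ∧ (derivative (fib a f)).eval x = 0
  · have hw : weight d f a = d := by
      rw [weight, fiberWeight, if_pos]
      simpa only [hroot, hroot'] using hbad
    rw [hw]
    refine ⟨fun X Y c => X ^ (c : ℕ), fun g => ?_⟩
    have hu : IsUnit (lead d f : R) :=
      isUnit_of_map_ne_zero hϖ hker hsurj (by rwa [map_intCast])
    obtain ⟨v, hv⟩ := hu.exists_left_inv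
    set F : (MvPolynomial (Fin n) R)[X] := C (MvPolynomial.C v) * fib MvPolynomial.X f with hF
    have hFl : F.coeff d = 1 := by
      rw [hF, coeff_C_mul, fib_coeff _ hf,
        ← map_intCast (MvPolynomial.C : R →+* MvPolynomial (Fin n) R),
          ← MvPolynomial.C_mul,
        hv, MvPolynomial.C_1]
    have hFd : F.natDegree ≤ d := (natDegree_C_mul_le _ _).trans (fib_natDegree_le _ hf)
    have hFm : F.Monic := monic_of_natDegree_le_of_coeff_eq_one d hFd hFl
    have hFn : F.natDegree = d :=
      natDegree_eq_of_le_of_coeff_ne_zero hFd (by rw [hFl]; exact one_ne_zero)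
    set G : (MvPolynomial (Fin n) R)[X] := fib MvPolynomial.X g
    refine ⟨fun c => (G %ₘ F).coeff c, fun X Y hY h0 => ?_⟩
    have hev : ∀ h : MvPolynomial (Fin (n + 1)) ℤ,
        (fib (MvPolynomial.X : Fin n → MvPolynomial (Fin n) R) h).map (MvPolynomial.eval Y) =
          fib Y h := by
      intro h
      rw [fib_map]
      exact congrArg (fun b => fib b h) (funext fun i => by simp)
    have h1 : (fib Y g).eval X = ((G %ₘ F).map (MvPolynomial.eval Y)).eval X := by
      have h2 := congrArg (fun r => (r.map (MvPolynomial.eval Y)).eval X)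
        (modByMonic_add_div G F)
      simp only [Polynomial.map_add, Polynomial.map_mul, eval_add, eval_mul] at h2
      have h3 : (F.map (MvPolynomial.eval Y)).eval X = 0 := by
        rw [hF, Polynomial.map_mul, hev, eval_mul, h0, mul_zero]
      rw [h3, zero_mul, add_zero, hev] at h2
      exact h2.symm
    have h4 : ((G %ₘ F).map (MvPolynomial.eval Y)).natDegree < d ∨
        (G %ₘ F).map (MvPolynomial.eval Y) = 0 := by
      by_cases h5 : (G %ₘ F).map (MvPolynomial.eval Y) = 0
      · exact Or.inr h5
      · left
        rw [natDegree_lt_iff_degree_lt h5, ← hFn, ← degree_eq_natDegree hFm.ne_zero]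
        exact degree_map_le.trans_lt (degree_modByMonic_lt _ hFm)
    rw [h1]
    rcases h4 with h4 | h4
    · rw [eval_eq_sum_range' h4, ← Fin.sum_univ_eq_sum_range
        (fun c => ((G %ₘ F).map (MvPolynomial.eval Y)).coeff c * X ^ c)]
      exact Finset.sum_congr rfl fun c _ => by rw [coeff_map, mul_comm]
    · rw [h4, eval_zero]
      refine (Finset.sum_eq_zero fun c _ => ?_).symm
      rw [← coeff_map, h4, coeff_zero, mul_zero]
  · set Z := Finset.univ.filter fun x => (fib a f).eval x = 0 with hZ
    have hw : weight d f a = Z.card := by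
      rw [weight, fiberWeight, if_neg]
      · simp only [hroot, hZ]
      · simpa only [hroot, hroot'] using hbad
    rw [hw]
    choose lift hlift using hsurj
    set a' : Fin n → R := fun i => lift (a i) with ha'
    have ha : π ∘ a' = a := funext fun i => hlift _
    have hN : ∀ c : ZMod p, c ∈ Z → ∃ φ : MvPolynomial (Fin n) R, ∀ (X : R) (Y : Fin n → R),
        π X = c → π ∘ Y = a → (fib Y f).eval X = 0 → X = MvPolynomial.eval Y φ := by
      intro c hc
      have hc0 : (fib a f).eval c = 0 := by simpa [hZ] using hc
      have hder : (derivative (fib a f)).eval c ≠ 0 := fun h => hbad ⟨c, hc0, h⟩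
      have hu : π (lift (((derivative (fib a f)).eval c)⁻¹) *
          (derivative (fib a' f)).eval (lift c)) = 1 := by
        rw [map_mul, hlift, ← eval_map_apply, ← derivative_map, fib_map, ha, hlift,
          inv_mul_cancel₀ hder]
      obtain ⟨φ, hφ⟩ := exists_newton hker (lift c) a' hu (k - 1)
      refine ⟨φ, fun X Y hX hY h0 => ?_⟩
      have h1 := (pow_dvd_pow ϖ hk).trans (hφ X Y (by rw [hX, hlift]) (by rw [hY, ha]) h0)
      rw [hϖ, zero_dvd_iff, sub_eq_zero] at h1
      exact h1
    choose! φ hφ using hN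
    set e := Z.equivFin
    refine ⟨fun X Y c => if π X = (e.symm c : ZMod p) then 1 else 0, fun g => ?_⟩
    refine ⟨fun c => (fib MvPolynomial.X g).eval (φ (e.symm c)), fun X Y hY h0 => ?_⟩
    have hX : π X ∈ Z := by
      rw [hZ, Finset.mem_filter]
      refine ⟨Finset.mem_univ _, ?_⟩
      rw [← hY, ← fib_map, eval_map_apply, h0, map_zero]
    rw [Finset.sum_eq_single (e ⟨π X, hX⟩)]
    · beta_reduce
      rw [if_pos (by simp), one_mul, eval_fib_eval, Equiv.symm_apply_apply,
        ← hφ (π X) hX X Y rfl hY h0]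
    · intro c _ hc
      beta_reduce
      rw [if_neg, zero_mul]
      intro h
      apply hc
      rw [← e.apply_symm_apply c]
      exact congrArg e (Subtype.ext h.symm)
    · simp

end Newton

end AuxPoly

namespace AuxPoly

section Simplex

variable (σ : Type*) [Fintype σ] [DecidableEq σ]

/-- The exponent vectors of degree at most `M`. -/
def simplex (M : ℕ) : Finset (σ →₀ ℕ) :=
  (Finset.range (M + 1)).biUnion fun m => Finset.univ.finsuppAntidiag m

variable {σ}

lemma mem_simplex {M : ℕ} {α : σ →₀ ℕ} : α ∈ simplex σ M ↔ ∑ i, α i ≤ M := by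
  simp [simplex]

lemma mem_finsuppAntidiag_univ {M : ℕ} {α : σ →₀ ℕ} :
    α ∈ (Finset.univ : Finset σ).finsuppAntidiag M ↔ ∑ i, α i = M := by
  simp

lemma simplex_succ (M : ℕ) : simplex σ (M + 1) =
    simplex σ M ∪ Finset.univ.finsuppAntidiag (M + 1) := by
  ext α
  simp only [mem_simplex, Finset.mem_union, mem_finsuppAntidiag_univ]
  omega

lemma disjoint_simplex (M : ℕ) :
    Disjoint (simplex σ M) (Finset.univ.finsuppAntidiag (M + 1)) := by
  rw [Finset.disjoint_left]
  intro α h1 h2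
  rw [mem_simplex] at h1
  rw [mem_finsuppAntidiag_univ] at h2
  omega

variable (σ) in
lemma card_simplex (M : ℕ) :
    (simplex σ M).card = (M + Fintype.card σ).choose (Fintype.card σ) := by
  rw [← Nat.choose_symm_add]
  induction M with
  | zero => simp [simplex]
  | succ M ih =>
    rw [simplex_succ, Finset.card_union_of_disjoint (disjoint_simplex M), ih,
      Finset.card_finsuppAntidiag_nat_eq_choose, Finset.card_univ,
      show Fintype.card σ + (M + 1) - 1 = M + Fintype.card σ by omega,
      show M + 1 + Fintype.card σ = (M + Fintype.card σ) + 1 by omega, Nat.choose_succ_succ']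

variable (σ) in
lemma sum_simplex_sub (k : ℕ) : ∑ α ∈ simplex σ k, (k - ∑ i, α i) =
    (k + Fintype.card σ).choose (Fintype.card σ + 1) := by
  induction k with
  | zero => simp [simplex]
  | succ k ih =>
    rw [simplex_succ, Finset.sum_union (disjoint_simplex k)]
    have h1 : ∑ α ∈ (Finset.univ : Finset σ).finsuppAntidiag (k + 1), (k + 1 - ∑ i, α i) = 0 := by
      refine Finset.sum_eq_zero fun α hα => ?_
      rw [mem_finsuppAntidiag_univ] at hα
      omega
    have h2 : ∑ α ∈ simplex σ k, (k + 1 - ∑ i, α i) =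
        ∑ α ∈ simplex σ k, ((k - ∑ i, α i) + 1) := by
      refine Finset.sum_congr rfl fun α hα => ?_
      rw [mem_simplex] at hα
      omega
    rw [h1, h2, Finset.sum_add_distrib, ih, Finset.sum_const, card_simplex, smul_eq_mul, mul_one,
      add_zero, show k + 1 + Fintype.card σ = (k + Fintype.card σ) + 1 by omega,
      Nat.choose_succ_succ', add_comm]

end Simplex

section Count

/-- A set of combinations of vectors killed by powers of `p` is small. -/
lemma natCard_le_of_forall_eq_sum {ι J : Type*} [Fintype J] {p k : ℕ} [NeZero (p ^ k)] (hp : 0 < p)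
    (w : J → ι → ZMod (p ^ k)) (m : J → ℕ) (hw : ∀ j i, (p : ZMod (p ^ k)) ^ m j * w j i = 0)
    (H : Set (ι → ZMod (p ^ k))) (hH : ∀ h ∈ H, ∃ c : J → ZMod (p ^ k),
        ∀ i, h i = ∑ j, c j * w j i) :
    Nat.card H ≤ p ^ ∑ j, m j := by
  classical
  set F : (∀ j, Fin (p ^ m j)) → ι → ZMod (p ^ k) :=
    fun v i => ∑ j, ((v j : ℕ) : ZMod (p ^ k)) * w j i with hF
  have hsub : H ⊆ Set.range F := by
    intro h hh
    obtain ⟨c, hc⟩ := hH h hh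
    refine ⟨fun j => ⟨(c j).val % p ^ m j, Nat.mod_lt _ (pow_pos hp _)⟩, funext fun i => ?_⟩
    rw [hc, hF]
    refine Finset.sum_congr rfl fun j _ => ?_
    have h1 : c j = (((c j).val % p ^ m j : ℕ) : ZMod (p ^ k)) +
        (p : ZMod (p ^ k)) ^ m j * (((c j).val / p ^ m j : ℕ) : ZMod (p ^ k)) := by
      conv_lhs => rw [← ZMod.natCast_zmod_val (c j), ← Nat.mod_add_div (c j).val (p ^ m j)]
      push_cast
      ring
    dsimp only
    conv_rhs => rw [h1]
    linear_combination -(((c j).val / p ^ m j : ℕ) : ZMod (p ^ k)) * hw j i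
  calc Nat.card H ≤ Nat.card (Set.range F) :=
        Nat.card_mono (Set.finite_range F) hsub
    _ ≤ Nat.card (∀ j, Fin (p ^ m j)) := Finite.card_range_le F
    _ = p ^ ∑ j, m j := by
        rw [Nat.card_eq_fintype_card, Fintype.card_pi]
        simp [Finset.prod_pow_eq_pow_sum]

/-- Taylor expansion, truncated thanks to nilpotence of the increments. -/
lemma exists_eval_eq_sum_simplex {n k : ℕ} {R : Type*} [CommRing R] {ϖ : R} (hϖ : ϖ ^ k = 0)
    (q : MvPolynomial (Fin n) R) (a : Fin n → R) : ∃ c : (Fin n →₀ ℕ) → R, ∀ Y : Fin n → R,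
      (∀ i, ϖ ∣ Y i - a i) → MvPolynomial.eval Y q =
        ∑ α ∈ simplex (Fin n) k, c α * ∏ i, (Y i - a i) ^ α i := by
  classical
  set q' : MvPolynomial (Fin n) R :=
    MvPolynomial.bind₁ (fun i => MvPolynomial.X i + MvPolynomial.C (a i)) q with hq'
  refine ⟨fun α => q'.coeff α, fun Y hY => ?_⟩
  have h1 : MvPolynomial.eval Y q = MvPolynomial.eval (fun i => Y i - a i) q' := by
    rw [hq', ← MvPolynomial.coe_aeval_eq_eval, ← MvPolynomial.coe_aeval_eq_eval]
    simp only [RingHom.coe_coe]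
    rw [MvPolynomial.aeval_bind₁]
    congr 2
    simp
  have h0 : ∀ α : Fin n →₀ ℕ, α ∉ simplex (Fin n) k → ∏ i, (Y i - a i) ^ α i = 0 := by
    intro α hα
    rw [mem_simplex, not_le] at hα
    have : ϖ ^ (∑ i, α i) ∣ ∏ i, (Y i - a i) ^ α i := by
      rw [← Finset.prod_pow_eq_pow_sum]
      exact Finset.prod_dvd_prod_of_dvd _ _ fun i _ => pow_dvd_pow_of_dvd (hY i) _
    rwa [pow_eq_zero_of_le hα.le hϖ, zero_dvd_iff] at this
  rw [h1, MvPolynomial.eval_eq', Finset.sum_subset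
      (Finset.subset_union_left (s₁ := q'.support) (s₂ := simplex (Fin n) k)),
    ← Finset.sum_subset (Finset.subset_union_right (s₁ := q'.support) (s₂ := simplex (Fin n) k))]
  · intro α _ hα
    rw [h0 α hα, mul_zero]
  · intro α _ hα
    rw [MvPolynomial.notMem_support_iff.1 hα, zero_mul]

variable {n d p k : ℕ} [Fact p.Prime]

lemma natCard_reduction_le {f : MvPolynomial (Fin (n + 1)) ℤ} (hf : f.totalDegree ≤ d)
    (hl : (lead d f : ZMod p) ≠ 0) (hk : k ≠ 0) {ι : Type*}
    (P : ι → Fin (n + 1) → ℤ) (hP : ∀ i, MvPolynomial.eval (P i) f = 0)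
    (H : Set (ι → ZMod (p ^ k))) (hH : ∀ h ∈ H, ∃ g : MvPolynomial (Fin (n + 1)) ℤ,
      ∀ i, h i = ((MvPolynomial.eval (P i) g : ℤ) : ZMod (p ^ k))) :
    Nat.card H ≤ p ^ ((∑ a : Fin n → ZMod p, weight d f a) * (k + n).choose (n + 1)) := by
  classical
  have hp : p.Prime := Fact.out
  have : NeZero (p ^ k) := ⟨pow_ne_zero _ hp.ne_zero⟩
  set π : ZMod (p ^ k) →+* ZMod p := ZMod.castHom (dvd_pow_self p hk) (ZMod p) with hπ
  have hϖ : (p : ZMod (p ^ k)) ^ k = 0 := by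
    rw [← Nat.cast_pow]
    exact ZMod.natCast_self _
  have hker : ∀ r, π r = 0 → (p : ZMod (p ^ k)) ∣ r := by
    intro r hr
    rw [← ZMod.natCast_zmod_val r, map_natCast, ZMod.natCast_eq_zero_iff] at hr
    rw [← ZMod.natCast_zmod_val r]
    exact Nat.cast_dvd_cast hr
  have hsurj : Function.Surjective π := ZMod.castHom_surjective _
  choose u hu using exists_local_basis hϖ hker hsurj hf hl
  choose lift hlift using hsurj
  set X : ι → ZMod (p ^ k) := fun i => ((P i 0 : ℤ) : ZMod (p ^ k))
  set Y : ι → Fin n → ZMod (p ^ k) := fun i l => ((P i l.succ : ℤ) : ZMod (p ^ k))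
  have hev : ∀ (g : MvPolynomial (Fin (n + 1)) ℤ) i,
      ((MvPolynomial.eval (P i) g : ℤ) : ZMod (p ^ k)) = (fib (Y i) g).eval (X i) := by
    intro g i
    rw [fib_eval]
    have : (Fin.cons (X i) (Y i) : Fin (n + 1) → ZMod (p ^ k)) =
        fun l => ((P i l : ℤ) : ZMod (p ^ k)) := by
      funext l
      refine Fin.cases ?_ (fun l => ?_) l <;> simp [X, Y]
    rw [this, MvPolynomial.aeval_def, ← MvPolynomial.coe_eval₂Hom]
    have h2 : (MvPolynomial.eval₂Hom (algebraMap ℤ (ZMod (p ^ k)))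
        fun l => ((P i l : ℤ) : ZMod (p ^ k))) =
        (Int.castRingHom (ZMod (p ^ k))).comp (MvPolynomial.eval (P i)) := by
      refine MvPolynomial.ringHom_ext (by simp) (by simp)
    rw [h2]
    rfl
  have h0 : ∀ i, (fib (Y i) f).eval (X i) = 0 := fun i => by rw [← hev, hP, Int.cast_zero]
  let J := (Σ a : Fin n → ZMod p, Fin (weight d f a)) × simplex (Fin n) k
  let w : J → ι → ZMod (p ^ k) := fun j i => if π ∘ Y i = j.1.1 then
    u j.1.1 (X i) (Y i) j.1.2 * ∏ l, (Y i l - lift (j.1.1 l)) ^ (j.2 : Fin n →₀ ℕ) l else 0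
  let m : J → ℕ := fun j => k - ∑ l, (j.2 : Fin n →₀ ℕ) l
  have hdvd : ∀ i a, π ∘ Y i = a → ∀ l, (p : ZMod (p ^ k)) ∣ Y i l - lift (a l) := by
    intro i a h l
    apply hker
    rw [map_sub, hlift, ← h, Function.comp_apply, sub_self]
  have hw : ∀ j i, (p : ZMod (p ^ k)) ^ m j * w j i = 0 := by
    rintro ⟨⟨a, c⟩, α, hα⟩ i
    rw [mem_simplex] at hα
    simp only [w, m]
    split_ifs with h
    · have h1 : (p : ZMod (p ^ k)) ^ (∑ l, α l) ∣ ∏ l, (Y i l - lift (a l)) ^ α l := by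
        rw [← Finset.prod_pow_eq_pow_sum]
        exact Finset.prod_dvd_prod_of_dvd _ _ fun l _ => pow_dvd_pow_of_dvd (hdvd i a h l) _
      have h2 := (mul_dvd_mul_left ((p : ZMod (p ^ k)) ^ (k - ∑ l, α l)) h1).trans
          (dvd_mul_left _ (u a (X i) (Y i) c))
      rw [← pow_add, Nat.sub_add_cancel hα, hϖ, zero_dvd_iff] at h2
      rw [← h2]
      ring
    · rw [mul_zero]
  refine (natCard_le_of_forall_eq_sum hp.pos w m hw H ?_).trans_eq ?_
  · intro h hh
    obtain ⟨g, hg⟩ := hH h hh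
    choose q hq using fun a => hu a g
    choose c hc using fun (a : Fin n → ZMod p) (e : Fin (weight d f a)) =>
      exists_eval_eq_sum_simplex hϖ (q a e) fun l => lift (a l)
    refine ⟨fun j => c j.1.1 j.1.2 j.2, fun i => ?_⟩
    rw [hg, hev, hq (π ∘ Y i) _ _ rfl (h0 i), Fintype.sum_prod_type, Fintype.sum_sigma,
      Fintype.sum_eq_single (π ∘ Y i)]
    · refine Finset.sum_congr rfl fun e _ => ?_
      rw [hc _ e _ (hdvd i _ rfl), Finset.mul_sum, ← Finset.sum_coe_sort]
      refine Finset.sum_congr rfl fun α _ => ?_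
      simp only [w, if_true]
      ring
    · intro a ha
      refine Finset.sum_eq_zero fun e _ => Finset.sum_eq_zero fun α _ => ?_
      simp only [w]
      rw [if_neg (Ne.symm ha), mul_zero]
  · congr 1
    rw [Fintype.sum_prod_type]
    simp only [m]
    rw [Finset.sum_const, Finset.card_univ, Fintype.card_sigma, smul_eq_mul]
    simp only [Fintype.card_fin]
    rw [Finset.sum_coe_sort (simplex (Fin n) k) fun α => k - ∑ l, α l, sum_simplex_sub,
      Fintype.card_fin]

end Count

section Lattice

lemma index_range_mulVecLin {ι : Type*} [Fintype ι] [DecidableEq ι] (A : Matrix ι ι ℤ)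
    (hA : A.det ≠ 0) : (LinearMap.range A.mulVecLin).toAddSubgroup.index = A.det.natAbs := by
  have hinj : Function.Injective A.mulVecLin := by
    rw [← LinearMap.ker_eq_bot, LinearMap.ker_eq_bot']
    exact fun v hv => Matrix.eq_zero_of_mulVec_eq_zero hA hv
  have key := AddSubgroup.index_eq_natAbs_det (Pi.basisFun ℤ ι)
    (LinearMap.range A.mulVecLin).toAddSubgroup
    ((Pi.basisFun ℤ ι).map (LinearEquiv.ofInjective A.mulVecLin hinj))
  rw [key, Module.Basis.det_apply]
  congr 2
  ext i j
  rw [Module.Basis.toMatrix_apply, Pi.basisFun_repr, Module.Basis.map_apply,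
    LinearEquiv.ofInjective_apply, Pi.basisFun_apply, Matrix.mulVecLin_apply,
    Matrix.mulVec_single_one, Matrix.col_apply]

lemma det_eq_prod_of_injective {ι L : Type*} [Fintype ι] [DecidableEq ι] [LinearOrder L]
    {b : ι → L} (hb : Function.Injective b) (A : Matrix ι ι ℤ) (h : ∀ i j, b i < b j → A i j = 0) :
    A.det = ∏ i, A i i := by
  let : LinearOrder ι := LinearOrder.lift' b hb
  convert Matrix.det_of_isLowerTriangular A fun i j hij => h i j hij

lemma pow_dvd_index {ι : Type*} [Fintype ι] {p k E : ℕ} (hp : p.Prime) (Λ : AddSubgroup (ι → ℤ))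
    (hΛ : ∀ H : Set (ι → ZMod (p ^ k)), (∀ h ∈ H, ∃ v ∈ Λ, ∀ i, h i = (v i : ZMod (p ^ k))) →
      Nat.card H ≤ p ^ E) : p ^ (k * Fintype.card ι - E) ∣ Λ.index := by
  have : NeZero (p ^ k) := ⟨pow_ne_zero _ hp.ne_zero⟩
  let red : (ι → ℤ) →+ (ι → ZMod (p ^ k)) := (Int.castAddHom (ZMod (p ^ k))).compLeft ι
  have hred : Function.Surjective red :=
    fun v => ⟨fun i => (v i).cast, funext fun i => by simp [red]⟩
  refine dvd_trans ?_ (Λ.index_map_dvd hred)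
  have h1 := (Λ.map red).card_mul_index
  rw [Nat.card_pi, Finset.prod_const, Nat.card_zmod, Finset.card_univ, ← pow_mul] at h1
  have h2 : Nat.card (Λ.map red) ≤ p ^ E := by
    refine hΛ (Λ.map red) ?_
    rintro _ ⟨v, hv, rfl⟩
    exact ⟨v, hv, fun i => rfl⟩
  obtain ⟨e, he, hce⟩ := (Nat.dvd_prime_pow hp).1 (Dvd.intro _ h1)
  rw [hce] at h1 h2
  have h3 : e ≤ E := (Nat.pow_le_pow_iff_right hp.one_lt).1 h2
  have h4 : p ^ e * (Λ.map red).index = p ^ e * p ^ (k * Fintype.card ι - e) := by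
    rw [h1, ← pow_add, Nat.add_sub_cancel' he]
  rw [Nat.eq_of_mul_eq_mul_left (pow_pos hp.pos e) h4]
  exact pow_dvd_pow _ (by omega)

end Lattice

section PowDvdIndex

variable {n d M : ℕ} {f : MvPolynomial (Fin (n + 1)) ℤ}

lemma mem_simplex_of_mem_support {g : MvPolynomial (Fin n) ℤ} (hg : g.totalDegree ≤ M)
    {α : Fin n →₀ ℕ} (hα : α ∈ g.support) : α ∈ simplex (Fin n) M := by
  rw [mem_simplex]
  have := MvPolynomial.le_totalDegree hα
  rw [Finsupp.sum_fintype _ _ fun _ => rfl] at this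
  omega

lemma totalDegree_le_iff_support {g : MvPolynomial (Fin n) ℤ} :
    g.totalDegree ≤ M ↔ g.support ⊆ simplex (Fin n) M := by
  refine ⟨fun h α hα => mem_simplex_of_mem_support h hα, fun h => ?_⟩
  refine Finset.sup_le fun α hα => ?_
  rw [Finsupp.sum_fintype _ _ fun _ => rfl]
  exact mem_simplex.1 (h hα)

/-- The matrix of multiplication by `f` followed by truncation. -/
noncomputable def mulMatrix (f : MvPolynomial (Fin n) ℤ) (N : ℕ) :
    Matrix (simplex (Fin n) N) (simplex (Fin n) N) ℤ :=
  fun α β => MvPolynomial.coeff α.1 (f * MvPolynomial.monomial β.1 1)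

lemma det_mulMatrix (f : MvPolynomial (Fin n) ℤ) (N : ℕ) :
    (mulMatrix f N).det = (MvPolynomial.constantCoeff f) ^ (simplex (Fin n) N).card := by
  have h2 : ∀ α, mulMatrix f N α α = MvPolynomial.constantCoeff f := by
    intro α
    rw [mulMatrix, MvPolynomial.coeff_mul_monomial', if_pos le_rfl, tsub_self, mul_one,
      MvPolynomial.constantCoeff_eq]
  rw [det_eq_prod_of_injective (b := fun α : simplex (Fin n) N => toLex α.1)
    (fun α β h => Subtype.ext (toLex.injective h))]
  · simp only [h2, Finset.prod_const, Finset.card_univ, Fintype.card_coe]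
  · intro α β h1
    rw [mulMatrix, MvPolynomial.coeff_mul_monomial', if_neg]
    intro h2
    exact absurd (Finsupp.toLex_monotone h2) (not_le.2 h1)

lemma mulMatrix_mulVec {f u : MvPolynomial (Fin n) ℤ} {N : ℕ} (hu : u.totalDegree ≤ N)
    (α : simplex (Fin n) N) :
    (mulMatrix f N).mulVec (fun β => u.coeff β.1) α = (f * u).coeff α.1 := by
  conv_rhs => rw [u.as_sum, Finset.mul_sum, MvPolynomial.coeff_sum,
    Finset.sum_subset (totalDegree_le_iff_support.1 hu) (fun β _ hβ => by
      rw [MvPolynomial.notMem_support_iff.1 hβ]; simp)]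
  rw [Matrix.mulVec, dotProduct,
    ← Finset.sum_coe_sort (simplex (Fin n) N)]
  refine Finset.sum_congr rfl fun β _ => ?_
  have : (MvPolynomial.monomial β.1 (u.coeff β.1) : MvPolynomial (Fin n) ℤ) =
      MvPolynomial.C (u.coeff β.1) * MvPolynomial.monomial β.1 1 := by
    rw [MvPolynomial.C_mul_monomial, mul_one]
  rw [this, mul_left_comm, MvPolynomial.coeff_C_mul, mulMatrix, mul_comm]

end PowDvdIndex

section Coeffs

variable {n : ℕ} {A : Finset (Fin n →₀ ℕ)}

/-- The polynomial with prescribed coefficients on a finite set of exponents. -/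
noncomputable def ofCoeffs (A : Finset (Fin n →₀ ℕ)) (v : A → ℤ) : MvPolynomial (Fin n) ℤ :=
  ∑ β : A, MvPolynomial.monomial β.1 (v β)

lemma coeff_ofCoeffs (v : A → ℤ) (α : A) : (ofCoeffs A v).coeff α.1 = v α := by
  rw [ofCoeffs, MvPolynomial.coeff_sum, Fintype.sum_eq_single α]
  · simp
  · intro β hβ
    rw [MvPolynomial.coeff_monomial, if_neg fun h => hβ (Subtype.ext h)]

lemma coeff_ofCoeffs_of_notMem (v : A → ℤ) {α : Fin n →₀ ℕ} (hα : α ∉ A) :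
    (ofCoeffs A v).coeff α = 0 := by
  rw [ofCoeffs, MvPolynomial.coeff_sum]
  refine Finset.sum_eq_zero fun β _ => ?_
  rw [MvPolynomial.coeff_monomial, if_neg fun h : β.1 = α => hα (h ▸ β.2)]

lemma totalDegree_ofCoeffs_le {M : ℕ} (hA : A ⊆ simplex (Fin n) M) (v : A → ℤ) :
    (ofCoeffs A v).totalDegree ≤ M := by
  rw [totalDegree_le_iff_support]
  intro α hα
  by_contra h
  exact MvPolynomial.mem_support_iff.1 hα (coeff_ofCoeffs_of_notMem v fun h' => h (hA h'))

lemma ofCoeffs_coeff {g : MvPolynomial (Fin n) ℤ} (hg : ∀ α, α ∉ A → g.coeff α = 0) :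
    ofCoeffs A (fun α => g.coeff α.1) = g := by
  ext α
  by_cases h : α ∈ A
  · exact coeff_ofCoeffs _ ⟨α, h⟩
  · rw [coeff_ofCoeffs_of_notMem _ h, hg α h]

/-- The matrix of values of the monomials in `A` at the points `P`. -/
noncomputable def evalMatrix {ι : Type*} (P : ι → Fin n → ℤ) (A : Finset (Fin n →₀ ℕ)) :
    Matrix ι A ℤ :=
  fun i α => MvPolynomial.eval (P i) (MvPolynomial.monomial α.1 1)

lemma evalMatrix_mulVec {ι : Type*} (P : ι → Fin n → ℤ) (v : A → ℤ) (i : ι) :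
    (evalMatrix P A).mulVec v i = MvPolynomial.eval (P i) (ofCoeffs A v) := by
  rw [ofCoeffs, map_sum, Matrix.mulVec, dotProduct]
  refine Finset.sum_congr rfl fun α _ => ?_
  rw [evalMatrix, MvPolynomial.eval_monomial, MvPolynomial.eval_monomial, one_mul, mul_comm]

end Coeffs

section Index

variable {n d M : ℕ} {f : MvPolynomial (Fin n) ℤ}

/-- The evaluation of polynomials of degree at most `M` at the points `P`. -/
noncomputable def evalHom {ι : Type*} (M : ℕ) (P : ι → Fin n → ℤ) :
    MvPolynomial.restrictTotalDegree (Fin n) ℤ M →+ (ι → ℤ) where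
  toFun g i := MvPolynomial.eval (P i) g.1
  map_zero' := by ext; simp
  map_add' := by intros; ext; simp

/-- The coefficients of degree at most `N` of a polynomial. -/
noncomputable def coeffHom (M N : ℕ) :
    MvPolynomial.restrictTotalDegree (Fin n) ℤ M →+ (simplex (Fin n) N → ℤ) where
  toFun g α := g.1.coeff α.1
  map_zero' := by ext; simp
  map_add' := by intros; ext; simp

lemma simplex_mono {M N : ℕ} (h : M ≤ N) : simplex (Fin n) M ⊆ simplex (Fin n) N := by
  intro α hα
  rw [mem_simplex] at hα ⊢
  omega

lemma coeffHom_surjective {N : ℕ} (h : N ≤ M) : Function.Surjective (coeffHom (n := n) M N) := by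
  intro v
  refine ⟨⟨ofCoeffs _ v, ?_⟩, funext fun α => coeff_ofCoeffs v α⟩
  rw [MvPolynomial.mem_restrictTotalDegree]
  exact totalDegree_ofCoeffs_le (simplex_mono h) v

/-- The exponents of degree in `(M - d, M]`. -/
def shell (n d M : ℕ) : Finset (Fin n →₀ ℕ) := simplex (Fin n) M \ simplex (Fin n) (M - d)

lemma shell_subset : shell n d M ⊆ simplex (Fin n) M := Finset.sdiff_subset

lemma not_dvd_C (hf : f.totalDegree = d) (hd : 0 < d) {c : ℤ} (hc : c ≠ 0) :
    ¬ f ∣ MvPolynomial.C c := by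
  rintro ⟨u, hu⟩
  have h1 : f * u ≠ 0 := by
    rw [← hu]
    simpa using hc
  have := MvPolynomial.totalDegree_mul_of_isDomain (left_ne_zero_of_mul h1)
      (right_ne_zero_of_mul h1)
  rw [← hu, MvPolynomial.totalDegree_C] at this
  omega

lemma totalDegree_le_sub_of_mul (hf : f.totalDegree = d) {u : MvPolynomial (Fin n) ℤ}
    (hu : (f * u).totalDegree ≤ M) (hf0 : f ≠ 0) : u.totalDegree ≤ M - d := by
  by_cases h : u = 0
  · simp [h]
  · rw [MvPolynomial.totalDegree_mul_of_isDomain hf0 h] at hu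
    omega

/-- A polynomial of degree at most `M` vanishing at sufficiently many points of `f = 0` is a
multiple of `f`. -/
lemma dvd_of_eval_eq_zero (hf : f.totalDegree = d) (hd : 0 < d) (hp : Prime f)
    (hc : MvPolynomial.constantCoeff f ≠ 0) (hM : d ≤ M) {P : shell n d M → Fin n → ℤ}
    (hP : ∀ i, MvPolynomial.eval (P i) f = 0) (hΔ : (evalMatrix P (shell n d M)).det ≠ 0)
    {g : MvPolynomial (Fin n) ℤ} (hg : g.totalDegree ≤ M)
    (h0 : ∀ i, MvPolynomial.eval (P i) g = 0) : f ∣ g := by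
  set T := mulMatrix f (M - d) with hT
  have hdet : T.det ≠ 0 := by
    rw [hT, det_mulMatrix]
    exact pow_ne_zero _ hc
  set u := ofCoeffs _ (T.adjugate.mulVec fun α => g.coeff α.1) with hu
  have hud : u.totalDegree ≤ M - d := totalDegree_ofCoeffs_le subset_rfl _
  set r := MvPolynomial.C T.det * g - f * u with hr
  have hr1 : r.totalDegree ≤ M := by
    refine (MvPolynomial.totalDegree_sub _ _).trans (max_le ?_ ?_)
    · refine (MvPolynomial.totalDegree_mul _ _).trans ?_
      rw [MvPolynomial.totalDegree_C]
      omega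
    · refine (MvPolynomial.totalDegree_mul _ _).trans ?_
      omega
  have hr2 : ∀ α, α ∉ shell n d M → r.coeff α = 0 := by
    intro α hα
    by_cases h1 : α ∈ simplex (Fin n) (M - d)
    · have h2 := mulMatrix_mulVec (f := f) hud ⟨α, h1⟩
      have h3 : (fun β : simplex (Fin n) (M - d) => u.coeff β.1) =
          T.adjugate.mulVec fun α => g.coeff α.1 := funext fun β => coeff_ofCoeffs _ β
      rw [h3, Matrix.mulVec_mulVec, Matrix.mul_adjugate, Matrix.smul_mulVec, Matrix.one_mulVec,
        Pi.smul_apply, smul_eq_mul] at h2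
      rw [hr, MvPolynomial.coeff_sub, MvPolynomial.coeff_C_mul, ← h2, sub_self]
    · have h2 : α ∉ simplex (Fin n) M := fun h => hα (Finset.mem_sdiff.2 ⟨h, h1⟩)
      by_contra h3
      exact h2 (totalDegree_le_iff_support.1 hr1 (MvPolynomial.mem_support_iff.2 h3))
  have hr3 : (fun α : shell n d M => r.coeff α.1) = 0 := by
    refine Matrix.eq_zero_of_mulVec_eq_zero hΔ (funext fun i => ?_)
    rw [evalMatrix_mulVec, ofCoeffs_coeff hr2, hr]
    simp [h0, hP]
  have hr4 : r = 0 := by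
    rw [← ofCoeffs_coeff hr2, hr3]
    simp [ofCoeffs]
  have h5 : f ∣ MvPolynomial.C T.det * g := ⟨u, sub_eq_zero.1 hr4⟩
  exact (hp.dvd_or_dvd h5).resolve_left (not_dvd_C hf hd hdet)

lemma pow_mul_index_dvd_det (hf : f.totalDegree = d) (hd : 0 < d) (hp : Prime f)
    (hc : MvPolynomial.constantCoeff f ≠ 0) (hM : d ≤ M) {P : shell n d M → Fin n → ℤ}
    (hP : ∀ i, MvPolynomial.eval (P i) f = 0) (hΔ : (evalMatrix P (shell n d M)).det ≠ 0) :
    (MvPolynomial.constantCoeff f).natAbs ^ (simplex (Fin n) (M - d)).card *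
      (evalHom M P).range.index ∣ (evalMatrix P (shell n d M)).det.natAbs := by
  set T := mulMatrix f (M - d) with hT
  have hdet : T.det = (MvPolynomial.constantCoeff f) ^ (simplex (Fin n) (M - d)).card :=
    det_mulMatrix _ _
  have hdet0 : T.det ≠ 0 := hdet ▸ pow_ne_zero _ hc
  set Λ := (LinearMap.range (evalMatrix P (shell n d M)).mulVecLin).toAddSubgroup with hΛ
  have h1 : Λ ≤ (evalHom M P).range := by
    rintro _ ⟨v, rfl⟩
    refine ⟨⟨ofCoeffs _ v, ?_⟩, funext fun i => (evalMatrix_mulVec P v i).symm⟩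
    rw [MvPolynomial.mem_restrictTotalDegree]
    exact totalDegree_ofCoeffs_le shell_subset v
  have h2 : Λ.comap (evalHom M P) ≤
      (LinearMap.range T.mulVecLin).toAddSubgroup.comap (coeffHom M (M - d)) := by
    rintro ⟨g, hg⟩ ⟨v, hv⟩
    rw [MvPolynomial.mem_restrictTotalDegree] at hg
    have hgv : f ∣ g - ofCoeffs _ v := by
      refine dvd_of_eval_eq_zero hf hd hp hc hM hP hΔ ((MvPolynomial.totalDegree_sub _ _).trans
        (max_le hg (totalDegree_ofCoeffs_le shell_subset v))) fun i => ?_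
      rw [map_sub, ← evalMatrix_mulVec, sub_eq_zero]
      exact (congrFun hv i).symm
    obtain ⟨u, hu⟩ := hgv
    have hud : u.totalDegree ≤ M - d := by
      refine totalDegree_le_sub_of_mul hf ?_ hp.ne_zero
      rw [← hu]
      exact (MvPolynomial.totalDegree_sub _ _).trans
        (max_le hg (totalDegree_ofCoeffs_le shell_subset v))
    refine ⟨fun β => u.coeff β.1, funext fun α => ?_⟩
    refine (mulMatrix_mulVec hud α).trans ?_
    rw [← hu, MvPolynomial.coeff_sub, coeff_ofCoeffs_of_notMem, sub_zero]
    · rfl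
    · intro h
      exact (Finset.mem_sdiff.1 h).2 α.2
  have h3 := AddSubgroup.index_dvd_of_le h2
  rw [AddSubgroup.index_comap_of_surjective _ (coeffHom_surjective (Nat.sub_le _ _)),
    index_range_mulVecLin _ hdet0, AddSubgroup.index_comap, hdet, Int.natAbs_pow] at h3
  rw [← index_range_mulVecLin _ hΔ, ← AddSubgroup.relIndex_mul_index h1]
  exact mul_dvd_mul_right h3 _

end Index

section Determinant

variable {n d M : ℕ}

lemma exists_points {f : MvPolynomial (Fin n) ℤ} (hf : f.totalDegree = d)
    (hf0 : f ≠ 0) (hc : MvPolynomial.constantCoeff f ≠ 0)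
    {S : Set (Fin n → ℤ)} (hS : ∀ g : MvPolynomial (Fin n) ℤ, g.totalDegree ≤ M →
      (∀ x ∈ S, MvPolynomial.eval x g = 0) → f ∣ g) :
    ∃ P : shell n d M → Fin n → ℤ, (∀ i, P i ∈ S) ∧ (evalMatrix P (shell n d M)).det ≠ 0 := by
  classical
  let A : Matrix S (shell n d M) ℤ := evalMatrix (fun x : S => x.1) (shell n d M)
  obtain ⟨r, -, hr⟩ := exists_det_submatrix_ne_zero (A.map (Int.castRingHom ℚ)) (by
    intro v hv
    obtain ⟨b, hb⟩ := IsLocalization.exist_integer_multiples_of_finite (nonZeroDivisors ℤ) v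
    choose w hw using hb
    have hb0 : ((b : ℤ) : ℚ) ≠ 0 := by
      have := nonZeroDivisors.coe_ne_zero b
      exact_mod_cast this
    have hw' : ∀ i, (w i : ℚ) = (b : ℤ) * v i := fun i => by
      have := hw i
      rw [zsmul_eq_mul] at this
      exact this
    set g := ofCoeffs _ w with hg
    have hgd : g.totalDegree ≤ M := totalDegree_ofCoeffs_le shell_subset w
    obtain ⟨u, hu⟩ := hS g hgd (by
      intro x hx
      have h1 := congrFun hv ⟨x, hx⟩
      rw [hg, ← evalMatrix_mulVec (fun x : S => x.1) w ⟨x, hx⟩]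
      have h2 : (((evalMatrix (fun x : S => x.1) (shell n d M)).mulVec w ⟨x, hx⟩ : ℤ) : ℚ) =
          (b : ℤ) * ((A.map (Int.castRingHom ℚ)).mulVec v ⟨x, hx⟩) := by
        simp only [Matrix.mulVec, dotProduct, Int.cast_sum, Int.cast_mul, hw', Finset.mul_sum]
        refine Finset.sum_congr rfl fun i _ => ?_
        rw [Matrix.map_apply]
        change _ = _ * (((A _ i : ℤ) : ℚ) * _)
        ring
      rw [h1, Pi.zero_apply, mul_zero] at h2
      exact_mod_cast h2)
    have hud : u.totalDegree ≤ M - d := totalDegree_le_sub_of_mul hf (hu ▸ hgd) hf0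
    have h3 : (fun β : simplex (Fin n) (M - d) => u.coeff β.1) = 0 := by
      refine Matrix.eq_zero_of_mulVec_eq_zero (M := mulMatrix f (M - d)) ?_ (funext fun α => ?_)
      · rw [det_mulMatrix]
        exact pow_ne_zero _ hc
      · rw [mulMatrix_mulVec hud, ← hu, hg, coeff_ofCoeffs_of_notMem _ fun h : α.1 ∈ shell n d M =>
          (Finset.mem_sdiff.1 h).2 α.2]
        rfl
    have h4 : u = 0 := by
      rw [← ofCoeffs_coeff (A := simplex (Fin n) (M - d)) (g := u), h3]
      · simp [ofCoeffs]
      · intro α hα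
        by_contra h
        exact hα (totalDegree_le_iff_support.1 hud (MvPolynomial.mem_support_iff.2 h))
    funext i
    have h5 : w i = 0 := by
      rw [← coeff_ofCoeffs w i, ← hg, hu, h4, mul_zero, MvPolynomial.coeff_zero]
    have h6 := hw' i
    rw [h5, Int.cast_zero, eq_comm, mul_eq_zero] at h6
    exact h6.resolve_left hb0)
  refine ⟨fun i => (r i).1, fun i => (r i).2, fun h => hr ?_⟩
  have h1 : (A.map (Int.castRingHom ℚ)).submatrix r id =
      (Int.castRingHom ℚ).mapMatrix (evalMatrix (fun i => (r i).1) (shell n d M)) := rfl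
  rw [h1, ← RingHom.map_det, h, map_zero]

lemma natAbs_det_evalMatrix_le {P : shell n d M → Fin n → ℤ} {B : ℕ} (hB : 1 ≤ B)
    (hP : ∀ i l, (P i l).natAbs ≤ B) :
    (evalMatrix P (shell n d M)).det.natAbs ≤
      (shell n d M).card.factorial * (B ^ M) ^ (shell n d M).card := by
  have h := Matrix.det_le (A := evalMatrix P (shell n d M)) (abv := AbsoluteValue.abs)
    (x := ((B ^ M : ℕ) : ℤ)) (by
      intro i α
      have h1 : ((evalMatrix P (shell n d M) i α).natAbs : ℤ) ≤ ((B ^ M : ℕ) : ℤ) := by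
        rw [Nat.cast_le, evalMatrix, MvPolynomial.eval_monomial, one_mul,
          Finsupp.prod_fintype _ _ fun _ => pow_zero _]
        calc (∏ l, P i l ^ α.1 l).natAbs = ∏ l, (P i l).natAbs ^ α.1 l := by
              rw [← Int.natAbsHom_apply, map_prod]
              simp [Int.natAbsHom_apply, Int.natAbs_pow]
          _ ≤ ∏ l, B ^ α.1 l := Finset.prod_le_prod' fun l _ => Nat.pow_le_pow_left (hP i l) _
          _ = B ^ ∑ l, α.1 l := Finset.prod_pow_eq_pow_sum _ _ _
          _ ≤ B ^ M := Nat.pow_le_pow_right hB (mem_simplex.1 (shell_subset α.2))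
      rwa [Int.natCast_natAbs] at h1)
  rw [Fintype.card_coe] at h
  change |(evalMatrix P (shell n d M)).det| ≤ _ at h
  rw [← Int.natCast_natAbs, nsmul_eq_mul] at h
  exact_mod_cast h

/-- The determinant method: an upper bound for the product of the prime powers dividing the
determinant of the monomials of degree in `(M - d, M]` at integral points of `f = 0`. -/
lemma determinant_inequality {f : MvPolynomial (Fin (n + 1)) ℤ} (hf : f.totalDegree = d)
    (hd : 0 < d) (hp : Prime f) (hc : MvPolynomial.constantCoeff f ≠ 0) (hM : d ≤ M)
    {B : ℕ} (hB : 1 ≤ B)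
    (hS : ∀ g : MvPolynomial (Fin (n + 1)) ℤ, g.totalDegree ≤ M →
      (∀ x : Fin (n + 1) → ℤ, MvPolynomial.eval x f = 0 → (∀ i, (x i).natAbs ≤ B) →
        MvPolynomial.eval x g = 0) → f ∣ g)
    (A : Finset ℕ) (k W : ℕ → ℕ) (hk : ∀ p ∈ A, k p ≠ 0)
    (hA : ∀ p ∈ A, ∃ _ : Fact p.Prime, (lead d f : ZMod p) ≠ 0 ∧
      ∑ a : Fin n → ZMod p, weight d f a ≤ W p) :
    (MvPolynomial.constantCoeff f).natAbs ^ (simplex (Fin (n + 1)) (M - d)).card *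
      ∏ p ∈ A, p ^ (k p * (shell (n + 1) d M).card - W p * (k p + n).choose (n + 1)) ≤
      (shell (n + 1) d M).card.factorial * (B ^ M) ^ (shell (n + 1) d M).card := by
  obtain ⟨P, hP, hΔ⟩ := exists_points
    (S := {x | MvPolynomial.eval x f = 0 ∧ ∀ i, (x i).natAbs ≤ B}) hf hp.ne_zero hc
    fun g hg h => hS g hg fun x h1 h2 => h x ⟨h1, h2⟩
  refine le_trans (Nat.le_of_dvd ?_ ?_) (natAbs_det_evalMatrix_le hB fun i l => (hP i).2 l)
  · exact Int.natAbs_pos.2 hΔ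
  refine dvd_trans (mul_dvd_mul_left _ ?_)
    (pow_mul_index_dvd_det hf hd hp hc hM (fun i => (hP i).1) hΔ)
  refine Finset.prod_dvd_of_isRelPrime ?_ ?_
  · intro p hpA q hqA hpq
    obtain ⟨hp', -⟩ := hA p hpA
    obtain ⟨hq', -⟩ := hA q hqA
    exact Nat.coprime_iff_isRelPrime.1
      (Nat.Coprime.pow _ _ ((Nat.coprime_primes hp'.out hq'.out).2 hpq))
  · intro p hpA
    obtain ⟨hp', hl, hW⟩ := hA p hpA
    have h1 := pow_dvd_index (k := k p) (E := W p * (k p + n).choose (n + 1)) hp'.out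
      (evalHom M P).range (by
        intro H hH
        refine (natCard_reduction_le hf.le hl (hk p hpA) P (fun i => (hP i).1) H ?_).trans
          (Nat.pow_le_pow_right hp'.out.pos (Nat.mul_le_mul_right _ hW))
        intro h hh
        obtain ⟨_, ⟨g, rfl⟩, hv⟩ := hH h hh
        exact ⟨g.1, hv⟩)
    rwa [Fintype.card_coe] at h1

end Determinant

section Reduction

variable {n d : ℕ}

lemma exists_int_polynomial {h : MvPolynomial (Fin n) ℂ} (hh : h ≠ 0) :
    ∃ g : MvPolynomial (Fin n) ℤ, g ≠ 0 ∧ g.totalDegree ≤ h.totalDegree ∧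
      ∀ x : Fin n → ℤ, MvPolynomial.eval (fun i => (x i : ℂ)) h = 0 →
          MvPolynomial.eval x g = 0 := by
  classical
  obtain ⟨α₀, hα₀⟩ := MvPolynomial.exists_coeff_ne_zero hh
  obtain ⟨ψ, hψ⟩ : ∃ ψ : Module.Dual ℚ ℂ, ψ (h.coeff α₀) ≠ 0 := by
    by_contra! hcon
    exact hα₀ ((Module.forall_dual_apply_eq_zero_iff ℚ _).1 hcon)
  obtain ⟨b, hb⟩ := IsLocalization.exist_integer_multiples_of_finite (nonZeroDivisors ℤ)
    fun α : h.support => ψ (h.coeff α.1)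
  choose w hw using hb
  have hb0 : ((b : ℤ) : ℚ) ≠ 0 := by
    have := nonZeroDivisors.coe_ne_zero b
    exact_mod_cast this
  have hw' : ∀ α : h.support, (w α : ℚ) = (b : ℤ) * ψ (h.coeff α.1) := fun α => by
    have := hw α
    rw [zsmul_eq_mul] at this
    exact this
  refine ⟨ofCoeffs h.support w, ?_, ?_, ?_⟩
  · intro h0
    have hmem : α₀ ∈ h.support := MvPolynomial.mem_support_iff.2 hα₀
    have h1 := coeff_ofCoeffs w ⟨α₀, hmem⟩
    rw [h0, MvPolynomial.coeff_zero] at h1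
    have h2 := hw' ⟨α₀, hmem⟩
    rw [← h1, Int.cast_zero, eq_comm, mul_eq_zero] at h2
    exact h2.elim hb0 hψ
  · refine Finset.sup_le fun α hα => MvPolynomial.le_totalDegree ?_
    by_contra h'
    exact MvPolynomial.mem_support_iff.1 hα (coeff_ofCoeffs_of_notMem w h')
  · intro x hx
    have h1 : ((MvPolynomial.eval x (ofCoeffs h.support w) : ℤ) : ℚ) =
        (b : ℤ) * ψ (MvPolynomial.eval (fun i => (x i : ℂ)) h) := by
      rw [ofCoeffs, map_sum, Int.cast_sum, MvPolynomial.eval_eq', map_sum ψ, Finset.mul_sum,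
        ← Finset.sum_coe_sort h.support]
      refine Finset.sum_congr rfl fun α _ => ?_
      have h2 : h.coeff α.1 * ∏ i, (x i : ℂ) ^ α.1 i =
          (∏ i, x i ^ α.1 i : ℤ) • h.coeff α.1 := by
        rw [zsmul_eq_mul, mul_comm]
        push_cast
        rfl
      rw [h2, map_zsmul, MvPolynomial.eval_monomial, Finsupp.prod_fintype _ _ fun _ => pow_zero _,
        Int.cast_mul, hw', zsmul_eq_mul]
      ring
    rw [hx, map_zero, mul_zero] at h1
    exact_mod_cast h1

lemma totalDegree_map_of_injective {R : Type*} [CommRing R] {φ : ℤ →+* R}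
    (hφ : Function.Injective φ) (f : MvPolynomial (Fin n) ℤ) :
    (MvPolynomial.map φ f).totalDegree = f.totalDegree := by
  rw [MvPolynomial.totalDegree, MvPolynomial.totalDegree,
    MvPolynomial.support_map_of_injective _ hφ]

lemma totalDegree_pos_of_not_isUnit {K : Type*} [Field K] {h : MvPolynomial (Fin n) K} (h0 : h ≠ 0)
    (hu : ¬ IsUnit h) : 0 < h.totalDegree := by
  by_contra hd
  rw [not_lt, nonpos_iff_eq_zero, MvPolynomial.totalDegree_eq_zero_iff_eq_C] at hd
  apply hu
  rw [hd]
  refine IsUnit.map MvPolynomial.C (isUnit_iff_ne_zero.2 fun h1 => h0 ?_)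
  rw [hd, h1, map_zero]

lemma prime_of_primitive {f : MvPolynomial (Fin n) ℤ}
    (hf : ∀ k : ℤ, (∀ m, k ∣ MvPolynomial.coeff m f) → IsUnit k)
    (hirr : Irreducible (MvPolynomial.map (Int.castRingHom ℚ) f)) : Prime f := by
  have hφ : Function.Injective (Int.castRingHom ℚ) := Int.cast_injective
  have key : ∀ a b : MvPolynomial (Fin n) ℤ, f = a * b →
      IsUnit (MvPolynomial.map (Int.castRingHom ℚ) a) → IsUnit a := by
    intro a b hab ha
    have h1 : a.totalDegree = 0 := by
      rw [← totalDegree_map_of_injective hφ]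
      exact (MvPolynomial.isUnit_iff_totalDegree_of_isReduced.1 ha).2
    rw [MvPolynomial.totalDegree_eq_zero_iff_eq_C] at h1
    rw [h1]
    refine IsUnit.map MvPolynomial.C (hf _ fun m => ?_)
    rw [hab, h1, MvPolynomial.coeff_C_mul, MvPolynomial.coeff_C, if_pos rfl]
    exact dvd_mul_right _ _
  refine Irreducible.prime ⟨fun hu => hirr.not_isUnit (hu.map _), fun a b hab => ?_⟩
  rcases hirr.isUnit_or_isUnit (by rw [hab, map_mul]) with h | h
  · exact Or.inl (key a b hab h)
  · exact Or.inr (key b a (hab.trans (mul_comm _ _)) h)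

lemma not_dvd_of_totalDegree_lt {f g : MvPolynomial (Fin n) ℤ} (hg : g ≠ 0)
    (h : g.totalDegree < f.totalDegree) : ¬ f ∣ g := by
  rintro ⟨u, rfl⟩
  rw [MvPolynomial.totalDegree_mul_of_isDomain (left_ne_zero_of_mul hg)
    (right_ne_zero_of_mul hg)] at h
  omega

/-- The integral zeros of a polynomial reducible over `ℂ` lie on a second hypersurface. -/
lemma exists_of_not_irreducible {f : MvPolynomial (Fin n) ℤ} (hd : 0 < f.totalDegree)
    (hp : Prime f) (hirr : ¬ Irreducible (MvPolynomial.map (Int.castRingHom ℂ) f)) :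
    ∃ g : MvPolynomial (Fin n) ℤ, g ≠ 0 ∧ ¬ f ∣ g ∧ g.totalDegree ≤ f.totalDegree ∧
      ∀ x, MvPolynomial.eval x f = 0 → MvPolynomial.eval x g = 0 := by
  have hφ : Function.Injective (Int.castRingHom ℂ) := Int.cast_injective
  set F := MvPolynomial.map (Int.castRingHom ℂ) f with hF
  have hFd : F.totalDegree = f.totalDegree := totalDegree_map_of_injective hφ f
  have hF0 : F ≠ 0 := by
    intro h
    rw [h, MvPolynomial.totalDegree_zero] at hFd
    omega
  have hFu : ¬ IsUnit F := by
    intro h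
    have := (MvPolynomial.isUnit_iff_totalDegree_of_isReduced.1 h).2
    omega
  rw [irreducible_iff, not_and] at hirr
  have h1 := hirr hFu
  push Not at h1
  obtain ⟨h, q, hhq, hu, qu⟩ := h1
  have hh0 : h ≠ 0 := left_ne_zero_of_mul (hhq ▸ hF0)
  have hq0 : q ≠ 0 := right_ne_zero_of_mul (hhq ▸ hF0)
  have hsum : f.totalDegree = h.totalDegree + q.totalDegree := by
    rw [← hFd, hhq, MvPolynomial.totalDegree_mul_of_isDomain hh0 hq0]
  have hhd := totalDegree_pos_of_not_isUnit hh0 hu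
  have hqd := totalDegree_pos_of_not_isUnit hq0 qu
  obtain ⟨g₁, hg₁, hd₁, hz₁⟩ := exists_int_polynomial hh0
  obtain ⟨g₂, hg₂, hd₂, hz₂⟩ := exists_int_polynomial hq0
  refine ⟨g₁ * g₂, mul_ne_zero hg₁ hg₂, fun hdvd => ?_, ?_, fun x hx => ?_⟩
  · rcases hp.dvd_or_dvd hdvd with h' | h'
    · exact not_dvd_of_totalDegree_lt hg₁ (by omega) h'
    · exact not_dvd_of_totalDegree_lt hg₂ (by omega) h'
  · refine (MvPolynomial.totalDegree_mul _ _).trans ?_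
    omega
  · have h2 : MvPolynomial.eval (fun i => (x i : ℂ)) F = 0 := by
      have : MvPolynomial.eval ((Int.castRingHom ℂ) ∘ x) F =
          (Int.castRingHom ℂ) (MvPolynomial.eval x f) := by
        rw [hF, MvPolynomial.eval_map, MvPolynomial.eval₂_comp]
      rw [hx, map_zero] at this
      exact this
    rw [hhq, map_mul, mul_eq_zero] at h2
    rw [map_mul, mul_eq_zero]
    exact h2.imp (hz₁ x) (hz₂ x)

end Reduction

section Affine

variable {n d : ℕ} {R S : Type*} [CommRing R] [CommRing S]

/-- The affine change of variables `X i ↦ X i + b i * X 0 + t i`. -/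
noncomputable def affine (b t : Fin (n + 1) → R) :
    MvPolynomial (Fin (n + 1)) R →ₐ[R] MvPolynomial (Fin (n + 1)) R :=
  MvPolynomial.aeval fun i =>
    MvPolynomial.X i + MvPolynomial.C (b i) * MvPolynomial.X 0 + MvPolynomial.C (t i)

lemma affine_X (b t : Fin (n + 1) → R) (i : Fin (n + 1)) : affine b t (MvPolynomial.X i) =
    MvPolynomial.X i + MvPolynomial.C (b i) * MvPolynomial.X 0 + MvPolynomial.C (t i) := by
  simp [affine]

lemma affine_C (b t : Fin (n + 1) → R) (r : R) :
    affine b t (MvPolynomial.C r) = MvPolynomial.C r :=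
  (affine b t).commutes r

lemma affine_comp (b t b' t' : Fin (n + 1) → R) (hb' : b' 0 = 0)
    (hb : b + b' = 0) (ht : ∀ i, t i + t' i + b i * t' 0 = 0) :
    (affine b' t').comp (affine b t) = AlgHom.id R _ := by
  refine MvPolynomial.algHom_ext fun i => ?_
  have h1 : (MvPolynomial.C (b i) : MvPolynomial (Fin (n + 1)) R) + MvPolynomial.C (b' i) = 0 := by
    rw [← map_add, ← Pi.add_apply, hb, Pi.zero_apply, map_zero]
  have h2 : (MvPolynomial.C (t i) : MvPolynomial (Fin (n + 1)) R) + MvPolynomial.C (t' i) +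
      MvPolynomial.C (b i) * MvPolynomial.C (t' 0) = 0 := by
    rw [← map_add, ← map_mul, ← map_add, ht, map_zero]
  rw [AlgHom.comp_apply, affine_X, map_add, map_add, map_mul, affine_C, affine_C, affine_X,
    affine_X, hb', map_zero, AlgHom.id_apply]
  linear_combination MvPolynomial.X 0 * h1 + h2

/-- The inverse of an affine change of variables. -/
noncomputable def affineEquiv (b t : Fin (n + 1) → R) (hb : b 0 = 0) :
    MvPolynomial (Fin (n + 1)) R ≃ₐ[R] MvPolynomial (Fin (n + 1)) R :=
  AlgEquiv.ofAlgHom (affine b t) (affine (-b) (fun i => -t i + b i * t 0))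
    (affine_comp _ _ _ _ hb (by simp) (by simp))
    (affine_comp _ _ _ _ (by simp [hb]) (by simp) (by simp [hb]))

lemma affineEquiv_apply (b t : Fin (n + 1) → R) (hb : b 0 = 0) (f : MvPolynomial (Fin (n + 1)) R) :
    affineEquiv b t hb f = affine b t f := rfl

lemma affineEquiv_symm_apply (b t : Fin (n + 1) → R) (hb : b 0 = 0)
    (f : MvPolynomial (Fin (n + 1)) R) :
    (affineEquiv b t hb).symm f = affine (-b) (fun i => -t i + b i * t 0) f := rfl

lemma totalDegree_affine_le (b t : Fin (n + 1) → R) (f : MvPolynomial (Fin (n + 1)) R) :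
    (affine b t f).totalDegree ≤ f.totalDegree := by
  rw [affine, MvPolynomial.aeval_def, MvPolynomial.eval₂_eq']
  refine MvPolynomial.totalDegree_finsetSum_le fun m hm => ?_
  refine (MvPolynomial.totalDegree_mul _ _).trans ?_
  rw [MvPolynomial.algebraMap_eq, MvPolynomial.totalDegree_C, zero_add]
  refine (MvPolynomial.totalDegree_finsetProd _ _).trans
    (le_trans (Finset.sum_le_sum fun i _ => ?_) (sum_le_totalDegree hm))
  refine (MvPolynomial.totalDegree_pow _ _).trans ?_
  conv_rhs => rw [← mul_one (m i)]
  refine Nat.mul_le_mul_left _ ?_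
  have hX : ∀ j, (MvPolynomial.X j : MvPolynomial (Fin (n + 1)) R).totalDegree ≤ 1 := fun j => by
    refine (MvPolynomial.totalDegree_monomial_le _ _).trans ?_
    simp
  refine (MvPolynomial.totalDegree_add _ _).trans (max_le ((MvPolynomial.totalDegree_add _ _).trans
    (max_le (hX i) ((MvPolynomial.totalDegree_mul _ _).trans ?_))) (by simp))
  rw [MvPolynomial.totalDegree_C, zero_add]
  exact hX 0

lemma totalDegree_affine (b t : Fin (n + 1) → R) (hb : b 0 = 0)
    (f : MvPolynomial (Fin (n + 1)) R) : (affine b t f).totalDegree = f.totalDegree := by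
  refine le_antisymm (totalDegree_affine_le _ _ _) ?_
  have := totalDegree_affine_le (-b) (fun i => -t i + b i * t 0) (affine b t f)
  rwa [← affineEquiv_apply _ _ hb, ← affineEquiv_symm_apply _ _ hb,
    AlgEquiv.symm_apply_apply] at this

lemma eval_affine (b t x : Fin (n + 1) → R) (f : MvPolynomial (Fin (n + 1)) R) :
    MvPolynomial.eval x (affine b t f) = MvPolynomial.eval (fun i => x i + b i * x 0 + t i) f := by
  have : (MvPolynomial.eval x).comp (affine b t : MvPolynomial (Fin (n + 1)) R →+* _) =
      MvPolynomial.eval (fun i => x i + b i * x 0 + t i) :=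
    MvPolynomial.ringHom_ext (by simp) fun i => by simp [affine_X]
  rw [← this]
  rfl

lemma map_affine (φ : R →+* S) (b t : Fin (n + 1) → R) (f : MvPolynomial (Fin (n + 1)) R) :
    MvPolynomial.map φ (affine b t f) = affine (φ ∘ b) (φ ∘ t) (MvPolynomial.map φ f) := by
  have : (MvPolynomial.map φ).comp (affine b t : MvPolynomial (Fin (n + 1)) R →+* _) =
      (affine (φ ∘ b) (φ ∘ t) : MvPolynomial (Fin (n + 1)) S →+*
        MvPolynomial (Fin (n + 1)) S).comp (MvPolynomial.map φ) :=
    MvPolynomial.ringHom_ext (by simp) fun i => by simp [affine_X]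
  exact congrArg (fun ψ => ψ f) this

lemma prime_affine {b t : Fin (n + 1) → R} (hb : b 0 = 0) {f : MvPolynomial (Fin (n + 1)) R}
    (hf : Prime f) : Prime (affine b t f) :=
  (MulEquiv.prime_iff (affineEquiv b t hb)).2 hf

lemma irreducible_map_affine (φ : R →+* S) {b t : Fin (n + 1) → R} (hb : b 0 = 0)
    {f : MvPolynomial (Fin (n + 1)) R} (hf : Irreducible (MvPolynomial.map φ f)) :
    Irreducible (MvPolynomial.map φ (affine b t f)) := by
  rw [map_affine]
  exact (MulEquiv.irreducible_iff (affineEquiv (φ ∘ b) (φ ∘ t) (by simp [hb]))).2 hf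

lemma coeff_prod_sum {ι : Type*} (s : Finset ι) (q : ι → Polynomial R) (m : ι → ℕ)
    (h : ∀ i ∈ s, (q i).natDegree ≤ m i) :
    (∏ i ∈ s, q i).coeff (∑ i ∈ s, m i) = ∏ i ∈ s, (q i).coeff (m i) ∧
      (∏ i ∈ s, q i).natDegree ≤ ∑ i ∈ s, m i := by
  classical
  induction s using Finset.induction_on with
  | empty => simp
  | insert a s ha ih =>
    obtain ⟨h1, h2⟩ := ih fun i hi => h i (Finset.mem_insert_of_mem hi)
    have h3 := h a (Finset.mem_insert_self _ _)
    rw [Finset.prod_insert ha, Finset.sum_insert ha, Finset.prod_insert ha,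
      Polynomial.coeff_mul_add_eq_of_natDegree_le h3 h2, h1]
    exact ⟨rfl, Polynomial.natDegree_mul_le.trans (Nat.add_le_add h3 h2)⟩

lemma lead_affine {f : MvPolynomial (Fin (n + 1)) ℤ} (hf : f.totalDegree ≤ d)
    (b t : Fin (n + 1) → ℤ) : lead d (affine b t f) =
      ∑ m ∈ f.support with ∑ i, m i = d, f.coeff m * ∏ i,
          ((if i = 0 then 1 else 0) + b i) ^ m i := by
  have h0 := fib_coeff (R := ℤ) (0 : Fin n → ℤ) ((totalDegree_affine_le b t f).trans hf)
  rw [Int.cast_id] at h0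
  have h1 : fib (0 : Fin n → ℤ) (affine b t f) = MvPolynomial.aeval (R := ℤ)
      (fun i => Polynomial.C ((if i = 0 then 1 else 0) + b i) * Polynomial.X +
          Polynomial.C (t i)) f := by
    have : (fib (0 : Fin n → ℤ)).comp (affine b t : MvPolynomial (Fin (n + 1)) ℤ →+* _) =
        (MvPolynomial.aeval (R := ℤ)
            (fun i => Polynomial.C ((if i = 0 then 1 else 0) + b i) * Polynomial.X +
          Polynomial.C (t i)) : MvPolynomial (Fin (n + 1)) ℤ →+* Polynomial ℤ) := by
      refine MvPolynomial.ringHom_ext (by simp) fun i => ?_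
      refine Fin.cases ?_ (fun i => ?_) i
      · simp [fib_apply, affine_X, add_mul]
      · simp [fib_apply, affine_X]
    exact congrArg (fun ψ => ψ f) this
  rw [← h0, h1, MvPolynomial.aeval_def, MvPolynomial.eval₂_eq', Polynomial.finsetSum_coeff,
    Finset.sum_filter]
  refine Finset.sum_congr rfl fun m hm => ?_
  rw [Polynomial.algebraMap_eq, Polynomial.coeff_C_mul]
  have hdeg : ∀ i ∈ Finset.univ, ((Polynomial.C ((if i = 0 then 1 else 0) + b i) * Polynomial.X +
      Polynomial.C (t i)) ^ m i).natDegree ≤ m i := fun i _ => by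
    refine Polynomial.natDegree_pow_le.trans ?_
    conv_rhs => rw [← mul_one (m i)]
    exact Nat.mul_le_mul_left _ Polynomial.natDegree_linear_le
  obtain ⟨h2, h3⟩ := coeff_prod_sum _ _ _ hdeg
  split_ifs with h
  · rw [h] at h2
    rw [h2]
    congr 1
    refine Finset.prod_congr rfl fun i _ => ?_
    have := Polynomial.coeff_pow_of_natDegree_le (m := m i) (n := 1) (Polynomial.natDegree_linear_le
      (a := (if i = 0 then 1 else 0) + b i) (b := t i))
    rw [mul_one] at this
    rw [this, Polynomial.coeff_add, Polynomial.coeff_C_mul, Polynomial.coeff_X_one, mul_one,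
      Polynomial.coeff_C_succ, add_zero]
  · rw [Polynomial.coeff_eq_zero_of_natDegree_lt, mul_zero]
    exact h3.trans_lt (lt_of_le_of_ne ((sum_le_totalDegree hm).trans hf) h)

lemma exists_lead_affine_ne_zero {f : MvPolynomial (Fin (n + 1)) ℤ} (hf : f.totalDegree = d)
    (hf0 : f ≠ 0) : ∃ b : Fin (n + 1) → ℤ, b 0 = 0 ∧ (∀ i, 0 ≤ b i ∧ b i ≤ d) ∧
      lead d (affine b 0 f) ≠ 0 := by
  classical
  let P : MvPolynomial (Fin n) ℤ :=
    ∑ m ∈ f.support with ∑ i, m i = d, MvPolynomial.monomial (Finsupp.tail m) (f.coeff m)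
  have htail : ∀ m : Fin (n + 1) →₀ ℕ, ∑ i, m i = m 0 + ∑ i, Finsupp.tail m i := fun m =>
    Fin.sum_univ_succ _
  have hP0 : P ≠ 0 := by
    obtain ⟨m₀, hm₀, hm₀'⟩ := Finset.exists_mem_eq_sup f.support
      (MvPolynomial.support_nonempty.2 hf0) fun m => m.sum fun _ e => e
    rw [← MvPolynomial.totalDegree] at hm₀'
    intro h0
    have h1 := congrArg (MvPolynomial.coeff (Finsupp.tail m₀)) h0
    rw [MvPolynomial.coeff_zero, MvPolynomial.coeff_sum] at h1
    have hs : ∑ i, m₀ i = d := by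
      rw [← hf, hm₀', Finsupp.sum_fintype _ _ (by simp)]
    rw [Finset.sum_eq_single m₀] at h1
    · rw [MvPolynomial.coeff_monomial, if_pos rfl] at h1
      exact MvPolynomial.mem_support_iff.1 hm₀ h1
    · intro m hm hne
      rw [MvPolynomial.coeff_monomial, if_neg]
      intro he
      apply hne
      have h2 := (Finset.mem_filter.1 hm).2
      rw [htail, he] at h2
      rw [htail] at hs
      rw [← Finsupp.cons_tail m, ← Finsupp.cons_tail m₀, he]
      congr 1
      omega
    · intro hm
      exact absurd (Finset.mem_filter.2 ⟨hm₀, hs⟩) hm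
  have hPd : P.totalDegree ≤ d := by
    refine MvPolynomial.totalDegree_finsetSum_le fun m hm => ?_
    refine (MvPolynomial.totalDegree_monomial_le _ _).trans ?_
    have h2 := (Finset.mem_filter.1 hm).2
    rw [htail] at h2
    rw [Finsupp.sum_fintype _ _ (by simp)]
    simp only [id]
    omega
  by_contra! hcon
  refine hP0 (MvPolynomial.eq_zero_of_eval_zero_at_prod_finset P
    (fun _ => (Finset.range (d + 1)).image ((↑) : ℕ → ℤ)) (fun i => ?_) fun a ha => ?_)
  · rw [Finset.card_image_of_injective _ Nat.cast_injective, Finset.card_range]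
    exact Nat.lt_succ_of_le ((MvPolynomial.degreeOf_le_totalDegree _ _).trans hPd)
  · have h1 := hcon (Fin.cons 0 a) rfl fun i => by
      refine Fin.cases ?_ (fun i => ?_) i
      · simp
      · obtain ⟨c, hc, hc'⟩ := Finset.mem_image.1 (ha i)
        rw [Fin.cons_succ, ← hc']
        rw [Finset.mem_range] at hc
        exact ⟨by positivity, by exact_mod_cast Nat.le_of_lt_succ hc⟩
    rw [lead_affine hf.le] at h1
    rw [← h1, map_sum]
    refine Finset.sum_congr rfl fun m _ => ?_
    rw [MvPolynomial.eval_monomial, Finsupp.prod_fintype _ _ (by simp), Fin.prod_univ_succ]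
    simp [Finsupp.tail, Fin.tail]

end Affine

section Interpolation

variable {m n d : ℕ}

lemma exists_lagrange (d : ℕ) : ∃ (Δ : ℤ) (ℓ : ℕ → Polynomial ℤ), Δ ≠ 0 ∧
    (∀ j ≤ d, ∀ k ≤ d, (ℓ j).eval (k : ℤ) = if j = k then Δ else 0) ∧
    ∀ j ≤ d, ∃ c : ℤ, c.natAbs ≤ Δ.natAbs ∧
      ℓ j = Polynomial.C c * ∏ k ∈ (Finset.range (d + 1)).erase j,
        (Polynomial.X - Polynomial.C (k : ℤ)) := by
  let w : ℕ → ℤ := fun j => ∏ k ∈ (Finset.range (d + 1)).erase j, ((j : ℤ) - k)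
  have hw : ∀ j, w j ≠ 0 := fun j => Finset.prod_ne_zero_iff.2 fun k hk =>
    sub_ne_zero.2 (by exact_mod_cast (Finset.ne_of_mem_erase hk).symm)
  let c : ℕ → ℤ := fun j => ∏ k ∈ (Finset.range (d + 1)).erase j, w k
  have hcw : ∀ j ≤ d, w j * c j = ∏ k ∈ Finset.range (d + 1), w k := fun j hj =>
    Finset.mul_prod_erase _ _ (Finset.mem_range.2 (Nat.lt_succ_of_le hj))
  refine ⟨∏ k ∈ Finset.range (d + 1), w k, fun j => Polynomial.C (c j) *
    ∏ k ∈ (Finset.range (d + 1)).erase j, (Polynomial.X - Polynomial.C (k : ℤ)),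
    Finset.prod_ne_zero_iff.2 fun k _ => hw k, fun j hj k hk => ?_, fun j hj => ⟨c j, ?_, rfl⟩⟩
  · rw [Polynomial.eval_mul, Polynomial.eval_C, Polynomial.eval_prod]
    simp only [Polynomial.eval_sub, Polynomial.eval_X, Polynomial.eval_C]
    split_ifs with h
    · subst h
      rw [← hcw j hj, mul_comm]
    · rw [Finset.prod_eq_zero (i := k), mul_zero]
      · exact Finset.mem_erase.2 ⟨fun h' => h h'.symm, Finset.mem_range.2 (Nat.lt_succ_of_le hk)⟩
      · exact sub_self _
  · rw [← hcw j hj, Int.natAbs_mul]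
    exact Nat.le_mul_of_pos_left _ (Int.natAbs_pos.2 (hw j))

lemma degreeOf_X_sub_C_le (i k : Fin m) (c : ℤ) :
    (MvPolynomial.X i - MvPolynomial.C c : MvPolynomial (Fin m) ℤ).degreeOf k ≤
      if i = k then 1 else 0 := by
  rw [sub_eq_add_neg, ← map_neg]
  refine (MvPolynomial.degreeOf_add_le _ _ _).trans (max_le ?_ ?_)
  · rw [MvPolynomial.degreeOf_X]
    split_ifs with h1 h2 h2 <;> simp_all
  · rw [MvPolynomial.degreeOf_C]
    exact Nat.zero_le _

lemma l1_le_of_natAbs_eval_le {F : MvPolynomial (Fin m) ℤ} (hF : F.totalDegree ≤ d) {V : ℕ}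
    (hV : ∀ j : Fin m → Fin (d + 1),
      (MvPolynomial.eval (fun i => ((j i : ℕ) : ℤ)) F).natAbs ≤ V) :
    l1 F ≤ (d + 1) ^ ((d + 1) * m) * V := by
  classical
  obtain ⟨Δ, ℓ, hΔ, hℓ, hℓc⟩ := exists_lagrange d
  let L : Fin m → ℕ → MvPolynomial (Fin m) ℤ := fun i j => Polynomial.aeval (MvPolynomial.X i) (ℓ j)
  have hL : ∀ i, ∀ j ≤ d, ∃ c : ℤ, c.natAbs ≤ Δ.natAbs ∧ L i j = MvPolynomial.C c *
      ∏ k ∈ (Finset.range (d + 1)).erase j, (MvPolynomial.X i - MvPolynomial.C (k : ℤ)) := by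
    intro i j hj
    obtain ⟨c, hc, hc'⟩ := hℓc j hj
    refine ⟨c, hc, ?_⟩
    simp [L, hc']
  have hcard : ∀ j ≤ d, ((Finset.range (d + 1)).erase j).card = d := fun j hj => by
    rw [Finset.card_erase_of_mem (Finset.mem_range.2 (Nat.lt_succ_of_le hj)), Finset.card_range]
    rfl
  have hdeg : ∀ i k, ∀ j ≤ d, (L i j).degreeOf k ≤ if i = k then d else 0 := by
    intro i k j hj
    obtain ⟨c, -, hc⟩ := hL i j hj
    rw [hc]
    refine (MvPolynomial.degreeOf_mul_le _ _ _).trans ?_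
    rw [MvPolynomial.degreeOf_C, zero_add]
    refine (MvPolynomial.degreeOf_prod_le _ _ _).trans
      ((Finset.sum_le_sum fun (l : ℕ) _ => degreeOf_X_sub_C_le i k (l : ℤ)).trans ?_)
    rw [Finset.sum_const, hcard j hj]
    split_ifs <;> simp
  have hl1 : ∀ i, ∀ j ≤ d, l1 (L i j) ≤ Δ.natAbs * (d + 1) ^ d := by
    intro i j hj
    obtain ⟨c, hc, hc'⟩ := hL i j hj
    rw [hc']
    refine (l1_mul _ _).trans (Nat.mul_le_mul (by rwa [l1_C]) ((l1_prod _ _).trans ?_))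
    refine (Finset.prod_le_pow_card _ _ (d + 1) fun k hk => ?_).trans_eq (by rw [hcard j hj])
    have hk' := Finset.mem_range.1 (Finset.mem_of_mem_erase hk)
    refine (l1_sub _ _).trans ?_
    rw [l1_X, l1_C]
    omega
  have hid : MvPolynomial.C (Δ ^ m) * F = ∑ j : Fin m → Fin (d + 1),
      MvPolynomial.C (MvPolynomial.eval (fun i => ((j i : ℕ) : ℤ)) F) * ∏ i, L i (j i) := by
    rw [← sub_eq_zero]
    refine MvPolynomial.eq_zero_of_eval_zero_at_prod_finset _
      (fun _ => (Finset.range (d + 1)).image ((↑) : ℕ → ℤ)) (fun k => ?_) fun a ha => ?_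
    · rw [Finset.card_image_of_injective _ Nat.cast_injective, Finset.card_range]
      refine Nat.lt_succ_of_le ?_
      rw [sub_eq_add_neg, ← Finset.sum_neg_distrib]
      refine (MvPolynomial.degreeOf_add_le _ _ _).trans (max_le ?_ ?_)
      · refine (MvPolynomial.degreeOf_C_mul_le _ _ _).trans
          ((MvPolynomial.degreeOf_le_totalDegree _ _).trans hF)
      · refine (MvPolynomial.degreeOf_sum_le _ _ _).trans (Finset.sup_le fun j _ => ?_)
        rw [← neg_mul, ← map_neg]
        refine (MvPolynomial.degreeOf_C_mul_le _ _ _).trans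
          ((MvPolynomial.degreeOf_prod_le _ _ _).trans ?_)
        refine (Finset.sum_le_sum fun i _ =>
          hdeg i k (j i) (Nat.le_of_lt_succ (j i).isLt)).trans ?_
        simp
    · have : ∃ b : Fin m → Fin (d + 1), a = fun i => ((b i : ℕ) : ℤ) := by
        choose b hb hb' using fun i => Finset.mem_image.1 (ha i)
        exact ⟨fun i => ⟨b i, Finset.mem_range.1 (hb i)⟩, funext fun i => (hb' i).symm⟩
      obtain ⟨b, rfl⟩ := this
      have hLe : ∀ i (j : Fin (d + 1)), MvPolynomial.eval (fun i => ((b i : ℕ) : ℤ)) (L i j) =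
          if j = b i then Δ else 0 := by
        intro i j
        have h1 : MvPolynomial.eval (fun i => ((b i : ℕ) : ℤ)) (L i j) =
            (ℓ j).eval ((b i : ℕ) : ℤ) := by
          have := Polynomial.hom_eval₂ (ℓ j) (algebraMap ℤ (MvPolynomial (Fin m) ℤ))
            (MvPolynomial.eval (fun i => ((b i : ℕ) : ℤ))) (MvPolynomial.X i)
          rw [MvPolynomial.eval_X] at this
          simp only [L, Polynomial.aeval_def, this, Polynomial.eval]
          congr 1
          exact RingHom.ext_int _ _
        rw [h1, hℓ _ (Nat.le_of_lt_succ j.isLt) _ (Nat.le_of_lt_succ (b i).isLt)]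
        simp only [Fin.ext_iff]
      rw [map_sub, map_mul, map_sum, MvPolynomial.eval_C, sub_eq_zero,
        Finset.sum_eq_single b]
      · rw [map_mul, MvPolynomial.eval_C, map_prod, Finset.prod_congr rfl fun i _ => hLe i (b i)]
        simp [mul_comm]
      · intro j _ hj
        obtain ⟨i, hi⟩ := Function.ne_iff.1 hj
        rw [map_mul, map_prod, Finset.prod_eq_zero (Finset.mem_univ i), mul_zero]
        rw [hLe, if_neg hi]
      · simp
  have h1 : Δ.natAbs ^ m * l1 F = l1 (MvPolynomial.C (Δ ^ m) * F) := by
    rw [l1_eq_sum (f := MvPolynomial.C (Δ ^ m) * F) (s := F.support), l1, Finset.mul_sum]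
    · refine Finset.sum_congr rfl fun α _ => ?_
      rw [MvPolynomial.coeff_C_mul, Int.natAbs_mul, Int.natAbs_pow]
    · intro α hα
      rw [MvPolynomial.mem_support_iff, MvPolynomial.coeff_C_mul] at hα
      exact MvPolynomial.mem_support_iff.2 (right_ne_zero_of_mul hα)
  have h2 : Δ.natAbs ^ m * l1 F ≤ Δ.natAbs ^ m * ((d + 1) ^ ((d + 1) * m) * V) := by
    rw [h1, hid]
    refine (l1_sum _ _).trans ((Finset.sum_le_card_nsmul _ _ (V * (Δ.natAbs * (d + 1) ^ d) ^ m)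
      fun j _ => ?_).trans_eq ?_)
    · refine (l1_mul _ _).trans (Nat.mul_le_mul (by rw [l1_C]; exact hV j)
        ((l1_prod _ _).trans ((Finset.prod_le_pow_card _ _ _ fun i _ =>
          hl1 i (j i) (Nat.le_of_lt_succ (j i).isLt)).trans_eq ?_)))
      simp
    · simp only [Finset.card_univ, Fintype.card_pi, Fintype.card_fin, Finset.prod_const,
        smul_eq_mul, mul_pow, add_mul, one_mul, pow_add, pow_mul]
      ring
  exact Nat.le_of_mul_le_mul_left h2 (pow_pos (Int.natAbs_pos.2 hΔ) _)

end Interpolation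

section Normalize

variable {n d : ℕ}

/-- The homothety `f(X) ↦ f(B X)`. -/
noncomputable def scale (B : ℤ) :
    MvPolynomial (Fin (n + 1)) ℤ →ₐ[ℤ] MvPolynomial (Fin (n + 1)) ℤ :=
  MvPolynomial.aeval fun i => MvPolynomial.C B * MvPolynomial.X i

lemma scale_X (B : ℤ) (i : Fin (n + 1)) :
    scale B (MvPolynomial.X i) = MvPolynomial.C B * MvPolynomial.X i := by
  simp [scale]

lemma coeff_scale (B : ℤ) (f : MvPolynomial (Fin (n + 1)) ℤ) (m : Fin (n + 1) →₀ ℕ) :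
    (scale B f).coeff m = B ^ (∑ i, m i) * f.coeff m := by
  classical
  induction f using MvPolynomial.induction_on' with
  | monomial a c =>
    have : scale B (MvPolynomial.monomial a c) =
        MvPolynomial.monomial a (B ^ (∑ i, a i) * c) := by
      rw [scale, MvPolynomial.aeval_monomial, Finsupp.prod_fintype _ _ (by simp)]
      simp only [mul_pow, Finset.prod_mul_distrib, ← map_pow, ← map_prod,
          Finset.prod_pow_eq_pow_sum]
      rw [MvPolynomial.monomial_eq, Finsupp.prod_fintype _ _ (by simp), MvPolynomial.algebraMap_eq,
        map_mul]
      ring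
    rw [this, MvPolynomial.coeff_monomial, MvPolynomial.coeff_monomial]
    split_ifs with h
    · rw [h]
    · rw [mul_zero]
  | add p q hp hq => rw [map_add, MvPolynomial.coeff_add, hp, hq, MvPolynomial.coeff_add, mul_add]

lemma l1_mono {f g : MvPolynomial (Fin (n + 1)) ℤ}
    (h : ∀ m, (f.coeff m).natAbs ≤ (g.coeff m).natAbs) : l1 f ≤ l1 g := by
  classical
  rw [l1_eq_sum (f := g) (s := f.support ∪ g.support) Finset.subset_union_right,
    l1_eq_sum (f := f) (s := f.support ∪ g.support) Finset.subset_union_left]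
  exact Finset.sum_le_sum fun m _ => h m

lemma l1_le_l1_scale {B : ℕ} (hB : 1 ≤ B) (f : MvPolynomial (Fin (n + 1)) ℤ) :
    l1 f ≤ l1 (scale (B : ℤ) f) := l1_mono fun m => by
  rw [coeff_scale, Int.natAbs_mul, Int.natAbs_pow, Int.natAbs_natCast]
  exact Nat.le_mul_of_pos_left _ (pow_pos hB _)

lemma totalDegree_scale_le (B : ℤ) (f : MvPolynomial (Fin (n + 1)) ℤ) :
    (scale B f).totalDegree ≤ f.totalDegree := by
  refine MvPolynomial.totalDegree_le_of_support_subset fun m hm => ?_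
  rw [MvPolynomial.mem_support_iff, coeff_scale] at hm
  exact MvPolynomial.mem_support_iff.2 (right_ne_zero_of_mul hm)

lemma eval_scale (B : ℤ) (f : MvPolynomial (Fin (n + 1)) ℤ) (x : Fin (n + 1) → ℤ) :
    MvPolynomial.eval x (scale B f) = MvPolynomial.eval (fun i => B * x i) f := by
  have : (MvPolynomial.eval x).comp (scale (n := n) B :
      MvPolynomial (Fin (n + 1)) ℤ →+* MvPolynomial (Fin (n + 1)) ℤ) =
      MvPolynomial.eval (fun i => B * x i) :=
    MvPolynomial.ringHom_ext (by simp) fun i => by simp [scale_X]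
  rw [← this]
  rfl

lemma scale_affine (B : ℤ) (j : Fin (n + 1) → ℤ) (f : MvPolynomial (Fin (n + 1)) ℤ) :
    scale B (affine 0 (fun i => B * j i) f) = affine 0 j (scale B f) := by
  have : (scale B).comp (affine 0 (fun i => B * j i)) =
      ((affine 0 j).comp (scale B) : MvPolynomial (Fin (n + 1)) ℤ →ₐ[ℤ] _) := by
    refine MvPolynomial.algHom_ext fun i => ?_
    simp [affine_X, scale_X, mul_add]
  exact congrArg (fun ψ => ψ f) this

lemma lead_translate {f : MvPolynomial (Fin (n + 1)) ℤ} (hf : f.totalDegree ≤ d)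
    (t : Fin (n + 1) → ℤ) : lead d (affine 0 t f) = lead d f := by
  have h : affine 0 0 f = f := by
    have : affine 0 0 = AlgHom.id ℤ (MvPolynomial (Fin (n + 1)) ℤ) :=
      MvPolynomial.algHom_ext fun i => by simp [affine_X]
    rw [this]
    rfl
  conv_rhs => rw [← h]
  rw [lead_affine hf, lead_affine hf]

lemma exists_translate {f : MvPolynomial (Fin (n + 1)) ℤ} (hf : f.totalDegree ≤ d) (hd : 0 < d)
    (hl : lead d f ≠ 0) {B : ℕ} (hB : 1 ≤ B) : ∃ t : Fin (n + 1) → ℤ,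
      (∀ i, 0 ≤ t i ∧ t i ≤ d * B) ∧
      l1 (affine 0 t f) ≤
        (MvPolynomial.constantCoeff (affine 0 t f)).natAbs * (d + 1) ^ (3 * d * (n + 1)) ∧
      B ^ d ≤ (MvPolynomial.constantCoeff (affine 0 t f)).natAbs * (d + 1) ^ (3 * d * (n + 1)) := by
  obtain ⟨j, hj⟩ := Finite.exists_max fun j : Fin (n + 1) → Fin (d + 1) =>
    (MvPolynomial.eval (fun i => ((j i : ℕ) : ℤ)) (scale (B : ℤ) f)).natAbs
  have hF := l1_le_of_natAbs_eval_le ((totalDegree_scale_le (B : ℤ) f).trans hf) hj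
  have hc : MvPolynomial.constantCoeff (affine 0 (fun i => (B : ℤ) * ((j i : ℕ) : ℤ)) f) =
      MvPolynomial.eval (fun i => ((j i : ℕ) : ℤ)) (scale (B : ℤ) f) := by
    rw [← MvPolynomial.eval_zero', eval_affine, eval_scale]
    simp
  have hexp : (d + 1) * (n + 1) + d ≤ 3 * d * (n + 1) := by nlinarith
  have hjd : ∀ i, (j i : ℕ) ≤ d := fun i => Nat.le_of_lt_succ (j i).isLt
  refine ⟨fun i => (B : ℤ) * ((j i : ℕ) : ℤ), fun i => ⟨by positivity, ?_⟩, ?_, ?_⟩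
  · have h : ((j i : ℕ) : ℤ) ≤ d := by exact_mod_cast hjd i
    exact (mul_comm _ _).trans_le (mul_le_mul_of_nonneg_right h (Int.natCast_nonneg B))
  · rw [hc]
    refine (l1_le_l1_scale hB _).trans ?_
    rw [scale_affine]
    have h1 : l1 (affine 0 (fun i => ((j i : ℕ) : ℤ)) (scale (B : ℤ) f)) ≤
        l1 (scale (B : ℤ) f) * (d + 1) ^ d := by
      refine l1_bind₁_le (Nat.le_add_left 1 d) (fun i => ?_) ((totalDegree_scale_le _ f).trans hf)
      refine (l1_add _ _).trans ?_
      have := l1_X i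
      have := hjd i
      simp only [Pi.zero_apply, map_zero, zero_mul, add_zero, l1_X, l1_C, Int.natAbs_natCast]
      omega
    refine h1.trans ((Nat.mul_le_mul_right _ hF).trans ?_)
    rw [mul_right_comm, ← pow_add, mul_comm]
    exact Nat.mul_le_mul_left _ (Nat.pow_le_pow_right (Nat.succ_pos d) hexp)
  · rw [hc]
    have h1 := natAbs_coeff_le_l1 (scale (B : ℤ) f) (Finsupp.single 0 d)
    rw [coeff_scale, Int.natAbs_mul, Int.natAbs_pow, Int.natAbs_natCast] at h1
    have h2 : ∑ i, (Finsupp.single (0 : Fin (n + 1)) d) i = d := by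
      simp [Finsupp.single_apply]
    rw [h2] at h1
    refine (Nat.le_mul_of_pos_right _ (Int.natAbs_pos.2 hl)).trans (h1.trans (hF.trans ?_))
    rw [mul_comm]
    exact Nat.mul_le_mul_left _ (Nat.pow_le_pow_right (Nat.succ_pos d)
      ((Nat.le_add_right _ _).trans hexp))

lemma exists_normalization {f : MvPolynomial (Fin (n + 1)) ℤ} (hf : f.totalDegree = d) (hd : 0 < d)
    (hp : Prime f) (hirr : Irreducible (MvPolynomial.map (Int.castRingHom ℂ) f))
    {B : ℕ} (hB : 1 ≤ B) : ∃ f₂ : MvPolynomial (Fin (n + 1)) ℤ, f₂.totalDegree = d ∧ Prime f₂ ∧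
      Irreducible (MvPolynomial.map (Int.castRingHom ℂ) f₂) ∧ lead d f₂ ≠ 0 ∧
      l1 f₂ ≤ (MvPolynomial.constantCoeff f₂).natAbs * (d + 1) ^ (3 * d * (n + 1)) ∧
      B ^ d ≤ (MvPolynomial.constantCoeff f₂).natAbs * (d + 1) ^ (3 * d * (n + 1)) ∧
      ∀ g₂ : MvPolynomial (Fin (n + 1)) ℤ, ¬ f₂ ∣ g₂ →
        (∀ x, MvPolynomial.eval x f₂ = 0 → (∀ i, (x i).natAbs ≤ (2 * d + 1) * B) →
          MvPolynomial.eval x g₂ = 0) →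
        ∃ g : MvPolynomial (Fin (n + 1)) ℤ, ¬ f ∣ g ∧ g.totalDegree = g₂.totalDegree ∧
          ∀ x : Fin (n + 1) → ℤ, MvPolynomial.eval x f = 0 → (∀ i, |x i| ≤ (B : ℤ)) →
            MvPolynomial.eval x g = 0 := by
  obtain ⟨b, hb0, hb, hl⟩ := exists_lead_affine_ne_zero hf hp.ne_zero
  have hd1 : (affine b 0 f).totalDegree = d := (totalDegree_affine _ _ hb0 _).trans hf
  obtain ⟨t, ht, hl1, hBd⟩ := exists_translate hd1.le hd hl hB
  refine ⟨affine 0 t (affine b 0 f), (totalDegree_affine _ _ rfl _).trans hd1,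
    prime_affine rfl (prime_affine hb0 hp),
    irreducible_map_affine _ rfl (irreducible_map_affine _ hb0 hirr), ?_, hl1, hBd, ?_⟩
  · rwa [lead_translate hd1.le]
  · intro g₂ hg₂ hv
    obtain ⟨g₁, rfl⟩ := (affineEquiv 0 t rfl).surjective g₂
    obtain ⟨g, rfl⟩ := (affineEquiv b 0 hb0).surjective g₁
    simp only [affineEquiv_apply] at hg₂ hv ⊢
    refine ⟨g, fun h => hg₂ (map_dvd _ (map_dvd _ h)), ?_, fun x hx hxB => ?_⟩
    · rw [totalDegree_affine _ _ rfl, totalDegree_affine _ _ hb0]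
    · have hxy : (fun i => (x i - b i * x 0 - t i + t i)
        + b i * (x 0 - b 0 * x 0 - t 0 + t 0)) = x := by
        funext i
        rw [hb0]
        ring
      have := hv (fun i => x i - b i * x 0 - t i)
      simp only [eval_affine, Pi.zero_apply, zero_mul, add_zero, hxy] at this
      refine this hx fun i => ?_
      have h1 := abs_le.1 (hxB i)
      have h0 := abs_le.1 (hxB 0)
      have h2 := hb i
      have h3 := ht i
      have h4 : |b i * x 0| ≤ d * B := by
        rw [abs_mul, abs_of_nonneg h2.1]
        exact mul_le_mul h2.2 (hxB 0) (abs_nonneg _) (by positivity)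
      have h5 := abs_le.1 h4
      zify
      rw [abs_le]
      constructor <;> linarith

end Normalize

section ShellCard

variable {n : ℕ}

lemma card_shell_add (n d r : ℕ) : (shell (n + 1) d (r + d)).card =
    ∑ j ∈ Finset.range d, (r + j + 1 + n).choose n := by
  have h1 : ∀ d, (simplex (Fin (n + 1)) (r + d)).card = (simplex (Fin (n + 1)) r).card +
      ∑ j ∈ Finset.range d, (r + j + 1 + n).choose n := by
    intro d
    induction d with
    | zero => simp
    | succ d ih =>
      rw [Finset.sum_range_succ, ← add_assoc _ _ ((r + d + 1 + n).choose n), ← ih, card_simplex,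
          card_simplex, Fintype.card_fin]
      have : r + (d + 1) + (n + 1) = (r + d + 1 + n) + 1 := by ring
      rw [this, Nat.choose_succ_succ, add_comm]
      congr 2
      ring
  rw [shell, Finset.card_sdiff_of_subset (simplex_mono (Nat.sub_le _ _)), Nat.add_sub_cancel, h1,
    Nat.add_sub_cancel_left]

lemma mul_pow_le_card_shell (n d r : ℕ) :
    d * r ^ n ≤ n.factorial * (shell (n + 1) d (r + d)).card := by
  rw [card_shell_add, Finset.mul_sum, ← smul_eq_mul]
  nth_rewrite 1 [← Finset.card_range d]
  refine Finset.card_nsmul_le_sum (N := ℕ) _ _ _ fun j _ => ?_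
  rw [← Nat.ascFactorial_eq_factorial_mul_choose]
  exact (Nat.pow_le_pow_left (by omega) n).trans (Nat.pow_succ_le_ascFactorial _ n)

lemma card_shell_le (n d r : ℕ) :
    n.factorial * (shell (n + 1) d (r + d)).card ≤ d * (r + d + n) ^ n := by
  rw [card_shell_add, Finset.mul_sum]
  refine (Finset.sum_le_card_nsmul (N := ℕ) _ _ ((r + d + n) ^ n) fun j hj => ?_).trans_eq
    (by rw [Finset.card_range, smul_eq_mul])
  rw [← Nat.descFactorial_eq_factorial_mul_choose]
  have := Finset.mem_range.1 hj
  exact (Nat.descFactorial_le_pow _ n).trans (Nat.pow_le_pow_left (by omega) n)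

lemma pow_le_card_simplex (n r : ℕ) :
    r ^ (n + 1) ≤ (n + 1).factorial * (simplex (Fin (n + 1)) r).card := by
  rw [card_simplex, Fintype.card_fin, ← Nat.ascFactorial_eq_factorial_mul_choose]
  exact (Nat.pow_le_pow_left (by omega) _).trans (Nat.pow_succ_le_ascFactorial _ _)

end ShellCard

section GoodModulus

variable {n d : ℕ}

lemma exists_good_modulus (hn : 1 ≤ n) (hd : 0 < d) {f : MvPolynomial (Fin (n + 1)) ℤ}
    (hf : f.totalDegree ≤ d) (hl : lead d f ≠ 0)
    (hirr : Irreducible (MvPolynomial.map (Int.castRingHom ℂ) f)) {V : ℕ} (hV : l1 f ≤ V)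
    (hdV : 2 ^ d ≤ V) :
    ∃ N : ℕ, N ≠ 0 ∧ N ≤ V ^ (25 * d ^ 2) ∧ ∀ p : ℕ, p.Prime → ¬ p ∣ N → 4096 * d ^ 4 ≤ p →
      ∃ _ : Fact p.Prime, (lead d f : ZMod p) ≠ 0 ∧
        ∑ a : Fin n → ZMod p, weight d f a ≤ p ^ (n - 1) * (p + 203 * d ^ 2 * Nat.sqrt p) := by
  obtain ⟨D, hD0, hDd, ⟨N₀, hN₀, hDl⟩, hcert⟩ := exists_certificate hd hf hl hirr
  obtain ⟨α, hα⟩ := MvPolynomial.exists_coeff_ne_zero hD0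
  refine ⟨(lead d f).natAbs * (D.coeff α).natAbs,
    mul_ne_zero (Int.natAbs_ne_zero.2 hl) (Int.natAbs_ne_zero.2 hα), ?_, ?_⟩
  · have hV1 : 1 ≤ V := le_trans Nat.one_le_two_pow hdV
    have h1 : N₀ * (2 * d * (l1 f * 2 ^ d)) ≤ V ^ 8 := by
      have h2 : N₀ * (2 * d * 2 ^ d) ≤ V ^ 7 := by
        have hd2 : d ≤ 2 ^ d := Nat.lt_two_pow_self.le
        have h8 : 6 ≤ 8 ^ d := (by norm_num : 6 ≤ 8 ^ 1).trans
            (Nat.pow_le_pow_right (by norm_num) hd)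
        calc N₀ * (2 * d * 2 ^ d) ≤ 3 * d ^ 2 * (2 * d * 2 ^ d) := Nat.mul_le_mul_right _ hN₀
          _ = 6 * d ^ 3 * 2 ^ d := by ring
          _ ≤ 8 ^ d * (2 ^ d) ^ 3 * 2 ^ d :=
            Nat.mul_le_mul_right _ (Nat.mul_le_mul h8 (Nat.pow_le_pow_left hd2 3))
          _ = (2 ^ d) ^ 7 := by
            rw [show (8 : ℕ) = 2 ^ 3 by norm_num, ← pow_mul, mul_comm 3 d, pow_mul]
            ring
          _ ≤ V ^ 7 := Nat.pow_le_pow_left hdV 7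
      calc N₀ * (2 * d * (l1 f * 2 ^ d)) = N₀ * (2 * d * 2 ^ d) * l1 f := by ring
        _ ≤ V ^ 7 * V := Nat.mul_le_mul h2 hV
        _ = V ^ 8 := by ring
    have h3 : (D.coeff α).natAbs ≤ V ^ (24 * d ^ 2) :=
      calc (D.coeff α).natAbs ≤ l1 D := natAbs_coeff_le_l1 _ _
        _ ≤ N₀.factorial * (2 * d * (l1 f * 2 ^ d)) ^ N₀ := hDl
        _ ≤ N₀ ^ N₀ * (2 * d * (l1 f * 2 ^ d)) ^ N₀ :=
          Nat.mul_le_mul_right _ (Nat.factorial_le_pow _)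
        _ = (N₀ * (2 * d * (l1 f * 2 ^ d))) ^ N₀ := (mul_pow _ _ _).symm
        _ ≤ (V ^ 8) ^ N₀ := Nat.pow_le_pow_left h1 _
        _ ≤ (V ^ 8) ^ (3 * d ^ 2) := Nat.pow_le_pow_right (pow_pos hV1 8) hN₀
        _ = V ^ (24 * d ^ 2) := by rw [← pow_mul]; congr 1; ring
    calc (lead d f).natAbs * (D.coeff α).natAbs ≤ V * V ^ (24 * d ^ 2) :=
        Nat.mul_le_mul ((natAbs_coeff_le_l1 _ _).trans hV) h3
      _ = V ^ (24 * d ^ 2 + 1) := (pow_succ' _ _).symm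
      _ ≤ V ^ (25 * d ^ 2) := Nat.pow_le_pow_right hV1 (by
          have : 0 < d ^ 2 := pow_pos hd 2
          omega)
  · intro p hp hpN hdp
    have : Fact p.Prime := ⟨hp⟩
    have hlp : ((lead d f : ℤ) : ZMod p) ≠ 0 := fun h => hpN
      (Dvd.dvd.mul_right (Int.natCast_dvd.1 ((ZMod.intCast_zmod_eq_zero_iff_dvd _ _).1 h)) _)
    have hαp : ((D.coeff α : ℤ) : ZMod p) ≠ 0 := fun h => hpN
      (Dvd.dvd.mul_left (Int.natCast_dvd.1 ((ZMod.intCast_zmod_eq_zero_iff_dvd _ _).1 h)) _)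
    have hDp : MvPolynomial.map (Int.castRingHom (ZMod p)) D ≠ 0 := fun h => hαp (by
      have := congrArg (MvPolynomial.coeff α) h
      rwa [MvPolynomial.coeff_map, MvPolynomial.coeff_zero] at this)
    have hsq : 64 * d ^ 2 ≤ Nat.sqrt p := Nat.le_sqrt.2 (by
      refine le_trans (le_of_eq ?_) hdp
      ring)
    have hd4 : d ≤ d ^ 4 := Nat.le_self_pow (by norm_num) d
    have h1 := sum_weight_le hd hf hlp hDd hDp
      (fun b a h => hcert p (by omega) hlp b a h) hsq
    refine ⟨this, hlp, Nat.le_of_mul_le_mul_left (h1.trans_eq ?_) hp.pos⟩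
    obtain ⟨k, rfl⟩ := Nat.exists_eq_add_of_le' hn
    rw [Nat.add_sub_cancel, pow_succ]
    ring

end GoodModulus

lemma exponent_ge {n d s p k : ℕ} {Y : ℝ} (hn : 1 ≤ n)
    (hY : Y ^ n = n.factorial * s) (hp : 0 < p) (hk1 : (k : ℝ) + n ≤ Y / p)
    (hk2 : Y / p ≤ k + n + 1) :
    (s : ℝ) * (Y / p * (n - 203 * d ^ 2 / √p) / (n + 1) - (n + 1)) ≤
      ((k * s - p ^ (n - 1) * (p + 203 * d ^ 2 * Nat.sqrt p) *
          (k + n).choose (n + 1) : ℕ) : ℝ) := by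
  have hp' : (0 : ℝ) < p := by exact_mod_cast hp
  have hsp : (0 : ℝ) < √p := Real.sqrt_pos.2 hp'
  have h1 : (k * s : ℝ) ≤
      ((k * s - p ^ (n - 1) * (p + 203 * d ^ 2 * Nat.sqrt p) * (k + n).choose (n + 1) : ℕ) : ℝ) +
        (p ^ (n - 1) * (p + 203 * d ^ 2 * Nat.sqrt p) * (k + n).choose (n + 1) : ℝ) := by
    exact_mod_cast le_tsub_add
  have h2 : (p ^ (n - 1) * (p + 203 * d ^ 2 * Nat.sqrt p) : ℝ) ≤
      p ^ n * (1 + 203 * d ^ 2 / √p) := by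
    have h3 : (p : ℝ) ^ n = p ^ (n - 1) * p := by
      rw [← pow_succ, Nat.sub_add_cancel hn]
    have h4 : (p : ℝ) / √p = √p := Real.div_sqrt
    have h5 : (p : ℝ) ^ n * (1 + 203 * d ^ 2 / √p) = p ^ (n - 1) * (p + 203 * d ^ 2 * √p) := by
      rw [h3, ← h4]
      field_simp
      linear_combination (203 * (d : ℝ) ^ 2) * Real.sq_sqrt hp'.le
    rw [h5]
    gcongr
    exact Real.nat_sqrt_le_real_sqrt
  have h3 : ((k + n).choose (n + 1) : ℝ) ≤ (Y / p) ^ (n + 1) / (n + 1).factorial := by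
    refine (Nat.choose_le_pow_div _ _).trans ?_
    gcongr
    push_cast
    exact hk1
  have h4 : (p ^ (n - 1) * (p + 203 * d ^ 2 * Nat.sqrt p) * (k + n).choose (n + 1) : ℝ) ≤
      (1 + 203 * d ^ 2 / √p) * (s * (Y / p)) / (n + 1) := by
    refine (mul_le_mul h2 h3 (by positivity) (by positivity)).trans_eq ?_
    have : (s : ℝ) = Y ^ n / n.factorial := by
      rw [hY]
      field_simp
    rw [this, Nat.factorial_succ, div_pow]
    push_cast
    field_simp
    ring
  have h5 : (s : ℝ) * (Y / p - n - 1) ≤ k * s := by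
    rw [mul_comm (k : ℝ)]
    exact mul_le_mul_of_nonneg_left (by linarith) (Nat.cast_nonneg s)
  have h6 : (s : ℝ) * (Y / p * (n - 203 * d ^ 2 / √p) / (n + 1) - (n + 1)) =
      s * (Y / p - n - 1) - (1 + 203 * d ^ 2 / √p) * (s * (Y / p)) / (n + 1) := by
    field_simp
    ring
  linarith

lemma exists_sum_exponent_ge (n : ℕ) (hn : 1 ≤ n) : ∃ C : ℝ, 0 ≤ C ∧ ∀ (d s Q N : ℕ) (Y : ℝ),
    0 < Y → Y ^ n = n.factorial * s → 0 < d → 4096 * d ^ 4 ≤ Q → N ≠ 0 → Real.log N ≤ Q →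
      (s : ℝ) * Y * (n / (n + 1)) * (Real.log (Y / Q) - C) ≤
        ∑ p ∈ (primesIoc Q ⌊Y / (n + 1)⌋₊).filter (fun p => ¬ p ∣ N),
          (((⌊Y / p⌋₊ - n) * s - p ^ (n - 1) * (p + 203 * d ^ 2 * Nat.sqrt p) *
            (⌊Y / p⌋₊ - n + n).choose (n + 1) : ℕ) : ℝ) * Real.log p := by
  obtain ⟨C₀, hC₀⟩ := exists_log_div_le_sum
  refine ⟨|C₀| + 2 * n + 57, by positivity, fun d s Q N Y hY0 hY hd hQ hN hNQ => ?_⟩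
  have hn' : (1 : ℝ) ≤ n := by exact_mod_cast hn
  have hQ1 : 1 ≤ Q := le_trans (by have := pow_pos hd 4; omega) hQ
  have hQ0 : (0 : ℝ) < Q := by exact_mod_cast hQ1
  have hYP : Y < (n + 1) * (⌊Y / (n + 1)⌋₊ + 1) := by
    have := Nat.lt_floor_add_one (Y / (n + 1))
    rw [div_lt_iff₀ (by positivity)] at this
    linarith
  rcases lt_or_ge ⌊Y / (n + 1)⌋₊ Q with hPQ | hPQ
  · refine le_trans (mul_nonpos_of_nonneg_of_nonpos (by positivity) ?_)
      (Finset.sum_nonneg fun p _ => mul_nonneg (Nat.cast_nonneg _) (Real.log_natCast_nonneg p))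
    have h1 : Y / Q ≤ n + 1 := by
      rw [div_le_iff₀ hQ0]
      have : ((⌊Y / (n + 1)⌋₊ : ℕ) : ℝ) + 1 ≤ Q := by exact_mod_cast hPQ
      exact hYP.le.trans (mul_le_mul_of_nonneg_left this (by positivity))
    have h2 := Real.log_le_sub_one_of_pos (div_pos hY0 hQ0)
    have := abs_nonneg C₀
    linarith
  set P := ⌊Y / (n + 1)⌋₊ with hP
  have hP1 : (1 : ℝ) ≤ P := by exact_mod_cast hQ1.trans hPQ
  have hPY : (P : ℝ) ≤ Y / (n + 1) := Nat.floor_le (by positivity)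
  have hlog : Real.log (Y / Q) - (2 * n + 1) ≤ Real.log (P / Q) := by
    have h1 : Y / Q ≤ 2 * (n + 1) * (P / Q) := by
      rw [← mul_div_assoc]
      gcongr
      nlinarith
    have h2 := Real.log_le_log (by positivity) h1
    rw [Real.log_mul (by positivity) (by positivity)] at h2
    have h3 := Real.log_le_sub_one_of_pos (show (0 : ℝ) < 2 * (n + 1) by positivity)
    linarith
  have hlog4 : Real.log 4 ≤ 2 := by
    have : Real.log 4 = 2 * Real.log 2 := by
      rw [show (4 : ℝ) = 2 ^ 2 by norm_num, Real.log_pow]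
      norm_num
    have := Real.log_two_lt_d9
    linarith
  set A := (primesIoc Q P).filter (fun p => ¬ p ∣ N)
  have hAsub : A ⊆ primesIoc Q P := Finset.filter_subset _ _
  have hterm : ∀ p ∈ A, (s : ℝ) * (Y * n / (n + 1) * (Real.log p / p) -
      Y * (203 * d ^ 2) / (n + 1) * (Real.log p / (p * √p)) - (n + 1) * Real.log p) ≤
        (((⌊Y / p⌋₊ - n) * s - p ^ (n - 1) * (p + 203 * d ^ 2 * Nat.sqrt p) *
            (⌊Y / p⌋₊ - n + n).choose (n + 1) : ℕ) : ℝ) * Real.log p := by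
    intro p hp
    obtain ⟨⟨hQp, hpP⟩, hpp⟩ := mem_primesIoc.1 (hAsub hp)
    have hp0 : (0 : ℝ) < p := by exact_mod_cast hpp.pos
    have hfl : n ≤ ⌊Y / p⌋₊ := by
      refine Nat.le_floor ?_
      rw [le_div_iff₀ hp0]
      have h1 : (p : ℝ) ≤ Y / (n + 1) := le_trans (by exact_mod_cast hpP) hPY
      rw [le_div_iff₀ (by positivity)] at h1
      nlinarith
    have h1 := exponent_ge (d := d) (k := ⌊Y / p⌋₊ - n) hn hY hpp.pos
      (by
        rw [Nat.cast_sub hfl, sub_add_cancel]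
        exact Nat.floor_le (by positivity))
      (by
        rw [Nat.cast_sub hfl, sub_add_cancel]
        exact (Nat.lt_floor_add_one _).le)
    refine le_trans (le_of_eq ?_) (mul_le_mul_of_nonneg_right h1 (Real.log_natCast_nonneg p))
    have : (0 : ℝ) < √p := Real.sqrt_pos.2 hp0
    field_simp
  refine le_trans ?_ (Finset.sum_le_sum hterm)
  rw [← Finset.mul_sum, Finset.sum_sub_distrib, Finset.sum_sub_distrib, ← Finset.mul_sum,
    ← Finset.mul_sum, ← Finset.mul_sum, mul_assoc, mul_assoc]
  refine mul_le_mul_of_nonneg_left ?_ (Nat.cast_nonneg s)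
  have hS1 : Real.log (Y / Q) - (2 * n + 2 + |C₀|) ≤ ∑ p ∈ A, Real.log p / p := by
    have h1 := hC₀ Q P hQ1 hPQ
    have h2 := sum_log_div_of_dvd_le N Q P hN hQ1
    have h3 : Real.log N / Q ≤ 1 := (div_le_one hQ0).2 hNQ
    have h4 := Finset.sum_filter_add_sum_filter_not (primesIoc Q P) (fun p => p ∣ N)
      (fun p : ℕ => Real.log p / p)
    have h5 := le_abs_self C₀
    linarith
  have hS2 : (203 * d ^ 2) * ∑ p ∈ A, Real.log p / (p * √p) ≤ 51 := by
    have h1 : ∑ p ∈ A, Real.log p / (p * √p) ≤ 8 * Real.log 4 / √Q :=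
      (Finset.sum_le_sum_of_subset_of_nonneg hAsub fun p _ _ =>
        div_nonneg (Real.log_natCast_nonneg p) (by positivity)).trans
          (sum_log_div_mul_sqrt_le Q P hQ1)
    have h2 : (64 * d ^ 2 : ℝ) ≤ √Q := by
      refine Real.le_sqrt_of_sq_le ?_
      refine le_trans (le_of_eq ?_) (show ((4096 * d ^ 4 : ℕ) : ℝ) ≤ Q by exact_mod_cast hQ)
      push_cast
      ring
    have hsQ : (0 : ℝ) < √Q := Real.sqrt_pos.2 hQ0
    refine (mul_le_mul_of_nonneg_left h1 (by positivity)).trans ?_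
    rw [← mul_div_assoc, div_le_iff₀ hsQ]
    have hd2 : (0 : ℝ) ≤ d ^ 2 := by positivity
    nlinarith
  have hS3 : (n + 1) * ∑ p ∈ A, Real.log p ≤ 2 * Y := by
    have h1 : ∑ p ∈ A, Real.log p ≤ Real.log 4 * P :=
      (Finset.sum_le_sum_of_subset_of_nonneg hAsub fun p _ _ => Real.log_natCast_nonneg p).trans
        (sum_log_primesIoc_le Q P)
    rw [le_div_iff₀ (by positivity)] at hPY
    have hP0 : (0 : ℝ) ≤ P := by positivity
    have h2 := mul_le_mul_of_nonneg_left (h1.trans (mul_le_mul_of_nonneg_right hlog4 hP0))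
      (show (0 : ℝ) ≤ n + 1 by positivity)
    linarith
  have hS1' := mul_le_mul_of_nonneg_left hS1 (show (0 : ℝ) ≤ Y * n / (n + 1) by positivity)
  have hS2' := mul_le_mul_of_nonneg_left hS2 (show (0 : ℝ) ≤ Y / (n + 1) by positivity)
  have e1 : Y * (203 * d ^ 2) / (n + 1) * ∑ p ∈ A, Real.log p / (p * √p) =
      Y / (n + 1) * ((203 * d ^ 2) * ∑ p ∈ A, Real.log p / (p * √p)) := by ring
  have e2 : Y / (n + 1) * 51 ≤ Y * n / (n + 1) * 51 := by
    gcongr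
    nlinarith
  have e3 : 2 * Y ≤ Y * n / (n + 1) * 4 := by
    rw [div_mul_eq_mul_div, le_div_iff₀ (by positivity)]
    nlinarith
  rw [e1]
  have e4 : Y * (n / (n + 1) * (Real.log (Y / Q) - (|C₀| + 2 * n + 57))) =
      Y * n / (n + 1) * (Real.log (Y / Q) - (2 * n + 2 + |C₀|)) - Y * n / (n + 1) * 51
        - Y * n / (n + 1) * 4 := by ring
  rw [e4]
  linarith

lemma exists_log_inequality (n : ℕ) (hn : 1 ≤ n) : ∃ C : ℝ, 0 ≤ C ∧
    ∀ (d r B Q V : ℕ) (f : MvPolynomial (Fin (n + 1)) ℤ) (Y : ℝ), 0 < d → f.totalDegree = d →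
      Prime f → Irreducible (MvPolynomial.map (Int.castRingHom ℂ) f) → lead d f ≠ 0 →
      MvPolynomial.constantCoeff f ≠ 0 → l1 f ≤ V → 2 ^ d ≤ V → 1 ≤ B →
      (∀ g : MvPolynomial (Fin (n + 1)) ℤ, g.totalDegree ≤ r + d →
        (∀ x, MvPolynomial.eval x f = 0 → (∀ i, (x i).natAbs ≤ B) → MvPolynomial.eval x g = 0) →
        f ∣ g) →
      4096 * d ^ 4 ≤ Q → 25 * d ^ 2 * Real.log V ≤ Q → 0 < Y →
      Y ^ n = n.factorial * (shell (n + 1) d (r + d)).card →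
      ((shell (n + 1) d (r + d)).card : ℝ) * Y * (n / (n + 1)) * (Real.log (Y / Q) - C) +
          (simplex (Fin (n + 1)) r).card * Real.log (MvPolynomial.constantCoeff f).natAbs ≤
        (shell (n + 1) d (r + d)).card * (Real.log (shell (n + 1) d (r + d)).card +
          (r + d) * Real.log B) := by
  obtain ⟨C, hC0, hC⟩ := exists_sum_exponent_ge n hn
  refine ⟨C, hC0, fun d r B Q V f Y hd hf hp hirr hl hc hV hdV hB hS hQ hVQ hY0 hY => ?_⟩
  obtain ⟨N, hN0, hNV, hN⟩ := exists_good_modulus hn hd hf.le hl hirr hV hdV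
  have hVpos : (0 : ℝ) < V := by
    exact_mod_cast lt_of_lt_of_le (by positivity) hdV
  have hNQ : Real.log N ≤ Q := by
    refine le_trans (Real.log_le_log (by exact_mod_cast Nat.pos_of_ne_zero hN0)
      (show (N : ℝ) ≤ (V : ℝ) ^ (25 * d ^ 2) by exact_mod_cast hNV)) ?_
    rw [Real.log_pow]
    push_cast
    exact hVQ
  have hsum := hC d (shell (n + 1) d (r + d)).card Q N Y hY0 hY hd hQ hN0 hNQ
  set A := (primesIoc Q ⌊Y / (n + 1)⌋₊).filter (fun p => ¬ p ∣ N) with hA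
  have hAmem : ∀ p ∈ A, ((Q < p ∧ p ≤ ⌊Y / (n + 1)⌋₊) ∧ p.Prime) ∧ ¬ p ∣ N := fun p hp => by
    rw [hA, Finset.mem_filter, mem_primesIoc] at hp
    exact hp
  have hdet := determinant_inequality hf hd hp hc (Nat.le_add_left d r) hB hS A
    (fun p => ⌊Y / p⌋₊ - n) (fun p => p ^ (n - 1) * (p + 203 * d ^ 2 * Nat.sqrt p))
    (fun p hp => by
      obtain ⟨⟨⟨-, hpP⟩, hpp⟩, -⟩ := hAmem p hp
      have hp0 : (0 : ℝ) < p := by exact_mod_cast hpp.pos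
      refine Nat.sub_ne_zero_of_lt (Nat.le_floor ?_)
      have h1 : (p : ℝ) ≤ Y / (n + 1) :=
        le_trans (by exact_mod_cast hpP) (Nat.floor_le (by positivity))
      rw [le_div_iff₀ hp0]
      rw [le_div_iff₀ (by positivity)] at h1
      push_cast
      linarith)
    (fun p hp => by
      obtain ⟨⟨⟨hQp, -⟩, hpp⟩, hpN⟩ := hAmem p hp
      exact hN p hpp hpN (hQ.trans hQp.le))
  rw [Nat.add_sub_cancel] at hdet
  set s := (shell (n + 1) d (r + d)).card with hs
  have hs0 : (0 : ℝ) < s := by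
    have h1 : (0 : ℝ) < n.factorial * s := hY ▸ pow_pos hY0 n
    exact pos_of_mul_pos_right h1 (by positivity)
  have hpow : ∀ p ∈ A, (((p : ℕ) : ℝ) ^ ((⌊Y / p⌋₊ - n) * s -
      p ^ (n - 1) * (p + 203 * d ^ 2 * Nat.sqrt p) * (⌊Y / p⌋₊ - n + n).choose (n + 1))) ≠ 0 :=
    fun p hp => pow_ne_zero _ (by exact_mod_cast (hAmem p hp).1.2.ne_zero)
  have hc0 : ((MvPolynomial.constantCoeff f).natAbs : ℝ) ≠ 0 := by
    exact_mod_cast Int.natAbs_ne_zero.2 hc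
  have hlog := Real.log_le_log (Nat.cast_pos.2 (Nat.pos_of_ne_zero (mul_ne_zero
    (pow_ne_zero _ (Int.natAbs_ne_zero.2 hc)) (Finset.prod_ne_zero_iff.2 fun p hp =>
      pow_ne_zero _ (hAmem p hp).1.2.ne_zero))))
    (show ((_ : ℕ) : ℝ) ≤ ((_ : ℕ) : ℝ) from Nat.cast_le.2 hdet)
  rw [Nat.cast_mul, Nat.cast_pow, Nat.cast_prod, Real.log_mul (pow_ne_zero _ hc0)
    (Finset.prod_ne_zero_iff.2 fun p hp => by
      rw [Nat.cast_pow]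
      exact hpow p hp), Real.log_pow, Real.log_prod fun p hp => by
        rw [Nat.cast_pow]
        exact hpow p hp] at hlog
  have hBne : (B : ℝ) ≠ 0 := by exact_mod_cast (Nat.one_le_iff_ne_zero.1 hB)
  have hright : Real.log ((s.factorial * (B ^ (r + d)) ^ s : ℕ) : ℝ) ≤
      s * (Real.log s + (r + d) * Real.log B) := by
    rw [Nat.cast_mul, Nat.cast_pow, Nat.cast_pow,
      Real.log_mul (by exact_mod_cast s.factorial_ne_zero) (by positivity), Real.log_pow,
      Real.log_pow]
    have h1 : Real.log s.factorial ≤ s * Real.log s := by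
      rw [← Real.log_pow]
      refine Real.log_le_log (by exact_mod_cast s.factorial_pos) ?_
      exact_mod_cast Nat.factorial_le_pow s
    push_cast
    linarith
  have hleft : ∑ p ∈ A, Real.log ((p ^ ((⌊Y / p⌋₊ - n) * s -
      p ^ (n - 1) * (p + 203 * d ^ 2 * Nat.sqrt p) * (⌊Y / p⌋₊ - n + n).choose (n + 1)) : ℕ) : ℝ) =
      ∑ p ∈ A, (((⌊Y / p⌋₊ - n) * s - p ^ (n - 1) * (p + 203 * d ^ 2 * Nat.sqrt p) *
            (⌊Y / p⌋₊ - n + n).choose (n + 1) : ℕ) : ℝ) * Real.log p :=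
    Finset.sum_congr rfl fun p _ => by rw [Nat.cast_pow, Real.log_pow]
  rw [hleft] at hlog
  linarith

section Estimate

lemma log_ratio_le {n : ℕ} (hn : 1 ≤ n) {s Y ℓ C N H σ M b u r θ d L x k κ : ℝ}
    (hs : 0 < s) (hY : 0 < Y) (hM : 0 ≤ M) (hu : 1 ≤ u) (hr : 0 < r) (hd : 0 < d) (hL : 0 ≤ L)
    (hx : 0 ≤ x) (hk : 0 ≤ k) (hκ : 0 ≤ κ)
    (h : s * Y * (n / (n + 1)) * (ℓ - C) + N * H ≤ s * (σ + M * b))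
    (hσ : σ ≤ n * Y) (hYr : u * r ≤ Y) (hN : s * Y * θ / ((n + 1) * d * u) ≤ N)
    (hH : H = d * (L + x - 3 * (n + 1) * k)) (hH0 : 0 ≤ H) (hb : b ≤ L + κ)
    (hMr : M ≤ 2 * r) (hML : M * L ≤ r * (L + 1)) (hθL : L - 1 ≤ θ * L) (hθ : 1 / 2 ≤ θ)
    (hθ1 : θ ≤ 1) (hku : k ≤ (1 + n) * u) (hκu : κ ≤ (2 + n) * u) :
    ℓ ≤ C + ((n + 1) * (3 * n + 5) + 1 + 3 * (n + 1) ^ 2) + L / u - x / (2 * n * u) := by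
  have hn' : (1 : ℝ) ≤ n := by exact_mod_cast hn
  have hn0 : (0 : ℝ) < n := by linarith
  have hu0 : 0 < u := by linarith
  have h1 : M * b ≤ Y * ((L + 1) / u + 2 * (2 + n)) := by
    have e1 : M * b ≤ r * (L + 1) + 2 * r * ((2 + n) * u) := calc
      M * b ≤ M * (L + κ) := by gcongr
      _ = M * L + M * κ := by ring
      _ ≤ r * (L + 1) + 2 * r * ((2 + n) * u) := by gcongr
    have e2 : r * (L + 1) + 2 * r * ((2 + n) * u) = (u * r) * ((L + 1) / u + 2 * (2 + n)) := by
      field_simp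
    rw [e2] at e1
    refine e1.trans ?_
    gcongr
  have h2 : Y * (θ * (L + x - 3 * (n + 1) * k) / ((n + 1) * u)) * s ≤ N * H := by
    refine le_trans (le_of_eq ?_) (mul_le_mul_of_nonneg_right hN hH0)
    rw [hH]
    field_simp
  have h3 : (n / (n + 1)) * (ℓ - C) + θ * (L + x - 3 * (n + 1) * k) / ((n + 1) * u) ≤
      n + ((L + 1) / u + 2 * (2 + n)) := by
    refine le_of_mul_le_mul_left ?_ (mul_pos hs hY)
    have : s * (σ + M * b) ≤ s * (n * Y + Y * ((L + 1) / u + 2 * (2 + n))) := by gcongr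
    linarith
  have h4 : n * (ℓ - C) * u + θ * (L + x - 3 * (n + 1) * k) ≤
      (n + 1) * (n * u + (L + 1) + 2 * (2 + n) * u) := by
    have := mul_le_mul_of_nonneg_left h3 (show 0 ≤ (n + 1) * u by positivity)
    have e1 : (n + 1) * u * (n / (n + 1) * (ℓ - C) +
        θ * (L + x - 3 * (n + 1) * k) / ((n + 1) * u)) =
        n * (ℓ - C) * u + θ * (L + x - 3 * (n + 1) * k) := by
      field_simp
    have e2 : (n + 1) * u * (n + ((L + 1) / u + 2 * (2 + n))) =
        (n + 1) * (n * u + (L + 1) + 2 * (2 + n) * u) := by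
      field_simp
      ring
    rwa [e1, e2] at this
  have h5 : θ * k ≤ (1 + n) * u := (mul_le_of_le_one_left hk hθ1).trans hku
  have h6 : x / 2 ≤ θ * x := by nlinarith
  have h7 : 3 * (n + 1) * (θ * k) ≤ 3 * (n + 1) * ((1 + n) * u) := by gcongr
  have h8 : n * (ℓ - C) * u ≤ n * L - x / 2 +
      ((n + 1) * (3 * n + 5) + 1 + 3 * (n + 1) ^ 2) * u := by
    nlinarith
  have h9 : ((n + 1) * (3 * n + 5) + 1 + 3 * (n + 1) ^ 2) * u ≤
      n * (((n + 1) * (3 * n + 5) + 1 + 3 * (n + 1) ^ 2) * u) :=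
    le_mul_of_one_le_left (by positivity) hn'
  refine le_of_mul_le_mul_left ?_ (mul_pos hn0 hu0)
  have e3 : n * u * (C + ((n + 1) * (3 * n + 5) + 1 + 3 * (n + 1) ^ 2) + L / u - x / (2 * n * u)) =
      n * u * C + n * (((n + 1) * (3 * n + 5) + 1 + 3 * (n + 1) ^ 2) * u) + n * L - x / 2 := by
    field_simp
  rw [e3]
  linarith

lemma le_of_log_ratio_le {n : ℕ} (hn : 1 ≤ n) {Y Q C u d L x q : ℝ} (hY : 0 < Y) (hQ : 0 < Q)
    (hu : 1 ≤ u) (hL : 0 ≤ L) (hq : 0 ≤ q) (hx : 0 ≤ x)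
    (h : Real.log (Y / Q) ≤ C + L / u - x / (2 * n * u))
    (hQd : Q ≤ q * d ^ 4 * L * (1 + x / u)) :
    Y ≤ 2 * n * q * Real.exp C * (d ^ 4 * L * Real.exp (L / u)) := by
  have hn' : (1 : ℝ) ≤ n := by exact_mod_cast hn
  have hu0 : 0 < u := by linarith
  have h1 : 1 + x / u ≤ 2 * n * Real.exp (x / (2 * n * u)) := by
    have e1 := Real.add_one_le_exp (x / (2 * n * u))
    have e2 : 2 * n * (x / (2 * n * u) + 1) = x / u + 2 * n := by field_simp
    nlinarith
  have h2 : Y / Q ≤ Real.exp (C + L / u - x / (2 * n * u)) :=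
    (Real.log_le_iff_le_exp (div_pos hY hQ)).1 h
  rw [div_le_iff₀ hQ] at h2
  refine h2.trans ?_
  calc _ ≤ Real.exp (C + L / u - x / (2 * n * u)) *
        (q * d ^ 4 * L * (2 * n * Real.exp (x / (2 * n * u)))) := by
        refine mul_le_mul_of_nonneg_left (hQd.trans ?_) (Real.exp_pos _).le
        gcongr
    _ = 2 * n * q * (d ^ 4 * L) *
        (Real.exp (C + L / u - x / (2 * n * u)) * Real.exp (x / (2 * n * u))) := by ring
    _ = _ := by
        rw [← Real.exp_add, sub_add_cancel, Real.exp_add]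
        ring

lemma degree_ratio {n : ℕ} (hn : 1 ≤ n) {d r M L X K : ℝ} (hd : 1 ≤ d) (hL : 0 ≤ L)
    (hX : d * L ≤ X) (hdX : d ≤ 2 * X) (hK : 4 * ((n : ℝ) + 1) ^ 2 ≤ K) (hM : K * X ≤ M)
    (hr : r + d = M) : 0 < r ∧ M ≤ 2 * r ∧ M * L ≤ r * (L + 1) ∧
      L - 1 ≤ (r / (M + n)) ^ (n + 1) * L ∧ 1 / 2 ≤ (r / (M + n)) ^ (n + 1) ∧
      (r / (M + n)) ^ (n + 1) ≤ 1 := by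
  have hn' : (1 : ℝ) ≤ n := by exact_mod_cast hn
  have hX0 : 0 < X := by linarith
  have hM4 : 4 * ((n : ℝ) + 1) ^ 2 * X ≤ M :=
    (mul_le_mul_of_nonneg_right hK hX0.le).trans hM
  have hn4 : (4 : ℝ) ≤ (n + 1) ^ 2 := by nlinarith
  have hM16 : 16 * X ≤ M := le_trans (by gcongr; linarith) hM4
  have hr0 : 0 < r := by linarith
  have hMn : 0 < M + n := by linarith
  have hb : 1 - ((n : ℝ) + 1) * ((n + d) / (M + n)) ≤ (r / (M + n)) ^ (n + 1) := by
    have e1 : r / (M + n) = 1 + -((n + d) / (M + n)) := by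
      field_simp
      linarith
    have e2 : (n + d) / (M + n) ≤ 1 := by
      rw [div_le_one hMn]
      linarith
    have := one_add_mul_le_pow (show -2 ≤ -((n + d) / (M + n)) by linarith) (n + 1)
    rw [e1]
    push_cast at this
    linarith
  have hnd : (n : ℝ) + d ≤ (n + 1) * d := by nlinarith
  refine ⟨hr0, by linarith, by nlinarith, ?_, ?_, pow_le_one₀ (by positivity) ?_⟩
  · have e1 : ((n : ℝ) + 1) * ((n + d) / (M + n)) * L ≤ 1 := by
      rw [← mul_div_assoc, div_mul_eq_mul_div, div_le_one hMn]
      calc ((n : ℝ) + 1) * (n + d) * L ≤ (n + 1) * ((n + 1) * d) * L := by gcongr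
        _ = (n + 1) ^ 2 * (d * L) := by ring
        _ ≤ (n + 1) ^ 2 * X := by gcongr
        _ ≤ M + n := by nlinarith
    nlinarith
  · have e1 : ((n : ℝ) + 1) * ((n + d) / (M + n)) ≤ 1 / 2 := by
      rw [← mul_div_assoc, div_le_div_iff₀ hMn two_pos]
      calc ((n : ℝ) + 1) * (n + d) * 2 ≤ (n + 1) * ((n + 1) * d) * 2 := by gcongr
        _ = 2 * (n + 1) ^ 2 * d := by ring
        _ ≤ 2 * (n + 1) ^ 2 * (2 * X) := by gcongr
        _ ≤ 1 * (M + n) := by linarith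
    linarith
  · rw [div_le_one hMn]
    linarith

lemma shell_estimates {n d r : ℕ} (hn : 1 ≤ n) (hd : 1 ≤ d) {u Y : ℝ} (hu : 1 ≤ u)
    (hud : u ^ n = d) (hY : 0 < Y)
    (hYs : Y ^ n = n.factorial * (shell (n + 1) d (r + d)).card) :
    0 < ((shell (n + 1) d (r + d)).card : ℝ) ∧
    Real.log (shell (n + 1) d (r + d)).card ≤ n * Y ∧ u * r ≤ Y ∧
      (shell (n + 1) d (r + d)).card * Y * (r / (r + d + n)) ^ (n + 1) / ((n + 1) * d * u) ≤
        (simplex (Fin (n + 1)) r).card := by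
  set s := (shell (n + 1) d (r + d)).card with hs
  have hn0 : n ≠ 0 := by omega
  have hd0 : (0 : ℝ) < d := by exact_mod_cast hd
  have hu0 : 0 < u := by linarith
  have hs0 : (0 : ℝ) < s := by
    have h1 : (0 : ℝ) < n.factorial * s := hYs ▸ pow_pos hY n
    exact pos_of_mul_pos_right h1 (by positivity)
  have hup : Y ≤ u * (r + d + n) := by
    refine le_of_pow_le_pow_left₀ hn0 (by positivity) ?_
    rw [hYs, mul_pow, hud]
    exact_mod_cast card_shell_le n d r
  refine ⟨hs0, ?_, ?_, ?_⟩
  · have h1 : (s : ℝ) ≤ Y ^ n := by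
      rw [hYs]
      refine le_mul_of_one_le_left hs0.le ?_
      exact_mod_cast n.factorial_pos
    refine (Real.log_le_log hs0 h1).trans ?_
    rw [Real.log_pow]
    gcongr
    linarith [Real.log_le_sub_one_of_pos hY]
  · refine le_of_pow_le_pow_left₀ hn0 hY.le ?_
    rw [hYs, mul_pow, hud]
    exact_mod_cast mul_pow_le_card_shell n d r
  · have h1 : (r : ℝ) ^ (n + 1) ≤ ((n + 1) * n.factorial) * (simplex (Fin (n + 1)) r).card := by
      have := pow_le_card_simplex n r
      rw [Nat.factorial_succ] at this
      exact_mod_cast this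
    have hMn : (0 : ℝ) < r + d + n := by positivity
    have h2 : (n.factorial : ℝ) * (s * Y) ≤ d * u * (r + d + n) ^ (n + 1) := calc
      _ = Y ^ (n + 1) := by rw [pow_succ, hYs]; ring
      _ ≤ (u * (r + d + n)) ^ (n + 1) := by gcongr
      _ = _ := by rw [mul_pow, pow_succ u, hud]
    have hf : (0 : ℝ) < n.factorial := by exact_mod_cast n.factorial_pos
    rw [div_le_iff₀ (by positivity), div_pow, ← mul_div_assoc, div_le_iff₀ (by positivity)]
    refine le_of_mul_le_mul_left ?_ hf
    calc (n.factorial : ℝ) * (s * Y * r ^ (n + 1)) = n.factorial * (s * Y) * r ^ (n + 1) := by ring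
      _ ≤ (d * u * (r + d + n) ^ (n + 1)) *
          (((n + 1) * n.factorial) * (simplex (Fin (n + 1)) r).card) := by gcongr
      _ = _ := by ring

lemma exists_not_dvd (n : ℕ) (hn : 1 ≤ n) : ∃ K : ℝ, 1 ≤ K ∧
    ∀ (d r B : ℕ) (f : MvPolynomial (Fin (n + 1)) ℤ) (u : ℝ), 1 ≤ d → 2 ≤ B →
      f.totalDegree = d → Prime f → Irreducible (MvPolynomial.map (Int.castRingHom ℂ) f) →
      lead d f ≠ 0 →
      l1 f ≤ (MvPolynomial.constantCoeff f).natAbs * (d + 1) ^ (3 * d * (n + 1)) →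
      B ^ d ≤ (MvPolynomial.constantCoeff f).natAbs * (d + 1) ^ (3 * d * (n + 1)) →
      1 ≤ u → u ≤ d → u ^ n = d →
      K * (d ^ 4 / u * Real.exp (Real.log B / u) * Real.log B) ≤ r + d →
      ∃ g : MvPolynomial (Fin (n + 1)) ℤ, g.totalDegree ≤ r + d ∧
        (∀ x, MvPolynomial.eval x f = 0 → (∀ i, (x i).natAbs ≤ (2 * d + 1) * B) →
          MvPolynomial.eval x g = 0) ∧ ¬ f ∣ g := by
  obtain ⟨C, hC0, hC⟩ := exists_log_inequality n hn
  have hn' : (1 : ℝ) ≤ n := by exact_mod_cast hn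
  set C₁ : ℝ := C + ((n + 1) * (3 * n + 5) + 1 + 3 * (n + 1) ^ 2) with hC₁
  set C₂ : ℝ := 2 * n * 8300 * Real.exp C₁ with hC₂
  have hC₂0 : 0 < C₂ := by positivity
  refine ⟨4 * (n + 1) ^ 2 + 2 * C₂ + 1, by nlinarith [sq_nonneg ((n : ℝ) + 1)], ?_⟩
  intro d r B f u hd hB hf hp hirr hl hVl hVB hu hu' hud hK
  by_contra! hS
  set c₀ := (MvPolynomial.constantCoeff f).natAbs with hc₀
  set V := c₀ * (d + 1) ^ (3 * d * (n + 1)) with hV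
  have hd' : (1 : ℝ) ≤ d := by exact_mod_cast hd
  have hd0 : (0 : ℝ) < d := by linarith
  have hu0 : 0 < u := by linarith
  have hBd : 0 < B ^ d := by positivity
  have hc₀0 : c₀ ≠ 0 := by
    intro h
    rw [hV, h, zero_mul] at hVB
    omega
  have hc : MvPolynomial.constantCoeff f ≠ 0 := Int.natAbs_ne_zero.1 hc₀0
  have hB2 : (2 : ℝ) ≤ B := by exact_mod_cast hB
  set L := Real.log B with hL
  have hL2 : 1 / 2 ≤ L := by
    have := Real.log_two_gt_d9
    have h2 : Real.log 2 ≤ L := Real.log_le_log two_pos hB2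
    linarith
  have hL0 : 0 < L := by linarith
  set x := Real.log V / d - L with hx
  have hlogV : Real.log V = d * (L + x) := by
    rw [hx]
    field_simp
    ring
  have hx0 : 0 ≤ x := by
    rw [hx, sub_nonneg, le_div_iff₀ hd0, mul_comm, hL, ← Real.log_pow]
    refine Real.log_le_log (by positivity) ?_
    exact_mod_cast hVB
  have hH : Real.log c₀ = d * (L + x - 3 * (n + 1) * Real.log (d + 1)) := by
    have h1 : Real.log V = Real.log c₀ + 3 * d * (n + 1) * Real.log (d + 1) := by
      rw [hV, Nat.cast_mul, Nat.cast_pow, Real.log_mul (by exact_mod_cast hc₀0) (by positivity),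
        Real.log_pow]
      push_cast
      ring
    linarith
  have hH0 : 0 ≤ Real.log c₀ := Real.log_nonneg (by exact_mod_cast Nat.one_le_iff_ne_zero.2 hc₀0)
  set Q : ℕ := 4096 * d ^ 4 + ⌈25 * d ^ 2 * Real.log V⌉₊ with hQ
  have hQ1 : 4096 * d ^ 4 ≤ Q := Nat.le_add_right _ _
  have hQ2 : 25 * d ^ 2 * Real.log V ≤ Q := (Nat.le_ceil _).trans (by
    rw [hQ]
    exact_mod_cast Nat.le_add_left _ _)
  have hQ0 : (0 : ℝ) < Q := by
    have : 0 < Q := lt_of_lt_of_le (by positivity) hQ1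
    exact_mod_cast this
  have hd34 : (d : ℝ) ^ 3 * u ≤ d ^ 4 := by
    rw [pow_succ _ 3]
    gcongr
  have hQd : (Q : ℝ) ≤ 8300 * d ^ 4 * L * (1 + x / u) := by
    have h1 : (⌈25 * d ^ 2 * Real.log V⌉₊ : ℝ) ≤ 25 * d ^ 2 * Real.log V + 1 :=
      (Nat.ceil_lt_add_one (by rw [hlogV]; positivity)).le
    have h2 : (d : ℝ) ^ 3 * x ≤ d ^ 4 * (x / u) := by
      rw [← mul_div_assoc, le_div_iff₀ hu0, mul_right_comm]
      gcongr
    have h3 : (d : ℝ) ^ 3 ≤ d ^ 4 := pow_le_pow_right₀ hd' (by norm_num)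
    have h4 : (1 : ℝ) ≤ d ^ 4 := one_le_pow₀ hd'
    have h5 : 0 ≤ x / u := by positivity
    have h6 : (d : ℝ) ^ 3 * L ≤ d ^ 4 * L := by gcongr
    have h7 : (d : ℝ) ^ 4 ≤ d ^ 4 * (2 * L) := le_mul_of_one_le_right (by positivity) (by linarith)
    have h8 : (d : ℝ) ^ 4 * (x / u) ≤ d ^ 4 * (2 * L) * (x / u) := by gcongr
    have h9 : 0 ≤ (d : ℝ) ^ 4 * L * (x / u) := by positivity
    rw [hQ, Nat.cast_add]
    push_cast
    have e1 : 25 * (d : ℝ) ^ 2 * (d * (L + x)) = 25 * (d ^ 3 * L) + 25 * (d ^ 3 * x) := by ring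
    have e2 : 8300 * (d : ℝ) ^ 4 * L * (1 + x / u) =
        4150 * (d ^ 4 * (2 * L)) + 8300 * (d ^ 4 * L * (x / u)) := by ring
    have e3 : (d : ℝ) ^ 4 * (2 * L) * (x / u) = 2 * (d ^ 4 * L * (x / u)) := by ring
    rw [hlogV, e1] at h1
    rw [hlogV, e1, e2]
    linarith
  set s := (shell (n + 1) d (r + d)).card with hs
  have hlogd : Real.log d ≤ n * u := by
    rw [← hud, Real.log_pow]
    gcongr
    linarith [Real.log_le_sub_one_of_pos hu0]
  have hk : Real.log (d + 1) ≤ (1 + n) * u := by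
    have h1 : Real.log (d + 1) ≤ Real.log (2 * d) := Real.log_le_log (by positivity) (by linarith)
    rw [Real.log_mul two_ne_zero hd0.ne'] at h1
    have := Real.log_two_lt_d9
    linarith
  have hκ : Real.log (3 * d) ≤ (2 + n) * u := by
    rw [Real.log_mul three_ne_zero hd0.ne']
    have := Real.log_le_sub_one_of_pos (show (0 : ℝ) < 3 by norm_num)
    linarith
  have hb : Real.log ((2 * d + 1) * B : ℕ) ≤ L + Real.log (3 * d) := by
    rw [hL, ← Real.log_mul (by positivity) (by positivity)]
    refine Real.log_le_log (by positivity) ?_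
    push_cast
    rw [mul_comm (B : ℝ)]
    gcongr
    linarith
  set X := d ^ 4 / u * Real.exp (L / u) * L with hX
  have hexp : 1 ≤ Real.exp (L / u) := Real.one_le_exp (by positivity)
  have hd3 : (d : ℝ) ≤ d ^ 4 / u := by
    rw [le_div_iff₀ hu0]
    have h1 : (1 : ℝ) ≤ d ^ 2 := one_le_pow₀ hd'
    calc (d : ℝ) * u ≤ d * u * d ^ 2 := le_mul_of_one_le_right (by positivity) h1
      _ = d ^ 3 * u := by ring
      _ ≤ _ := hd34
  have hdL : d * L ≤ X := by
    rw [hX]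
    gcongr
    exact hd3.trans (le_mul_of_one_le_right (by positivity) hexp)
  have hdX : d ≤ 2 * X := by
    have : d * (1 / 2) ≤ d * L := by gcongr
    linarith
  have hX0 : 0 < X := by linarith
  obtain ⟨hr0, hMr, hML, hθL, hθ, hθ1⟩ := degree_ratio hn hd' hL0.le hdL hdX
    (show 4 * ((n : ℝ) + 1) ^ 2 ≤ 4 * (n + 1) ^ 2 + 2 * C₂ + 1 by linarith) hK rfl
  set Y : ℝ := (n.factorial * s : ℝ) ^ ((n : ℝ)⁻¹) with hYdef
  have hspos : 0 < (n.factorial * s : ℝ) := by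
    have h1 : (0 : ℝ) < d * r ^ n := by positivity
    exact h1.trans_le (by exact_mod_cast mul_pow_le_card_shell n d r)
  have hY0 : 0 < Y := Real.rpow_pos_of_pos hspos _
  have hYs : Y ^ n = n.factorial * s := Real.rpow_inv_natCast_pow hspos.le (by omega)
  obtain ⟨hs0, hσ, hYr, hN⟩ := shell_estimates hn hd hu hud hY0 hYs
  have hineq := hC d r ((2 * d + 1) * B) Q V f Y hd hf hp hirr hl hc hVl
    ((Nat.pow_le_pow_left hB d).trans hVB)
    (Nat.one_le_iff_ne_zero.2 (by positivity)) hS hQ1 hQ2 hY0 hYs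
  have hratio := log_ratio_le hn hs0 hY0 (by positivity) hu hr0 hd0 hL0.le hx0
    (Real.log_nonneg (by linarith)) (Real.log_nonneg (by linarith)) hineq hσ hYr hN hH hH0 hb hMr
    hML hθL hθ hθ1 hk hκ
  have hYle := le_of_log_ratio_le hn hY0 hQ0 hu hL0.le (by norm_num) hx0 hratio hQd
  have h1 : (d : ℝ) ^ 4 * L * Real.exp (L / u) = u * X := by
    rw [hX]
    field_simp
  rw [h1] at hYle
  have h2 : u * r ≤ u * (C₂ * X) := hYr.trans (hYle.trans_eq (by ring))
  have h3 : r ≤ C₂ * X := le_of_mul_le_mul_left h2 hu0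
  have h4 : 0 < (4 * ((n : ℝ) + 1) ^ 2 + 1) * X := by positivity
  have h5 : (4 * ((n : ℝ) + 1) ^ 2 + 2 * C₂ + 1) * X =
      (4 * ((n : ℝ) + 1) ^ 2 + 1) * X + 2 * (C₂ * X) := by ring
  linarith

end Estimate

end AuxPoly

open MvPolynomial

/-- Existence of auxiliary polynomials: for `n ≥ 1` there is `c = c(n)` such that for every
primitive polynomial `f ∈ ℤ[x₁,…,x_{n+1}]` of degree `d ≥ 1` irreducible over ℚ and every integer
`B ≥ 2` there is a nonzero polynomial `g`, not divisible by `f`, of degree at most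
`c·d^{4-1/n}·B^{1/d^{1/n}}·log B`, vanishing on all integral points of `f = 0` of height `≤ B`. -/
theorem auxiliary_polynomial_exists (n : ℕ) (hn : 1 ≤ n) :
    ∃ c : ℝ, ∀ (f : MvPolynomial (Fin (n + 1)) ℤ) (d : ℕ), f.totalDegree = d → 1 ≤ d →
      (∀ k : ℤ, (∀ m, k ∣ MvPolynomial.coeff m f) → IsUnit k) →
      Irreducible (MvPolynomial.map (Int.castRingHom ℚ) f) →
      ∀ B : ℕ, 2 ≤ B →
        ∃ g : MvPolynomial (Fin (n + 1)) ℤ, g ≠ 0 ∧ ¬ f ∣ g ∧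
          (g.totalDegree : ℝ) ≤ c * (d : ℝ) ^ ((4 : ℝ) - 1 / (n : ℝ))
              * (B : ℝ) ^ (1 / (d : ℝ) ^ ((1 : ℝ) / (n : ℝ))) * Real.log B ∧
          ∀ x : Fin (n + 1) → ℤ, MvPolynomial.eval x f = 0 → (∀ i, |x i| ≤ (B : ℤ)) →
            MvPolynomial.eval x g = 0 := by
  obtain ⟨K, hK1, hK⟩ := AuxPoly.exists_not_dvd n hn
  refine ⟨K + 4, fun f d hf hd hprim hirr B hB => ?_⟩
  have hp : Prime f := AuxPoly.prime_of_primitive hprim hirr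
  have hn' : (1 : ℝ) ≤ n := by exact_mod_cast hn
  have hd' : (1 : ℝ) ≤ d := by exact_mod_cast hd
  have hd0 : (0 : ℝ) < d := by linarith
  have hB2 : (2 : ℝ) ≤ B := by exact_mod_cast hB
  set u : ℝ := (d : ℝ) ^ ((1 : ℝ) / (n : ℝ)) with hu_def
  have hu : 1 ≤ u := Real.one_le_rpow hd' (by positivity)
  have hu0 : 0 < u := by linarith
  have hu' : u ≤ d := Real.rpow_le_self_of_one_le hd' ((div_le_one (by linarith)).2 hn')
  have hud : u ^ n = d := by
    rw [hu_def, one_div]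
    exact Real.rpow_inv_natCast_pow hd0.le (by omega)
  have hpow : (d : ℝ) ^ ((4 : ℝ) - 1 / (n : ℝ)) = d ^ 4 / u := by
    rw [Real.rpow_sub hd0]
    norm_cast
  have hexp : (B : ℝ) ^ (1 / u) = Real.exp (Real.log B / u) := by
    rw [Real.rpow_def_of_pos (by linarith), mul_one_div]
  have hL : 1 / 2 ≤ Real.log B := by
    have h1 := Real.log_two_gt_d9
    have h2 : Real.log 2 ≤ Real.log B := Real.log_le_log two_pos hB2
    linarith
  rw [hpow, hexp]
  set X := d ^ 4 / u * Real.exp (Real.log B / u) * Real.log B with hX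
  have hKX : (K + 4) * (d ^ 4 / u) * Real.exp (Real.log B / u) * Real.log B = (K + 4) * X := by
    rw [hX]
    ring
  rw [hKX]
  have hdX : d ≤ 2 * X := by
    have h1 : (d : ℝ) ≤ d ^ 4 / u := by
      rw [le_div_iff₀ hu0]
      calc (d : ℝ) * u ≤ d * d := by gcongr
        _ = d ^ 2 := by ring
        _ ≤ d ^ 4 := pow_le_pow_right₀ hd' (by norm_num)
    have h2 : (1 : ℝ) ≤ Real.exp (Real.log B / u) := Real.one_le_exp (by positivity)
    have h3 : d * 1 * (1 / 2) ≤ X := by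
      rw [hX]
      gcongr
    linarith
  have hX0 : 0 < X := by linarith
  by_cases hC : Irreducible (MvPolynomial.map (Int.castRingHom ℂ) f)
  · obtain ⟨f₂, hf₂, hp₂, hC₂, hl, hV, hBV, hg⟩ :=
      AuxPoly.exists_normalization hf hd hp hC (show 1 ≤ B by omega)
    set r := ⌈K * X⌉₊ with hr
    have hrX : K * X ≤ r + d := (Nat.le_ceil _).trans (by linarith)
    obtain ⟨g₂, hdeg, hg₂, hdvd⟩ := hK d r B f₂ u hd hB hf₂ hp₂ hC₂ hl hV hBV hu hu' hud hrX
    obtain ⟨g, hfg, hgd, hgx⟩ := hg g₂ hdvd hg₂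
    refine ⟨g, fun h => hfg (h ▸ dvd_zero f), hfg, ?_, hgx⟩
    have h1 : (g.totalDegree : ℝ) ≤ r + d := by
      rw [hgd]
      exact_mod_cast hdeg
    have h2 : (r : ℝ) ≤ K * X + 1 := (Nat.ceil_lt_add_one (by positivity)).le
    linarith
  · obtain ⟨g, hg0, hfg, hgd, hg⟩ := AuxPoly.exists_of_not_irreducible (by omega) hp hC
    refine ⟨g, hg0, hfg, ?_, fun x hx _ => hg x hx⟩
    have h1 : (g.totalDegree : ℝ) ≤ d := by
      rw [← hf]
      exact_mod_cast hgd
    nlinarith
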